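/- arXiv:1801.04862 — 2 statements merged into one kernel-verified Lean document; each statement's English description precedes it below -/
import Mathlib

section
/- Let g : ℝ^(n0+n1) → Sym⁺_d(ℝ) be C² and N-log-concave, with ∫_{ℝ^{n1}} |g(t,y)| dy < ∞ for all t; set α(t) := ∫_{ℝ^{n1}} g(t,y) dy and assume α is C² with Sym⁺_d values, with derivatives obtained by differentiation under the integral sign. Fix t ∈ ℝ^{n0} and V₀ = [v_1,…,v_{n0}] ∈ M_{d,n0}(ℝ), assume the block operator Θ^g_{1,1}(t,y) is invertible on M_{d,n1}(ℝ) for every y, and set F(y) := Σ_{j=1}^{n0} (g(t,y)⁻¹ ∂_{t_j} g(t,y)) v_j. Then ⟨−Θ^α(t) V₀, V₀⟩_{id_{n0}⊗α(t)} ≥ ∫_{ℝ^{n1}} ⟨(−Θ^g_{1,1}(t,y))⁻¹ ∇_y F, ∇_y F⟩_{id_{n1}⊗g(t,y)} dy − ∫_{ℝ^{n1}} ‖F(y) − α(t)⁻¹ ∫_{ℝ^{n1}} g(t,z) F(z) dz‖²_{g(t,y)} dy. -/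
open Matrix MeasureTheory

noncomputable section

/-- Entrywise partial derivative, in direction `x_j`, of a matrix-valued function. -/
def mpd {n d : ℕ} (j : Fin n) (g : (Fin n → ℝ) → Matrix (Fin d) (Fin d) ℝ)
    (x : Fin n → ℝ) : Matrix (Fin d) (Fin d) ℝ :=
  Matrix.of fun i k => fderiv ℝ (fun y => g y i k) x (Pi.single j 1)

/-- `θ^g_{j,k}(x) = g(x)⁻¹ (∂²_{x_k x_j} g(x) − (∂_{x_k} g)(x) g(x)⁻¹ (∂_{x_j} g)(x))`. -/
def theta {n d : ℕ} (g : (Fin n → ℝ) → Matrix (Fin d) (Fin d) ℝ) (j k : Fin n)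
    (x : Fin n → ℝ) : Matrix (Fin d) (Fin d) ℝ :=
  (g x)⁻¹ * (mpd k (mpd j g) x - mpd k g x * (g x)⁻¹ * mpd j g x)

/-- The operator `Θ^g(x)` on `M_{d,n}(ℝ)`: a `d×n` matrix is encoded by its columns
`U : Fin n → Fin d → ℝ`, and the `k`-th column of `Θ^g(x) U` is `Σ_j θ^g_{j,k}(x) u_j`. -/
def ThetaOp {n d : ℕ} (g : (Fin n → ℝ) → Matrix (Fin d) (Fin d) ℝ)
    (x : Fin n → ℝ) (U : Fin n → Fin d → ℝ) : Fin n → Fin d → ℝ :=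
  fun k => ∑ j, (theta g j k x).mulVec (U j)

/-- `⟨U,V⟩_{id_n ⊗ a} = Σ_k ⟨a u_k, v_k⟩` on `M_{d,n}(ℝ)` (matrices given by columns). -/
def minner {n d : ℕ} (a : Matrix (Fin d) (Fin d) ℝ)
    (U V : Fin n → Fin d → ℝ) : ℝ :=
  ∑ k, a.mulVec (U k) ⬝ᵥ V k

/-- `‖u‖²_a = ⟨a u, u⟩` on `ℝ^d`. -/
def vnormSq {d : ℕ} (a : Matrix (Fin d) (Fin d) ℝ) (u : Fin d → ℝ) : ℝ :=
  a.mulVec u ⬝ᵥ u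

/-- N-log-concavity: `⟨Θ^g(x) U, U⟩_{id_n ⊗ g(x)} ≤ 0` for all `x` and `U`. -/
def NLogConcave {n d : ℕ} (g : (Fin n → ℝ) → Matrix (Fin d) (Fin d) ℝ) : Prop :=
  ∀ (x : Fin n → ℝ) (U : Fin n → Fin d → ℝ), minner (g x) (ThetaOp g x U) U ≤ 0

/-- Entrywise `C^k` smoothness of a matrix-valued function. -/
def MatCD {n d : ℕ} (k : ℕ) (g : (Fin n → ℝ) → Matrix (Fin d) (Fin d) ℝ) : Prop :=
  ∀ i j, ContDiff ℝ k fun y => g y i j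

/-- Polar of a nonnegative quadratic form `Q` with respect to a bilinear pairing `inn`:
`Q°(v) = sup { ⟨u,v⟩² : Q(u) ≤ 1 }`. -/
def polar {E : Type*} (inn : E → E → ℝ) (Q : E → ℝ) (v : E) : ℝ :=
  sSup {r | ∃ u, Q u ≤ 1 ∧ r = inn u v ^ 2}

/-- Partial derivative `∂_{x_j} F` of a vector-valued function. -/
def pdF {n d : ℕ} (j : Fin n) (F : (Fin n → ℝ) → Fin d → ℝ) (x : Fin n → ℝ) : Fin d → ℝ :=
  fun i => fderiv ℝ (fun y => F y i) x (Pi.single j 1)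

/-- `∇_x F = [∂_{x_1} F, …, ∂_{x_n} F] ∈ M_{d,n}(ℝ)`, encoded by columns. -/
def gradM {n d : ℕ} (F : (Fin n → ℝ) → Fin d → ℝ) (x : Fin n → ℝ) :
    Fin n → Fin d → ℝ :=
  fun j => pdF j F x

/-- The operator `L F = Δ F + Σ_k (g⁻¹ ∂_{x_k} g) ∂_{x_k} F`. -/
def Lop {n d : ℕ} (g : (Fin n → ℝ) → Matrix (Fin d) (Fin d) ℝ)
    (F : (Fin n → ℝ) → Fin d → ℝ) (x : Fin n → ℝ) : Fin d → ℝ :=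
  (∑ k, pdF k (pdF k F) x) + ∑ k, ((g x)⁻¹ * mpd k g x).mulVec (pdF k F x)

/-- `Θ^g(x)` realized as a `dn × dn` matrix acting on `ℝ^{n×d} ≅ M_{d,n}(ℝ)`. -/
def ThetaMat {n d : ℕ} (g : (Fin n → ℝ) → Matrix (Fin d) (Fin d) ℝ)
    (x : Fin n → ℝ) : Matrix (Fin n × Fin d) (Fin n × Fin d) ℝ :=
  Matrix.of fun p q => theta g q.1 p.1 x p.2 q.2

/-- Identification `M_{d,n}(ℝ) → ℝ^{n×d}`. -/
def toVec {n d : ℕ} (U : Fin n → Fin d → ℝ) : Fin n × Fin d → ℝ := fun p => U p.1 p.2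

/-- Identification `ℝ^{n×d} → M_{d,n}(ℝ)`. -/
def ofVec {n d : ℕ} (v : Fin n × Fin d → ℝ) : Fin n → Fin d → ℝ := fun k i => v (k, i)

/-- The block `Θ^g_{0,0}` on `M_{d,n0}(ℝ)`. -/
def Theta00 {n0 n1 d : ℕ} (g : (Fin (n0 + n1) → ℝ) → Matrix (Fin d) (Fin d) ℝ)
    (x : Fin (n0 + n1) → ℝ) (V : Fin n0 → Fin d → ℝ) : Fin n0 → Fin d → ℝ :=
  fun k => ∑ j, (theta g (Fin.castAdd n1 j) (Fin.castAdd n1 k) x).mulVec (V j)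

/-- The mixed block `Θ^g_{0,1} : M_{d,n0}(ℝ) → M_{d,n1}(ℝ)`. -/
def Theta01 {n0 n1 d : ℕ} (g : (Fin (n0 + n1) → ℝ) → Matrix (Fin d) (Fin d) ℝ)
    (x : Fin (n0 + n1) → ℝ) (V : Fin n0 → Fin d → ℝ) : Fin n1 → Fin d → ℝ :=
  fun k => ∑ j, (theta g (Fin.castAdd n1 j) (Fin.natAdd n0 k) x).mulVec (V j)

/-- The block `Θ^g_{1,1}` on `M_{d,n1}(ℝ)`. -/
def Theta11 {n0 n1 d : ℕ} (g : (Fin (n0 + n1) → ℝ) → Matrix (Fin d) (Fin d) ℝ)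
    (x : Fin (n0 + n1) → ℝ) (W : Fin n1 → Fin d → ℝ) : Fin n1 → Fin d → ℝ :=
  fun k => ∑ j, (theta g (Fin.natAdd n0 j) (Fin.natAdd n0 k) x).mulVec (W j)

/-- The block `Θ^g_{1,1}` realized as a `d n1 × d n1` matrix. -/
def Theta11Mat {n0 n1 d : ℕ} (g : (Fin (n0 + n1) → ℝ) → Matrix (Fin d) (Fin d) ℝ)
    (x : Fin (n0 + n1) → ℝ) : Matrix (Fin n1 × Fin d) (Fin n1 × Fin d) ℝ :=
  Matrix.of fun p q => theta g (Fin.natAdd n0 q.1) (Fin.natAdd n0 p.1) x p.2 q.2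

/-- The `dn × dn` matrix `Θ̃^g(x)` with `(j,k)` block `g(x) θ^g_{j,k}(x)`. -/
def tThetaMat {n d : ℕ} (g : (Fin n → ℝ) → Matrix (Fin d) (Fin d) ℝ)
    (x : Fin n → ℝ) : Matrix (Fin n × Fin d) (Fin n × Fin d) ℝ :=
  Matrix.of fun p q => (g x * theta g q.1 p.1 x) p.2 q.2

/-- Hessian matrix of a scalar function on `ℝⁿ`. -/
def Hess {n : ℕ} (φ : (Fin n → ℝ) → ℝ) (y : Fin n → ℝ) : Matrix (Fin n) (Fin n) ℝ :=
  Matrix.of fun j k => fderiv ℝ (fun z => fderiv ℝ φ z (Pi.single k 1)) y (Pi.single j 1)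

/-- Gradient of a scalar function on `ℝⁿ`. -/
def gradV {n : ℕ} (u : (Fin n → ℝ) → ℝ) (y : Fin n → ℝ) : Fin n → ℝ :=
  fun j => fderiv ℝ u y (Pi.single j 1)

section PosDefOp
set_option maxSynthPendingDepth 3
open scoped InnerProductSpace Topology
open Filter

variable {H : Type*} [NormedAddCommGroup H] [InnerProductSpace ℝ H]

/-- Symmetric positive definite operators. -/
structure PosDefOp (L : H →L[ℝ] H) : Prop where
  symm : ∀ u v, ⟪L u, v⟫_ℝ = ⟪L v, u⟫_ℝ
  pos : ∀ u, u ≠ 0 → 0 < ⟪L u, u⟫_ℝ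

/-- A symmetric operator is determined by its quadratic form. -/
theorem eq_of_quadratic {A B : H →L[ℝ] H} (hA : ∀ u v, ⟪A u, v⟫_ℝ = ⟪A v, u⟫_ℝ)
    (hB : ∀ u v, ⟪B u, v⟫_ℝ = ⟪B v, u⟫_ℝ) (h : ∀ u, ⟪A u, u⟫_ℝ = ⟪B u, u⟫_ℝ) : A = B := by
  ext u
  refine ext_inner_right ℝ fun v => ?_
  have h1 := h (u + v)
  simp only [map_add, inner_add_left, inner_add_right] at h1
  have := h u
  have := h v
  have := hA u v
  have := hB u v
  linarith

namespace PosDefOp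

variable {L M : H →L[ℝ] H}

theorem nonneg (hL : PosDefOp L) (u : H) : 0 ≤ ⟪L u, u⟫_ℝ := by
  by_cases h : u = 0
  · simp [h]
  · exact (hL.pos u h).le

variable [FiniteDimensional ℝ H]

theorem isUnit (hL : PosDefOp L) : IsUnit L := by
  have hinj : Function.Injective (L : H →ₗ[ℝ] H) := by
    rw [← LinearMap.ker_eq_bot, LinearMap.ker_eq_bot']
    intro u hu
    by_contra h
    have := hL.pos u h
    have h2 : L u = 0 := hu
    simp [h2] at this
  have hunit : IsUnit (L : H →ₗ[ℝ] H) :=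
    (LinearMap.isUnit_iff_ker_eq_bot _).2 (LinearMap.ker_eq_bot.2 hinj)
  obtain ⟨v, hv⟩ := hunit
  refine ⟨⟨L, LinearMap.toContinuousLinearMap (v⁻¹ : (H →ₗ[ℝ] H)ˣ).1, ?_, ?_⟩, rfl⟩
  · ext u
    have := congrArg (fun f : H →ₗ[ℝ] H => f u) v.mul_inv
    rw [hv] at this
    simpa using this
  · ext u
    have := congrArg (fun f : H →ₗ[ℝ] H => f u) v.inv_mul
    rw [hv] at this
    simpa using this

theorem apply_inverse (hL : PosDefOp L) (u : H) : L (Ring.inverse L u) = u := by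
  simpa using congrArg (fun f : H →L[ℝ] H => f u) (Ring.mul_inverse_cancel L hL.isUnit)

theorem inverse_apply (hL : PosDefOp L) (u : H) : Ring.inverse L (L u) = u := by
  simpa using congrArg (fun f : H →L[ℝ] H => f u) (Ring.inverse_mul_cancel L hL.isUnit)

theorem inverse (hL : PosDefOp L) : PosDefOp (Ring.inverse L) := by
  refine ⟨fun u v => ?_, fun u hu => ?_⟩
  · have := hL.symm (Ring.inverse L u) (Ring.inverse L v)
    rw [hL.apply_inverse, hL.apply_inverse] at this
    rw [real_inner_comm, ← this, real_inner_comm, real_inner_comm]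
  · have h : Ring.inverse L u ≠ 0 := by
      intro h
      have := hL.apply_inverse u
      rw [h, map_zero] at this
      exact hu this.symm
    have := hL.pos _ h
    rwa [hL.apply_inverse, real_inner_comm] at this

/-- The variational characterization of the inverse quadratic form. -/
theorem two_inner_sub_le (hL : PosDefOp L) (w c : H) :
    2 * ⟪w, c⟫_ℝ - ⟪L c, c⟫_ℝ ≤ ⟪Ring.inverse L w, w⟫_ℝ := by
  have h := hL.nonneg (c - Ring.inverse L w)
  have h1 := hL.symm c (Ring.inverse L w)
  simp only [map_sub, inner_sub_left, inner_sub_right, hL.apply_inverse] at h h1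
  rw [h1] at h
  rw [real_inner_comm w (Ring.inverse L w)]
  linarith

theorem inverse_anti (hL : PosDefOp L) (hM : PosDefOp M) (h : ∀ u, ⟪L u, u⟫_ℝ ≤ ⟪M u, u⟫_ℝ)
    (u : H) : ⟪Ring.inverse M u, u⟫_ℝ ≤ ⟪Ring.inverse L u, u⟫_ℝ := by
  have h1 := hL.two_inner_sub_le u (Ring.inverse M u)
  have h2 := h (Ring.inverse M u)
  rw [hM.apply_inverse] at h2
  have h3 := real_inner_comm u (Ring.inverse M u)
  linarith

theorem inverse_inverse (hL : PosDefOp L) : Ring.inverse (Ring.inverse L) = L := by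
  obtain ⟨v, rfl⟩ := hL.isUnit
  rw [Ring.inverse_unit, Ring.inverse_unit, inv_inv]

variable [CompleteSpace H]

theorem continuousAt_inverse (hL : PosDefOp L) : ContinuousAt Ring.inverse L := by
  obtain ⟨v, rfl⟩ := hL.isUnit
  exact NormedRing.inverse_continuousAt v

end PosDefOp

variable [FiniteDimensional ℝ H]

/-- Operator convergence can be tested on matrix coefficients. -/
theorem exists_tendsto_of_inner {P : Type*} {l : Filter P} {f : P → H →L[ℝ] H}
    (h : ∀ u v, ∃ c, Tendsto (fun p => ⟪f p u, v⟫_ℝ) l (𝓝 c)) : ∃ M, Tendsto f l (𝓝 M) := by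
  choose c hc using h
  let b := stdOrthonormalBasis ℝ H
  let E : Fin (Module.finrank ℝ H) → Fin (Module.finrank ℝ H) → H →L[ℝ] H :=
    fun i j => (innerSL ℝ (b j)).smulRight (b i)
  have key : ∀ L : H →L[ℝ] H, L = ∑ i, ∑ j, ⟪L (b j), b i⟫_ℝ • E i j := by
    intro L
    ext u
    simp only [_root_.sum_apply, _root_.smul_apply, E,
      ContinuousLinearMap.smulRight_apply, innerSL_apply_apply, smul_smul]
    conv_lhs => rw [← b.sum_repr' (L u)]
    refine Finset.sum_congr rfl fun i _ => ?_
    rw [← Finset.sum_smul]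
    congr 1
    conv_lhs => rw [← b.sum_repr' u]
    simp [map_sum, inner_sum, inner_smul_right, real_inner_comm, mul_comm]
  refine ⟨∑ i, ∑ j, c (b j) (b i) • E i j, ?_⟩
  rw [show f = fun p => ∑ i, ∑ j, ⟪f p (b j), b i⟫_ℝ • E i j from funext fun p => key (f p)]
  exact tendsto_finsetSum _ fun i _ => tendsto_finsetSum _ fun j _ => (hc _ _).smul_const _

/-- For symmetric operators it suffices to test convergence on the quadratic form. -/
theorem exists_tendsto_of_quadratic {P : Type*} {l : Filter P} {f : P → H →L[ℝ] H}
    (hs : ∀ p u v, ⟪f p u, v⟫_ℝ = ⟪f p v, u⟫_ℝ)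
    (h : ∀ u, ∃ c, Tendsto (fun p => ⟪f p u, u⟫_ℝ) l (𝓝 c)) : ∃ M, Tendsto f l (𝓝 M) := by
  choose c hc using h
  refine exists_tendsto_of_inner fun u v => ⟨(c (u + v) - c u - c v) / 2, ?_⟩
  have := (((hc (u + v)).sub (hc u)).sub (hc v)).div_const 2
  refine this.congr fun p => ?_
  simp only [map_add, inner_add_left, inner_add_right]
  rw [hs p v u]
  ring

end PosDefOp

section OneDim
set_option maxSynthPendingDepth 3
open scoped InnerProductSpace Topology Interval
open Filter

variable {H : Type*} [NormedAddCommGroup H] [InnerProductSpace ℝ H] [CompleteSpace H]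

theorem PosDefOp.intervalIntegral {γ : ℝ → H →L[ℝ] H} {a b : ℝ} (hab : a < b)
    (hγ : Continuous γ) (hpos : ∀ s, PosDefOp (γ s)) : PosDefOp (∫ s in a..b, γ s) := by
  have key : ∀ u v, ⟪(∫ s in a..b, γ s) u, v⟫_ℝ = ∫ s in a..b, ⟪γ s u, v⟫_ℝ := by
    intro u v
    rw [ContinuousLinearMap.intervalIntegral_apply (hγ.intervalIntegrable _ _), real_inner_comm,
      ← innerSL_apply_apply (𝕜 := ℝ),
      ← ContinuousLinearMap.intervalIntegral_comp_comm _
        ((hγ.clm_apply continuous_const).intervalIntegrable _ _)]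
    simp [real_inner_comm]
  refine ⟨fun u v => ?_, fun u hu => ?_⟩
  · simp only [key, (hpos _).symm u v]
  · rw [key]
    refine intervalIntegral.intervalIntegral_pos_of_pos ?_ (fun s => (hpos s).pos u hu) hab
    exact ((hγ.clm_apply continuous_const).inner continuous_const).intervalIntegrable _ _

variable [FiniteDimensional ℝ H]

/-- One-dimensional integrated inequality for the Schur-complement form. -/
theorem integral_le_of_le_schur {γ γ' γ'' : ℝ → H →L[ℝ] H} {w w' : ℝ → H} {D S : ℝ → ℝ} {a b : ℝ}
    (hab : a < b) (hγ : ∀ s, HasDerivAt γ (γ' s) s) (hγ' : ∀ s, HasDerivAt γ' (γ'' s) s)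
    (hγ'' : Continuous γ'') (hw : ∀ s, HasDerivAt w (w' s) s) (hw' : Continuous w')
    (hpos : ∀ s, PosDefOp (γ s)) (hD : Continuous D) (hS : Continuous S)
    (h : ∀ s u, D s ≤ -S s - 2 * ⟪w' s, u⟫_ℝ - ⟪γ'' s u, u⟫_ℝ
      + ⟪Ring.inverse (γ s) (w s + γ' s u), w s + γ' s u⟫_ℝ) :
    ∫ s in a..b, D s ≤ -(∫ s in a..b, S s)
      + ⟪Ring.inverse (∫ s in a..b, γ s) (∫ s in a..b, w s), ∫ s in a..b, w s⟫_ℝ := by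
  have cγ : Continuous γ := continuous_iff_continuousAt.2 fun s => (hγ s).continuousAt
  have cγ' : Continuous γ' := continuous_iff_continuousAt.2 fun s => (hγ' s).continuousAt
  have cw : Continuous w := continuous_iff_continuousAt.2 fun s => (hw s).continuousAt
  have hA := PosDefOp.intervalIntegral hab cγ hpos
  set A := ∫ s in a..b, γ s with hAdef
  set β := ∫ s in a..b, w s with hβ
  set c := Ring.inverse A β with hc
  let Z : ℝ → H := fun s => -∫ r in a..s, (w r - γ r c)
  have cz : Continuous fun r => w r - γ r c := cw.sub (cγ.clm_apply continuous_const)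
  have hZ : ∀ s, HasDerivAt Z (-(w s - γ s c)) s := fun s =>
    (intervalIntegral.integral_hasDerivAt_right (cz.intervalIntegrable _ _)
      (cz.stronglyMeasurableAtFilter _ _) cz.continuousAt).neg
  have hZa : Z a = 0 := by simp [Z]
  have hZb : Z b = 0 := by
    simp only [Z]
    rw [intervalIntegral.integral_sub (cw.intervalIntegrable _ _)
      ((cγ.clm_apply continuous_const).intervalIntegrable _ _),
      ← ContinuousLinearMap.intervalIntegral_apply (cγ.intervalIntegrable _ _), ← hAdef, ← hβ, hc,
      hA.apply_inverse, sub_self, neg_zero]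
  let U : ℝ → H := fun s => Ring.inverse (γ s) (Z s)
  have hγU : ∀ s, γ s (U s) = Z s := fun s => (hpos s).apply_inverse _
  have dinv : ∀ s, DifferentiableAt ℝ (fun s => Ring.inverse (γ s)) s := by
    intro s
    obtain ⟨v, hv⟩ := (hpos s).isUnit
    have h1 := hasFDerivAt_ringInverse (𝕜 := ℝ) v
    rw [hv] at h1
    exact (h1.comp_hasDerivAt s (hγ s)).differentiableAt
  have cinv : Continuous fun s => Ring.inverse (γ s) :=
    continuous_iff_continuousAt.2 fun s => (dinv s).continuousAt
  let R : ℝ → H := fun s => w s + γ' s (U s)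
  have dU : ∀ s, HasDerivAt U (c - Ring.inverse (γ s) (R s)) s := by
    intro s
    have h1 : HasDerivAt U (deriv U s) s :=
      ((dinv s).clm_apply (hZ s).differentiableAt).hasDerivAt
    have h2 := (hγ s).clm_apply h1
    have h3 : HasDerivAt (fun y => γ y (U y)) (-(w s - γ s c)) s := by
      simpa only [hγU] using hZ s
    have h4 := h2.unique h3
    have h5 : γ s (deriv U s) = γ s c - R s := by
      simp only [R]
      rw [eq_sub_of_add_eq' h4]; abel
    have h6 := congrArg (fun x => Ring.inverse (γ s) x) h5
    rw [(hpos s).inverse_apply, map_sub, (hpos s).inverse_apply] at h6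
    rwa [h6] at h1
  have cU : Continuous U := continuous_iff_continuousAt.2 fun s => (dU s).continuousAt
  have cR : Continuous R := cw.add (cγ'.clm_apply cU)
  have hγ'symm : ∀ s u v, ⟪γ' s u, v⟫_ℝ = ⟪γ' s v, u⟫_ℝ := by
    intro s u v
    have key : ∀ u v, HasDerivAt (fun s => ⟪γ s u, v⟫_ℝ) ⟪γ' s u, v⟫_ℝ s := fun u v => by
      simpa using ((hγ s).clm_apply (hasDerivAt_const s u)).inner ℝ (hasDerivAt_const s v)
    refine (key u v).unique ?_
    simpa only [(hpos _).symm u v] using key v u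
  let P : ℝ → ℝ := fun s => ⟪2 • w s + γ' s (U s), U s⟫_ℝ
  let U' : ℝ → H := fun s => c - Ring.inverse (γ s) (R s)
  let P' : ℝ → ℝ := fun s => 2 * ⟪w' s, U s⟫_ℝ + ⟪γ'' s (U s), U s⟫_ℝ + 2 * ⟪R s, U' s⟫_ℝ
  have cU' : Continuous U' := continuous_const.sub (cinv.clm_apply cR)
  have hP : ∀ s, HasDerivAt P (P' s) s := by
    intro s
    have h1 : HasDerivAt (fun t => (2 : ℝ) • w t + γ' t (U t))
        ((2 : ℝ) • w' s + (γ'' s (U s) + γ' s (U' s))) s :=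
      ((hw s).const_smul (2 : ℝ)).add ((hγ' s).clm_apply (dU s))
    have h2 : P = fun t => ⟪(2 : ℝ) • w t + γ' t (U t), U t⟫_ℝ := by
      funext t; simp only [P, two_smul]
    rw [h2]
    refine (h1.inner ℝ (dU s)).congr_deriv ?_
    have hs := hγ'symm s (U' s) (U s)
    simp only [P', U', R, inner_add_left, inner_smul_left, conj_trivial] at hs ⊢
    rw [hs]
    ring
  have cP' : Continuous P' := by
    have := hw'.inner (𝕜 := ℝ) cU
    have := (hγ''.clm_apply cU).inner (𝕜 := ℝ) cU
    have := cR.inner (𝕜 := ℝ) cU'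
    fun_prop
  have hPint : ∫ s in a..b, P' s = 0 := by
    rw [intervalIntegral.integral_eq_sub_of_hasDerivAt (fun s _ => hP s)
      (cP'.intervalIntegrable _ _)]
    simp [P, U, hZa, hZb]
  have cq : Continuous fun s => ⟪γ s c, c⟫_ℝ :=
    (cγ.clm_apply continuous_const).inner continuous_const
  have hqint : ∫ s in a..b, ⟪γ s c, c⟫_ℝ = ⟪Ring.inverse A β, β⟫_ℝ := by
    have : ∀ s, ⟪γ s c, c⟫_ℝ = innerSL ℝ c (γ s c) := fun s => by
      simp [real_inner_comm]
    simp only [this]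
    rw [ContinuousLinearMap.intervalIntegral_comp_comm _
        ((cγ.clm_apply continuous_const).intervalIntegrable _ _),
        ← ContinuousLinearMap.intervalIntegral_apply (cγ.intervalIntegrable _ _), ← hAdef, hc,
        hA.apply_inverse, innerSL_apply_apply]
  have main : ∀ s, D s ≤ -S s - P' s + ⟪γ s c, c⟫_ℝ := by
    intro s
    refine (h s (U s)).trans ?_
    have hR : R s = γ s c - γ s (U' s) := by
      simp [U', (hpos s).apply_inverse]
    have h1 : ⟪Ring.inverse (γ s) (R s), R s⟫_ℝ
        = ⟪γ s c, c⟫_ℝ - 2 * ⟪R s, U' s⟫_ℝ - ⟪γ s (U' s), U' s⟫_ℝ := by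
      have h2 : Ring.inverse (γ s) (R s) = c - U' s := by simp [U']
      rw [h2, hR]
      have h3 := (hpos s).symm c (U' s)
      simp only [inner_sub_left, inner_sub_right]
      rw [real_inner_comm (γ s c) c, real_inner_comm (γ s (U' s)) c, real_inner_comm (γ s c) (U' s),
        real_inner_comm (γ s (U' s)) (U' s), h3]
      ring
    have h4 := (hpos s).nonneg (U' s)
    simp only [P', R] at h1 ⊢
    linarith
  calc ∫ s in a..b, D s ≤ ∫ s in a..b, (-S s - P' s + ⟪γ s c, c⟫_ℝ) :=
        intervalIntegral.integral_mono hab.le (hD.intervalIntegrable _ _)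
          (((hS.neg.sub cP').add cq).intervalIntegrable _ _) main
    _ = _ := by
        have h1 := intervalIntegral.integral_add (μ := volume)
          ((hS.neg.sub cP').intervalIntegrable a b) (cq.intervalIntegrable a b)
        have h2 := intervalIntegral.integral_sub (μ := volume)
          (hS.neg.intervalIntegrable a b) (cP'.intervalIntegrable a b)
        have h3 := intervalIntegral.integral_neg (μ := volume) (a := a) (b := b) (f := S)
        simp only [Pi.sub_apply, Pi.neg_apply] at h1 h2
        linarith

end OneDim

section BoxIntegral
set_option maxSynthPendingDepth 3
open scoped InnerProductSpace Topology Interval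
open Filter

/-- A half-open box. -/
def hbox {n : ℕ} (a b : Fin n → ℝ) : Set (Fin n → ℝ) :=
  Set.univ.pi fun i => Set.Ioc (a i) (b i)

theorem measurableSet_hbox {n : ℕ} (a b : Fin n → ℝ) : MeasurableSet (hbox a b) :=
  MeasurableSet.univ_pi fun _ => measurableSet_Ioc

theorem hbox_subset_Icc {n : ℕ} (a b : Fin n → ℝ) : hbox a b ⊆ Set.Icc a b := fun _ hy =>
  ⟨fun i => (hy i trivial).1.le, fun i => (hy i trivial).2⟩

theorem restrict_hbox {n : ℕ} (a b : Fin n → ℝ) :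
    (volume : Measure (Fin n → ℝ)).restrict (hbox a b) = volume.restrict (Set.Icc a b) :=
  Measure.restrict_congr_set Measure.univ_pi_Ioc_ae_eq_Icc

variable {E V : Type*} [NormedAddCommGroup E] [NormedSpace ℝ E]
  [NormedAddCommGroup V]

theorem Continuous.integrableOn_hbox {n : ℕ} {Ψ : (Fin n → ℝ) → V} (h : Continuous Ψ)
    (a b : Fin n → ℝ) : IntegrableOn Ψ (hbox a b) :=
  (h.continuousOn.integrableOn_compact isCompact_Icc).mono_set (hbox_subset_Icc a b)

variable [NormedSpace ℝ V]

/-- Fubini for boxes, splitting off the first coordinate. -/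
theorem setIntegral_hbox_succ {n : ℕ} {Ψ : (Fin (n + 1) → ℝ) → V} (h : Continuous Ψ)
    (a b : Fin (n + 1) → ℝ) (hab : a 0 ≤ b 0) :
    ∫ y in hbox a b, Ψ y
      = ∫ s in (a 0)..(b 0), ∫ y in hbox (Fin.tail a) (Fin.tail b), Ψ (Fin.cons s y) := by
  have mp := (volume_preserving_piFinSuccAbove (fun _ : Fin (n + 1) => ℝ) 0).symm
  set e := (MeasurableEquiv.piFinSuccAbove (fun _ : Fin (n + 1) => ℝ) 0)
  have he : ∀ p, e.symm p = Fin.cons p.1 p.2 := fun p => by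
    simp [e, MeasurableEquiv.piFinSuccAbove, Fin.insertNthEquiv]
  have hpre : e.symm ⁻¹' hbox a b = Set.Ioc (a 0) (b 0) ×ˢ hbox (Fin.tail a) (Fin.tail b) := by
    ext p
    simp only [Set.mem_preimage, he, hbox, Set.mem_pi, Set.mem_univ, true_imp_iff, Set.mem_prod,
      Fin.forall_fin_succ, Fin.cons_zero, Fin.cons_succ, Fin.tail]
  have h1 := mp.setIntegral_preimage_emb e.symm.measurableEmbedding Ψ (hbox a b)
  have h2 : IntegrableOn (fun p : ℝ × (Fin n → ℝ) => Ψ (Fin.cons p.1 p.2))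
      (Set.Ioc (a 0) (b 0) ×ˢ hbox (Fin.tail a) (Fin.tail b)) (volume.prod volume) := by
    have hc : Continuous fun p : ℝ × (Fin n → ℝ) => Ψ (Fin.cons p.1 p.2) :=
      h.comp (Continuous.finCons continuous_fst continuous_snd)
    exact (hc.continuousOn.integrableOn_compact (isCompact_Icc.prod isCompact_Icc)).mono_set
      (Set.prod_mono Set.Ioc_subset_Icc_self (hbox_subset_Icc _ _))
  rw [← h1, hpre]
  simp only [he]
  rw [intervalIntegral.integral_of_le hab]
  exact setIntegral_prod _ h2

/-- Integral of `Φ` over a box of translations in the directions `f`. -/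
def boxI {n : ℕ} (f : Fin n → E) (a b : Fin n → ℝ) (Φ : E → V) (x : E) : V :=
  ∫ y in hbox a b, Φ (x + ∑ i, y i • f i)

theorem boxI_succ {n : ℕ} (f : Fin (n + 1) → E) (a b : Fin (n + 1) → ℝ) (hab : a 0 ≤ b 0)
    {Φ : E → V} (hΦ : Continuous Φ) (x : E) :
    boxI f a b Φ x
      = ∫ s in (a 0)..(b 0), boxI (Fin.tail f) (Fin.tail a) (Fin.tail b) Φ (x + s • f 0) := by
  unfold boxI
  rw [setIntegral_hbox_succ (by fun_prop) a b hab]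
  simp [Fin.sum_univ_succ, Fin.tail, add_assoc]

theorem setIntegral_hbox_zero [CompleteSpace V] (a b : Fin 0 → ℝ) (Ψ : (Fin 0 → ℝ) → V) :
    ∫ y in hbox a b, Ψ y = Ψ 0 := by
  have : hbox a b = Set.univ := by ext; simp [hbox]
  rw [this, Measure.restrict_univ, Measure.volume_pi_eq_dirac 0, integral_dirac]

theorem boxI_zero [CompleteSpace V] (f : Fin 0 → E) (a b : Fin 0 → ℝ) (Φ : E → V) :
    boxI f a b Φ = Φ := by
  funext x
  rw [boxI, setIntegral_hbox_zero]
  simp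

variable [FiniteDimensional ℝ E]

theorem continuous_boxI {n : ℕ} (f : Fin n → E) (a b : Fin n → ℝ) {Φ : E → V}
    (hΦ : Continuous Φ) : Continuous (boxI f a b Φ) := by
  have : ProperSpace E := FiniteDimensional.proper ℝ E
  unfold boxI
  rw [restrict_hbox]
  exact continuous_parametric_integral_of_continuous (by fun_prop) isCompact_Icc

theorem hasFDerivAt_boxI {n : ℕ} (f : Fin n → E) (a b : Fin n → ℝ) {Φ : E → V}
    (hΦ : ContDiff ℝ 1 Φ) (x : E) :
    HasFDerivAt (boxI f a b Φ) (boxI f a b (fderiv ℝ Φ) x) x := by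
  have : ProperSpace E := FiniteDimensional.proper ℝ E
  have c1 : Continuous (fderiv ℝ Φ) := hΦ.continuous_fderiv one_ne_zero
  have c0 : Continuous Φ := hΦ.continuous
  obtain ⟨C, hC⟩ := ((isCompact_closedBall x 1).prod
    (isCompact_Icc (a := a) (b := b))).exists_bound_of_continuousOn
    (f := fun p : E × (Fin n → ℝ) => fderiv ℝ Φ (p.1 + ∑ i, p.2 i • f i)) (by fun_prop)
  unfold boxI
  refine hasFDerivAt_integral_of_dominated_of_fderiv_le (bound := fun _ => C)
    (F := fun x (y : Fin n → ℝ) => Φ (x + ∑ i, y i • f i))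
    (F' := fun x y => fderiv ℝ Φ (x + ∑ i, y i • f i))
    (Metric.closedBall_mem_nhds x one_pos) ?_ ?_ ?_ ?_ ?_ ?_
  · exact Eventually.of_forall fun x => Continuous.aestronglyMeasurable (by fun_prop)
  · exact Continuous.integrableOn_hbox (by fun_prop) a b
  · exact Continuous.aestronglyMeasurable (by fun_prop)
  · refine (ae_restrict_iff' (measurableSet_hbox a b)).2
      (Eventually.of_forall fun y hy x' hx' => ?_)
    exact hC (x', y) ⟨hx', hbox_subset_Icc a b hy⟩
  · exact (continuous_const.integrableOn_hbox a b)
  · refine Eventually.of_forall fun y x' _ => ?_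
    have := (hΦ.differentiable one_ne_zero (x' + ∑ i, y i • f i)).hasFDerivAt
    simpa [Function.comp_def] using this.comp x' ((hasFDerivAt_id x').add_const (∑ i, y i • f i))

theorem fderiv_boxI {n : ℕ} (f : Fin n → E) (a b : Fin n → ℝ) {Φ : E → V}
    (hΦ : ContDiff ℝ 1 Φ) : fderiv ℝ (boxI f a b Φ) = boxI f a b (fderiv ℝ Φ) :=
  funext fun x => (hasFDerivAt_boxI f a b hΦ x).fderiv

theorem contDiff_one_boxI {n : ℕ} (f : Fin n → E) (a b : Fin n → ℝ) {Φ : E → V}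
    (hΦ : ContDiff ℝ 1 Φ) : ContDiff ℝ 1 (boxI f a b Φ) := by
  rw [contDiff_one_iff_fderiv, fderiv_boxI f a b hΦ]
  exact ⟨fun x => (hasFDerivAt_boxI f a b hΦ x).differentiableAt,
    continuous_boxI f a b (hΦ.continuous_fderiv one_ne_zero)⟩

theorem contDiff_two_boxI {n : ℕ} (f : Fin n → E) (a b : Fin n → ℝ) {Φ : E → V}
    (hΦ : ContDiff ℝ 2 Φ) : ContDiff ℝ 2 (boxI f a b Φ) := by
  have h1 : ContDiff ℝ 1 Φ := hΦ.of_le (by norm_num)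
  rw [show (2 : WithTop ℕ∞) = 1 + 1 by norm_num, contDiff_succ_iff_fderiv, fderiv_boxI f a b h1]
  refine ⟨fun x => (hasFDerivAt_boxI f a b h1 x).differentiableAt, by simp, ?_⟩
  exact contDiff_one_boxI f a b (hΦ.fderiv_right (by norm_num))

end BoxIntegral

section SchurForm
set_option maxSynthPendingDepth 3
open scoped InnerProductSpace Topology Interval
open Filter

variable {E H : Type*} [NormedAddCommGroup E] [NormedSpace ℝ E]
  [NormedAddCommGroup H] [InnerProductSpace ℝ H]

theorem inner_fderiv_symm {G : E → H →L[ℝ] H} (hG : Differentiable ℝ G)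
    (hs : ∀ x u v, ⟪G x u, v⟫_ℝ = ⟪G x v, u⟫_ℝ) (x e : E) (u v : H) :
    ⟪fderiv ℝ G x e u, v⟫_ℝ = ⟪fderiv ℝ G x e v, u⟫_ℝ := by
  have key : ∀ u v, HasFDerivAt (fun x => ⟪G x u, v⟫_ℝ)
      ((innerSL ℝ v).comp ((fderiv ℝ G x).flip u)) x := fun u v => by
    have h := (hG x).hasFDerivAt.clm_apply (hasFDerivAt_const u x)
    have h2 := (innerSL ℝ v).hasFDerivAt.comp x h
    simpa [Function.comp_def, real_inner_comm] using h2
  have h1 := (key u v).unique (by simpa only [hs _ u v] using key v u)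
  simpa [real_inner_comm] using congrArg (fun L : E →L[ℝ] ℝ => L e) h1

/-- The first-order vector `∑ⱼ (∂_{eⱼ} G) vⱼ`. -/
def firstVar {ι : Type*} [Fintype ι] (G : E → H →L[ℝ] H) (x : E) (e : ι → E) (v : ι → H) : H :=
  ∑ j, fderiv ℝ G x (e j) (v j)

/-- The second-order form `∑ⱼₖ ⟪(∂_{eₖ} ∂_{eⱼ} G) vⱼ, vₖ⟫`. -/
def secondVar {ι : Type*} [Fintype ι] (G : E → H →L[ℝ] H) (x : E) (e : ι → E) (v : ι → H) : ℝ :=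
  ∑ j, ∑ k, ⟪fderiv ℝ (fderiv ℝ G) x (e k) (e j) (v j), v k⟫_ℝ

/-- The quadratic form whose nonnegativity is matrix log-concavity. -/
def schurQ {ι : Type*} [Fintype ι] (G : E → H →L[ℝ] H) (x : E) (e : ι → E) (v : ι → H) : ℝ :=
  -secondVar G x e v + ⟪Ring.inverse (G x) (firstVar G x e v), firstVar G x e v⟫_ℝ

theorem schurQ_reindex {ι κ : Type*} [Fintype ι] [Fintype κ] (σ : κ → ι)
    (hσ : Function.Bijective σ) (G : E → H →L[ℝ] H) (x : E) (e : ι → E) (v : ι → H) :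
    schurQ G x (fun j => e (σ j)) (fun j => v (σ j)) = schurQ G x e v := by
  have h1 : firstVar G x (fun j => e (σ j)) (fun j => v (σ j)) = firstVar G x e v :=
    hσ.sum_comp fun j => fderiv ℝ G x (e j) (v j)
  have h2 : secondVar G x (fun j => e (σ j)) (fun j => v (σ j)) = secondVar G x e v := by
    unfold secondVar
    rw [← hσ.sum_comp]
    refine Finset.sum_congr rfl fun j _ => ?_
    exact hσ.sum_comp fun k => ⟪fderiv ℝ (fderiv ℝ G) x (e k) (e (σ j)) (v (σ j)), v k⟫_ℝ
  rw [schurQ, schurQ, h1, h2]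

theorem bijective_sum_succ (ι : Type*) (n : ℕ) : Function.Bijective
    (Sum.elim (Sum.elim Sum.inl fun _ => Sum.inr 0) fun i => Sum.inr i.succ :
      (ι ⊕ Unit) ⊕ Fin n → ι ⊕ Fin (n + 1)) := by
  constructor
  · rintro ((i | i) | i) ((j | j) | j) h <;> simp_all [Fin.succ_ne_zero, (Fin.succ_ne_zero _).symm]
  · rintro (i | i)
    · exact ⟨.inl (.inl i), rfl⟩
    · refine Fin.cases ⟨.inl (.inr ()), rfl⟩ (fun j => ⟨.inr j, rfl⟩) i

theorem schurQ_empty {ι : Type*} [Fintype ι] (G : E → H →L[ℝ] H) (x : E) (e : ι → E) (v : ι → H)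
    (f : Fin 0 → E) (u : Fin 0 → H) :
    schurQ G x (Sum.elim e f) (Sum.elim v u) = schurQ G x e v := by
  simp [schurQ, firstVar, secondVar]

theorem fderiv_fderiv_symm {V : Type*} [NormedAddCommGroup V] [NormedSpace ℝ V] {G : E → V}
    (hG : ContDiff ℝ 2 G) (x e e' : E) :
    fderiv ℝ (fderiv ℝ G) x e e' = fderiv ℝ (fderiv ℝ G) x e' e :=
  (hG.contDiffAt.isSymmSndFDerivAt (by simp)) e e'

theorem schurQ_unit {ι : Type*} [Fintype ι] {G : E → H →L[ℝ] H} (hG : ContDiff ℝ 2 G)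
    (hs : ∀ x u v, ⟪G x u, v⟫_ℝ = ⟪G x v, u⟫_ℝ) (x : E) (e : ι → E) (v : ι → H) (f : E) (u : H) :
    schurQ G x (Sum.elim e fun _ : Unit => f) (Sum.elim v fun _ : Unit => u)
      = -secondVar G x e v - 2 * ⟪∑ j, fderiv ℝ (fderiv ℝ G) x f (e j) (v j), u⟫_ℝ
        - ⟪fderiv ℝ (fderiv ℝ G) x f f u, u⟫_ℝ
        + ⟪Ring.inverse (G x) (firstVar G x e v + fderiv ℝ G x f u),
            firstVar G x e v + fderiv ℝ G x f u⟫_ℝ := by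
  have hG1 : ContDiff ℝ 1 (fderiv ℝ G) := hG.fderiv_right (by norm_num)
  have hs2 : ∀ e e' u v, ⟪fderiv ℝ (fderiv ℝ G) x e e' u, v⟫_ℝ
      = ⟪fderiv ℝ (fderiv ℝ G) x e e' v, u⟫_ℝ := by
    intro e e' u v
    have h := inner_fderiv_symm (G := fun x => fderiv ℝ G x e')
      ((hG1.differentiable one_ne_zero).clm_apply (differentiable_const _))
      (fun x => inner_fderiv_symm (hG.differentiable two_ne_zero) hs x e') x e u v
    rw [fderiv_clm_apply (hG1.differentiable one_ne_zero x) (differentiableAt_const _)] at h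
    simpa using h
  have h2 : secondVar G x (Sum.elim e fun _ : Unit => f) (Sum.elim v fun _ : Unit => u)
      = secondVar G x e v + 2 * ⟪∑ j, fderiv ℝ (fderiv ℝ G) x f (e j) (v j), u⟫_ℝ
        + ⟪fderiv ℝ (fderiv ℝ G) x f f u, u⟫_ℝ := by
    have h3 : ∀ k, ⟪fderiv ℝ (fderiv ℝ G) x (e k) f u, v k⟫_ℝ
        = ⟪fderiv ℝ (fderiv ℝ G) x f (e k) (v k), u⟫_ℝ := fun k => by
      rw [fderiv_fderiv_symm hG, hs2]
    simp only [secondVar, Fintype.sum_sum_type, Sum.elim_inl, Sum.elim_inr, Finset.univ_unique,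
      Finset.sum_singleton, Finset.sum_add_distrib, h3, sum_inner]
    ring
  have h1 : firstVar G x (Sum.elim e fun _ : Unit => f) (Sum.elim v fun _ : Unit => u)
      = firstVar G x e v + fderiv ℝ G x f u := by
    simp [firstVar]
  rw [schurQ, h1, h2]
  ring

theorem hasDerivAt_comp_line {V : Type*} [NormedAddCommGroup V] [NormedSpace ℝ V] {Φ : E → V}
    (hΦ : ContDiff ℝ 1 Φ) (x f : E) (s : ℝ) :
    HasDerivAt (fun s : ℝ => Φ (x + s • f)) (fderiv ℝ Φ (x + s • f) f) s := by
  have h1 : HasDerivAt (fun s : ℝ => x + s • f) f s := by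
    simpa using ((hasDerivAt_id s).smul_const f).const_add x
  exact (hΦ.differentiable one_ne_zero _).hasFDerivAt.comp_hasDerivAt s h1

variable [FiniteDimensional ℝ E] [CompleteSpace H]

theorem PosDefOp.boxI {n : ℕ} : ∀ {f : Fin n → E} {a b : Fin n → ℝ}, (∀ i, a i < b i) →
    ∀ {G : E → H →L[ℝ] H}, Continuous G → (∀ x, PosDefOp (G x)) →
    ∀ x, PosDefOp (boxI f a b G x) := by
  induction n with
  | zero => intro f a b _ G _ h x; rw [boxI_zero]; exact h x
  | succ n ih =>
    intro f a b hab G hG h x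
    rw [boxI_succ f a b (hab 0).le hG]
    have hc := continuous_boxI (Fin.tail f) (Fin.tail a) (Fin.tail b) hG
    exact PosDefOp.intervalIntegral (hab 0) (by fun_prop)
      fun s => ih (fun i => hab i.succ) hG h _

variable [FiniteDimensional ℝ H]

/-- Lower bounds on the Schur form are inherited by box marginals. -/
theorem integral_le_schurQ_boxI {n : ℕ} : ∀ {f : Fin n → E} {a b : Fin n → ℝ}, (∀ i, a i < b i) →
    ∀ {G : E → H →L[ℝ] H}, ContDiff ℝ 2 G → (∀ x, PosDefOp (G x)) →
    ∀ {ι : Type} [Fintype ι] (x : E) (e : ι → E) (v : ι → H) (D : (Fin n → ℝ) → ℝ),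
      Continuous D →
      (∀ y u, D y ≤ schurQ G (x + ∑ i, y i • f i) (Sum.elim e f) (Sum.elim v u)) →
      ∫ y in hbox a b, D y ≤ schurQ (boxI f a b G) x e v := by
  induction n with
  | zero =>
    intro f a b _ G _ _ ι _ x e v D _ h
    rw [boxI_zero, setIntegral_hbox_zero]
    simpa [schurQ_empty] using h 0 0
  | succ n ih =>
    intro f a b hab G hG hpos ι _ x e v D hD h
    have hab' : ∀ i, Fin.tail a i < Fin.tail b i := fun i => hab i.succ
    set A := boxI (Fin.tail f) (Fin.tail a) (Fin.tail b) G with hA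
    have hAC : ContDiff ℝ 2 A := contDiff_two_boxI _ _ _ hG
    have hAC1 : ContDiff ℝ 1 A := hAC.of_le (by norm_num)
    have hAC' : ContDiff ℝ 1 (fderiv ℝ A) := hAC.fderiv_right (by norm_num)
    have hG1 : ContDiff ℝ 1 G := hG.of_le (by norm_num)
    have hG' : ContDiff ℝ 1 (fderiv ℝ G) := hG.fderiv_right (by norm_num)
    have hApos : ∀ x, PosDefOp (A x) := PosDefOp.boxI hab' hG.continuous hpos
    let D' : ℝ → ℝ := fun s => ∫ y in hbox (Fin.tail a) (Fin.tail b), D (Fin.cons s y)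
    have hD' : Continuous D' := by
      simp only [D', restrict_hbox]
      refine continuous_parametric_integral_of_continuous ?_ isCompact_Icc
      exact hD.comp (Continuous.finCons continuous_fst continuous_snd)
    have hstep : ∀ s u, D' s ≤ schurQ A (x + s • f 0) (Sum.elim e fun _ : Unit => f 0)
        (Sum.elim v fun _ : Unit => u) := by
      intro s u
      refine ih hab' hG hpos (x + s • f 0) _ _ (fun y => D (Fin.cons s y))
        (hD.comp (Continuous.finCons continuous_const continuous_id)) fun y u' => ?_
      refine (h (Fin.cons s y) (Fin.cons u u')).trans_eq ?_
      rw [← schurQ_reindex _ (bijective_sum_succ ι n)]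
      simp only [Fin.sum_univ_succ, Fin.cons_zero, Fin.cons_succ, ← add_assoc, Fin.tail]
      congr 1
      · funext j; rcases j with (j | j) | j <;> simp [Fin.tail]
      · funext j; rcases j with (j | j) | j <;> simp
    have c0 : Continuous fun s : ℝ => x + s • f 0 := by fun_prop
    have c1 : Continuous fun s : ℝ => fderiv ℝ A (x + s • f 0) := hAC'.continuous.comp c0
    have c2 : Continuous fun s : ℝ => fderiv ℝ (fderiv ℝ A) (x + s • f 0) :=
      (hAC'.continuous_fderiv one_ne_zero).comp c0
    have c2' : ∀ e e' v, Continuous fun s : ℝ => fderiv ℝ (fderiv ℝ A) (x + s • f 0) e e' v :=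
      fun e e' v => ((c2.clm_apply continuous_const).clm_apply continuous_const).clm_apply
        continuous_const
    have c1' : ∀ e v, Continuous fun s : ℝ => fderiv ℝ A (x + s • f 0) e v :=
      fun e v => (c1.clm_apply continuous_const).clm_apply continuous_const
    have c2i : ∀ e e' v w, Continuous fun s : ℝ =>
        ⟪fderiv ℝ (fderiv ℝ A) (x + s • f 0) e e' v, w⟫_ℝ :=
      fun e e' v w => (c2' e e' v).inner continuous_const
    have d1 : ∀ e s, HasDerivAt (fun s : ℝ => fderiv ℝ A (x + s • f 0) e)
        (fderiv ℝ (fderiv ℝ A) (x + s • f 0) (f 0) e) s := fun e s => by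
      simpa using (hasDerivAt_comp_line hAC' x (f 0) s).clm_apply (hasDerivAt_const s e)
    have dw : ∀ s, HasDerivAt (fun s : ℝ => firstVar A (x + s • f 0) e v)
        (∑ j, fderiv ℝ (fderiv ℝ A) (x + s • f 0) (f 0) (e j) (v j)) s := fun s =>
      HasDerivAt.fun_sum fun j _ => by
        simpa using (d1 (e j) s).clm_apply (hasDerivAt_const s (v j))
    have key := integral_le_of_le_schur (hab 0) (hasDerivAt_comp_line hAC1 x (f 0)) (d1 (f 0))
      ((c2.clm_apply continuous_const).clm_apply continuous_const) dw
      (continuous_finsetSum _ fun j _ => c2' _ _ _) (fun s => hApos _) hD'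
      (S := fun s => secondVar A (x + s • f 0) e v)
      (continuous_finsetSum _ fun j _ => continuous_finsetSum _ fun k _ => c2i _ _ _ _)
      (fun s u => by
        rw [← schurQ_unit hAC (fun x => (hApos x).symm)]
        exact hstep s u)
    have e0 : ∫ s in (a 0)..(b 0), A (x + s • f 0) = boxI f a b G x :=
      (boxI_succ f a b (hab 0).le hG.continuous x).symm
    have e1 : ∀ y, fderiv ℝ (boxI f a b G) y
        = ∫ s in (a 0)..(b 0), fderiv ℝ A (y + s • f 0) := by
      intro y
      rw [fderiv_boxI f a b hG1, boxI_succ f a b (hab 0).le hG'.continuous, hA,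
        fderiv_boxI _ _ _ hG1]
    have e2 : fderiv ℝ (fderiv ℝ (boxI f a b G)) x
        = ∫ s in (a 0)..(b 0), fderiv ℝ (fderiv ℝ A) (x + s • f 0) := by
      have h2 := boxI_succ f a b (hab 0).le (hG'.continuous_fderiv one_ne_zero) x
      rw [fderiv_boxI f a b hG1, fderiv_boxI f a b hG', h2, hA, fderiv_boxI _ _ _ hG1,
        fderiv_boxI _ _ _ hG']
    have f1 : ∫ s in (a 0)..(b 0), firstVar A (x + s • f 0) e v
        = firstVar (boxI f a b G) x e v := by
      unfold firstVar
      rw [intervalIntegral.integral_finsetSum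
        (fun j _ => (c1' _ _).intervalIntegrable _ _), e1]
      refine Finset.sum_congr rfl fun j _ => ?_
      rw [ContinuousLinearMap.intervalIntegral_apply (c1.intervalIntegrable _ _),
        ContinuousLinearMap.intervalIntegral_apply
          ((c1.clm_apply continuous_const).intervalIntegrable _ _)]
    have f2 : ∫ s in (a 0)..(b 0), secondVar A (x + s • f 0) e v
        = secondVar (boxI f a b G) x e v := by
      unfold secondVar
      rw [intervalIntegral.integral_finsetSum
        (fun j _ => (continuous_finsetSum _ fun k _ => c2i _ _ _ _).intervalIntegrable _ _), e2]
      refine Finset.sum_congr rfl fun j _ => ?_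
      rw [intervalIntegral.integral_finsetSum
        (fun k _ => (c2i _ _ _ _).intervalIntegrable _ _)]
      refine Finset.sum_congr rfl fun k _ => ?_
      have c3 : Continuous fun s : ℝ => fderiv ℝ (fderiv ℝ A) (x + s • f 0) (e k) :=
        c2.clm_apply continuous_const
      have c4 : Continuous fun s : ℝ => fderiv ℝ (fderiv ℝ A) (x + s • f 0) (e k) (e j) :=
        c3.clm_apply continuous_const
      rw [ContinuousLinearMap.intervalIntegral_apply (c2.intervalIntegrable _ _) (e k),
        ContinuousLinearMap.intervalIntegral_apply (c3.intervalIntegrable _ _) (e j),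
        ContinuousLinearMap.intervalIntegral_apply (c4.intervalIntegrable _ _) (v j),
        real_inner_comm, ← innerSL_apply_apply (𝕜 := ℝ),
        ← ContinuousLinearMap.intervalIntegral_comp_comm _ ((c2' _ _ _).intervalIntegrable _ _)]
      simp [real_inner_comm]
    rw [setIntegral_hbox_succ hD a b (hab 0).le]
    rw [e0, f1, f2] at key
    exact key

end SchurForm

section ConvexInverse
set_option maxSynthPendingDepth 3
open scoped InnerProductSpace Topology Interval
open Filter

variable {T H : Type*} [NormedAddCommGroup T] [NormedSpace ℝ T]
  [NormedAddCommGroup H] [InnerProductSpace ℝ H] [FiniteDimensional ℝ H] [CompleteSpace H]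

theorem hasDerivAt_inverse {γ : ℝ → H →L[ℝ] H} {γ' : H →L[ℝ] H} {s : ℝ} {S : Set ℝ}
    (hpos : PosDefOp (γ s)) (hγ : HasDerivWithinAt γ γ' S s) :
    HasDerivWithinAt (fun s => Ring.inverse (γ s))
      (-(Ring.inverse (γ s) * γ' * Ring.inverse (γ s))) S s := by
  obtain ⟨v, hv⟩ := hpos.isUnit
  have h1 := hasFDerivAt_ringInverse (𝕜 := ℝ) v
  rw [hv] at h1
  have h2 := h1.comp_hasDerivWithinAt s hγ
  rw [← hv, Ring.inverse_unit]
  simpa [Function.comp_def] using h2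

theorem hasDerivAt_inner_inverse {γ γ' : ℝ → H →L[ℝ] H} (hpos : ∀ s, PosDefOp (γ s))
    (hγ : ∀ s, HasDerivAt γ (γ' s) s) (w : H) (s : ℝ) :
    HasDerivAt (fun s => ⟪Ring.inverse (γ s) w, w⟫_ℝ)
      (-⟪γ' s (Ring.inverse (γ s) w), Ring.inverse (γ s) w⟫_ℝ) s := by
  have h1 := (hasDerivAt_inverse (hpos s) (hγ s).hasDerivWithinAt).hasDerivAt univ_mem
  have h2 := (h1.clm_apply (hasDerivAt_const s w)).inner ℝ (hasDerivAt_const s w)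
  refine h2.congr_deriv ?_
  have h3 := (hpos s).inverse.symm (γ' s (Ring.inverse (γ s) w)) w
  simp only [map_zero, add_zero, inner_zero_right, zero_add, _root_.neg_apply,
    mul_apply_eq_comp, inner_neg_left]
  rw [h3, real_inner_comm]

/-- The inverse quadratic form of a matrix log-concave curve is convex. -/
theorem convexOn_inner_inverse_line {γ γ' γ'' : ℝ → H →L[ℝ] H} (hpos : ∀ s, PosDefOp (γ s))
    (hγ : ∀ s, HasDerivAt γ (γ' s) s) (hγ' : ∀ s, HasDerivAt γ' (γ'' s) s)
    (hq : ∀ s z, 0 ≤ -⟪γ'' s z, z⟫_ℝ + ⟪Ring.inverse (γ s) (γ' s z), γ' s z⟫_ℝ) (w : H) :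
    ConvexOn ℝ Set.univ fun s => ⟪Ring.inverse (γ s) w, w⟫_ℝ := by
  have hsymm : ∀ s u v, ⟪γ' s u, v⟫_ℝ = ⟪γ' s v, u⟫_ℝ := by
    intro s u v
    have key : ∀ u v, HasDerivAt (fun s => ⟪γ s u, v⟫_ℝ) ⟪γ' s u, v⟫_ℝ s := fun u v => by
      simpa using ((hγ s).clm_apply (hasDerivAt_const s u)).inner ℝ (hasDerivAt_const s v)
    refine (key u v).unique ?_
    simpa only [(hpos _).symm u v] using key v u
  have h1 := hasDerivAt_inner_inverse hpos hγ w
  have h2 : ∀ s, HasDerivAt (fun s => -⟪γ' s (Ring.inverse (γ s) w), Ring.inverse (γ s) w⟫_ℝ)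
      (-⟪γ'' s (Ring.inverse (γ s) w), Ring.inverse (γ s) w⟫_ℝ
        + 2 * ⟪Ring.inverse (γ s) (γ' s (Ring.inverse (γ s) w)),
          γ' s (Ring.inverse (γ s) w)⟫_ℝ) s := by
    intro s
    have h3 := ((hasDerivAt_inverse (hpos s) (hγ s).hasDerivWithinAt).hasDerivAt
      univ_mem).clm_apply (hasDerivAt_const s w)
    have h4 := (((hγ' s).clm_apply h3).inner ℝ h3).neg
    refine h4.congr_deriv ?_
    simp only [map_zero, add_zero, _root_.neg_apply, mul_apply_eq_comp,
      inner_add_left, inner_neg_right, map_neg, inner_neg_left]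
    rw [hsymm s (Ring.inverse (γ s) (γ' s (Ring.inverse (γ s) w))),
      real_inner_comm (Ring.inverse (γ s) (γ' s (Ring.inverse (γ s) w)))]
    ring
  have d1 : deriv (fun s => ⟪Ring.inverse (γ s) w, w⟫_ℝ) = _ := funext fun s => (h1 s).deriv
  refine convexOn_univ_of_deriv2_nonneg (fun s => (h1 s).differentiableAt) ?_ ?_
  · rw [d1]
    exact fun s => (h2 s).differentiableAt
  · intro s
    rw [Function.iterate_succ_apply, d1, Function.iterate_one, (h2 s).deriv]
    have := hq s (Ring.inverse (γ s) w)
    have := (hpos s).inverse.nonneg (γ' s (Ring.inverse (γ s) w))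
    linarith

/-- Matrix log-concavity along lines. -/
def LineLogConcave (A : T → H →L[ℝ] H) : Prop :=
  ∀ x e z, 0 ≤ -⟪fderiv ℝ (fderiv ℝ A) x e e z, z⟫_ℝ
    + ⟪Ring.inverse (A x) (fderiv ℝ A x e z), fderiv ℝ A x e z⟫_ℝ

variable {A : T → H →L[ℝ] H}

theorem convexOn_inner_inverse_comp_line (hA : ContDiff ℝ 2 A) (hpos : ∀ x, PosDefOp (A x))
    (hlc : LineLogConcave A) (x e : T) (w : H) :
    ConvexOn ℝ Set.univ fun s : ℝ => ⟪Ring.inverse (A (x + s • e)) w, w⟫_ℝ := by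
  refine convexOn_inner_inverse_line (fun s => hpos _)
    (hasDerivAt_comp_line (hA.of_le (by norm_num)) x e) (fun s => ?_) (fun s z => hlc _ e z) w
  simpa using (hasDerivAt_comp_line (hA.fderiv_right (m := 1) (by norm_num)) x e s).clm_apply
    (hasDerivAt_const s e)

theorem convexOn_of_lines {φ : T → ℝ}
    (h : ∀ x e : T, ConvexOn ℝ Set.univ fun s : ℝ => φ (x + s • e)) : ConvexOn ℝ Set.univ φ := by
  refine ⟨convex_univ, fun x _ y _ a b ha hb hab => ?_⟩
  have := (h x (y - x)).2 (Set.mem_univ 0) (Set.mem_univ 1) ha hb hab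
  simp only [smul_eq_mul, mul_zero, mul_one, zero_add, zero_smul, add_zero, one_smul,
    add_sub_cancel] at this
  have hx : a • x + b • y = x + b • (y - x) := by
    rw [show a = 1 - b by linarith]
    module
  rwa [hx]

theorem convexOn_inner_inverse (hA : ContDiff ℝ 2 A) (hpos : ∀ x, PosDefOp (A x))
    (hlc : LineLogConcave A) (w : H) :
    ConvexOn ℝ Set.univ fun x => ⟪Ring.inverse (A x) w, w⟫_ℝ :=
  convexOn_of_lines fun x e => convexOn_inner_inverse_comp_line hA hpos hlc x e w

theorem continuous_inverse_comp {X : Type*} [TopologicalSpace X] {A : X → H →L[ℝ] H}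
    (hA : Continuous A) (hpos : ∀ x, PosDefOp (A x)) : Continuous fun x => Ring.inverse (A x) :=
  continuous_iff_continuousAt.2 fun x =>
    (hpos x).continuousAt_inverse.comp (f := A) hA.continuousAt

/-- Derivatives of convex functions converge to the derivative of the limit. -/
theorem tendsto_of_subgradient {P : Type*} {l : Filter P} {φ : P → ℝ → ℝ} {d : P → ℝ} {U : ℝ → ℝ}
    {m : ℝ} (hφ : ∀ p h, φ p 0 + h * d p ≤ φ p h) (hU : ∀ h, Tendsto (fun p => φ p h) l (𝓝 (U h)))
    (hm : HasDerivAt U m 0) : Tendsto d l (𝓝 m) := by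
  have hs := hasDerivAt_iff_tendsto_slope_zero.1 hm
  simp only [zero_add, smul_eq_mul] at hs
  rw [tendsto_order]
  constructor
  · intro c hc
    obtain ⟨h, hh, hlt⟩ : ∃ h < (0 : ℝ), c < h⁻¹ * (U h - U 0) := by
      have := ((hs.mono_left
        (nhdsWithin_mono 0 (s := Set.Iio 0) fun x hx => ne_of_lt hx)).eventually
        (lt_mem_nhds hc)).and self_mem_nhdsWithin
      obtain ⟨h, h1, h2⟩ := this.exists
      exact ⟨h, h2, h1⟩
    have ht := (((hU h).sub (hU 0)).const_mul h⁻¹).eventually (lt_mem_nhds hlt)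
    filter_upwards [ht] with p hp
    refine hp.trans_le ?_
    have := hφ p h
    rw [inv_mul_eq_div, div_le_iff_of_neg hh]
    linarith
  · intro c hc
    obtain ⟨h, hh, hlt⟩ : ∃ h > (0 : ℝ), h⁻¹ * (U h - U 0) < c := by
      have := ((hs.mono_left
        (nhdsWithin_mono 0 (s := Set.Ioi 0) fun x hx => ne_of_gt hx)).eventually
        (gt_mem_nhds hc)).and self_mem_nhdsWithin
      obtain ⟨h, h1, h2⟩ := this.exists
      exact ⟨h, h2, h1⟩
    have ht := (((hU h).sub (hU 0)).const_mul h⁻¹).eventually (gt_mem_nhds hlt)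
    filter_upwards [ht] with p hp
    refine lt_of_le_of_lt ?_ hp
    have := hφ p h
    rw [le_inv_mul_iff₀ hh]
    linarith

theorem ConvexOn.add_mul_le {f : ℝ → ℝ} {m : ℝ} (hf : ConvexOn ℝ Set.univ f)
    (hm : HasDerivAt f m 0) (h : ℝ) : f 0 + h * m ≤ f h := by
  rcases lt_trichotomy h 0 with hh | rfl | hh
  · have := hf.slope_le_of_hasDerivAt (Set.mem_univ h) (Set.mem_univ 0) hh hm
    rw [slope_def_field, div_le_iff₀ (by linarith)] at this
    linarith
  · simp
  · have := hf.le_slope_of_hasDerivAt (Set.mem_univ 0) (Set.mem_univ h) hh hm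
    rw [slope_def_field, le_div_iff₀ (by linarith)] at this
    linarith

end ConvexInverse

section MonotoneLimit
set_option maxSynthPendingDepth 3
open scoped InnerProductSpace Topology Interval
open Filter

variable {T H : Type*} [NormedAddCommGroup T] [NormedSpace ℝ T]
  [NormedAddCommGroup H] [InnerProductSpace ℝ H] [FiniteDimensional ℝ H] [CompleteSpace H]

/-- A monotone approximation of `L` by smooth matrix log-concave functions. -/
structure MonoApprox (A : ℕ → T → H →L[ℝ] H) (L : T → H →L[ℝ] H) : Prop where
  contDiff : ∀ n, ContDiff ℝ 2 (A n)
  pos : ∀ n x, PosDefOp (A n x)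
  logConcave : ∀ n, LineLogConcave (A n)
  mono : ∀ x u, Monotone fun n => ⟪A n x u, u⟫_ℝ
  lim : ∀ x, Tendsto (fun n => A n x) atTop (𝓝 (L x))

theorem tendsto_apply {P : Type*} {l : Filter P} {f : P → H →L[ℝ] H} {M : H →L[ℝ] H}
    (h : Tendsto f l (𝓝 M)) (u : H) : Tendsto (fun p => f p u) l (𝓝 (M u)) :=
  ((ContinuousLinearMap.apply ℝ H u).continuous.tendsto M).comp h

theorem tendsto_inner_apply {P : Type*} {l : Filter P} {f : P → H →L[ℝ] H} {M : H →L[ℝ] H}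
    (h : Tendsto f l (𝓝 M)) (u v : H) : Tendsto (fun p => ⟪f p u, v⟫_ℝ) l (𝓝 ⟪M u, v⟫_ℝ) :=
  (tendsto_apply h u).inner tendsto_const_nhds

theorem symm_of_tendsto {P : Type*} {l : Filter P} [l.NeBot] {f : P → H →L[ℝ] H} {M : H →L[ℝ] H}
    (hs : ∀ p u v, ⟪f p u, v⟫_ℝ = ⟪f p v, u⟫_ℝ) (h : Tendsto f l (𝓝 M)) (u v : H) :
    ⟪M u, v⟫_ℝ = ⟪M v, u⟫_ℝ := by
  have h1 : ∀ u v, Tendsto (fun p => ⟪f p u, v⟫_ℝ) l (𝓝 ⟪M u, v⟫_ℝ) := fun u v =>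
    tendsto_inner_apply h u v
  exact tendsto_nhds_unique (h1 u v) (by simpa only [hs _ u v] using h1 v u)

theorem tendsto_of_quadratic {P : Type*} {l : Filter P} [l.NeBot] {f : P → H →L[ℝ] H}
    {M : H →L[ℝ] H} (hs : ∀ p u v, ⟪f p u, v⟫_ℝ = ⟪f p v, u⟫_ℝ)
    (hM : ∀ u v, ⟪M u, v⟫_ℝ = ⟪M v, u⟫_ℝ)
    (h : ∀ u, Tendsto (fun p => ⟪f p u, u⟫_ℝ) l (𝓝 ⟪M u, u⟫_ℝ)) : Tendsto f l (𝓝 M) := by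
  obtain ⟨N, hN⟩ := exists_tendsto_of_quadratic hs fun u => ⟨_, h u⟩
  rwa [show M = N from eq_of_quadratic hM (symm_of_tendsto hs hN) fun u =>
    tendsto_nhds_unique (h u) (tendsto_inner_apply hN u u)]

/-- One-sided derivatives of a curve of symmetric operators with convex quadratic forms. -/
theorem exists_oneSided_deriv {γ : ℝ → H →L[ℝ] H} (hs : ∀ s u v, ⟪γ s u, v⟫_ℝ = ⟪γ s v, u⟫_ℝ)
    (hc : ∀ u, ConvexOn ℝ Set.univ fun s => ⟪γ s u, u⟫_ℝ) :
    ∃ M N : H →L[ℝ] H, HasDerivWithinAt γ M (Set.Iio 0) 0 ∧ HasDerivWithinAt γ N (Set.Ioi 0) 0 ∧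
      (∀ u v, ⟪M u, v⟫_ℝ = ⟪M v, u⟫_ℝ) ∧ (∀ u v, ⟪N u, v⟫_ℝ = ⟪N v, u⟫_ℝ) ∧
      ∀ u, ⟪M u, u⟫_ℝ ≤ ⟪N u, u⟫_ℝ := by
  have hss : ∀ s u v, ⟪slope γ 0 s u, v⟫_ℝ = ⟪slope γ 0 s v, u⟫_ℝ := fun s u v => by
    simp only [slope, vsub_eq_sub, _root_.smul_apply, _root_.sub_apply, inner_smul_left,
      inner_sub_left, hs s u v, hs 0 u v]
  have hq : ∀ u s, ⟪slope γ 0 s u, u⟫_ℝ = slope (fun s => ⟪γ s u, u⟫_ℝ) 0 s := fun u s => by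
    simp [slope, inner_smul_left, inner_sub_left]
  have hl : ∀ u, Tendsto (fun s => ⟪slope γ 0 s u, u⟫_ℝ) (𝓝[<] 0)
      (𝓝 (derivWithin (fun s => ⟪γ s u, u⟫_ℝ) (Set.Iio 0) 0)) := fun u => by
    simp only [hq]
    exact (hasDerivWithinAt_iff_tendsto_slope' (by simp)).1
      ((hc u).hasDerivWithinAt_leftDeriv_of_mem_interior (by simp))
  have hr : ∀ u, Tendsto (fun s => ⟪slope γ 0 s u, u⟫_ℝ) (𝓝[>] 0)
      (𝓝 (derivWithin (fun s => ⟪γ s u, u⟫_ℝ) (Set.Ioi 0) 0)) := fun u => by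
    simp only [hq]
    exact (hasDerivWithinAt_iff_tendsto_slope' (by simp)).1
      ((hc u).hasDerivWithinAt_rightDeriv_of_mem_interior (by simp))
  obtain ⟨M, hM⟩ := exists_tendsto_of_quadratic hss fun u => ⟨_, hl u⟩
  obtain ⟨N, hN⟩ := exists_tendsto_of_quadratic hss fun u => ⟨_, hr u⟩
  refine ⟨M, N, (hasDerivWithinAt_iff_tendsto_slope' (by simp)).2 hM,
    (hasDerivWithinAt_iff_tendsto_slope' (by simp)).2 hN, symm_of_tendsto hss hM,
    symm_of_tendsto hss hN, fun u => ?_⟩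
  have e1 := tendsto_nhds_unique (hl u)
    (tendsto_inner_apply hM u u)
  have e2 := tendsto_nhds_unique (hr u)
    (tendsto_inner_apply hN u u)
  rw [← e1, ← e2]
  exact (hc u).leftDeriv_le_rightDeriv_of_mem_interior (by simp)

namespace MonoApprox

variable {A : ℕ → T → H →L[ℝ] H} {L : T → H →L[ℝ] H}

theorem tendsto_inner (h : MonoApprox A L) (x : T) (u v : H) :
    Tendsto (fun n => ⟪A n x u, v⟫_ℝ) atTop (𝓝 ⟪L x u, v⟫_ℝ) :=
  tendsto_inner_apply (h.lim x) u v

theorem inner_le (h : MonoApprox A L) (n : ℕ) (x : T) (u : H) : ⟪A n x u, u⟫_ℝ ≤ ⟪L x u, u⟫_ℝ :=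
  (h.mono x u).ge_of_tendsto (h.tendsto_inner x u u) n

theorem pos_lim (h : MonoApprox A L) (x : T) : PosDefOp (L x) :=
  ⟨symm_of_tendsto (fun n => (h.pos n x).symm) (h.lim x),
    fun u hu => ((h.pos 0 x).pos u hu).trans_le (h.inner_le 0 x u)⟩

theorem tendsto_inverse (h : MonoApprox A L) (x : T) :
    Tendsto (fun n => Ring.inverse (A n x)) atTop (𝓝 (Ring.inverse (L x))) :=
  (h.pos_lim x).continuousAt_inverse.tendsto.comp (h.lim x)

theorem convexOn_inverse (h : MonoApprox A L) (w : H) :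
    ConvexOn ℝ Set.univ fun x => ⟪Ring.inverse (L x) w, w⟫_ℝ := by
  have hl : ∀ x, Tendsto (fun n => ⟪Ring.inverse (A n x) w, w⟫_ℝ) atTop
      (𝓝 ⟪Ring.inverse (L x) w, w⟫_ℝ) := fun x =>
    tendsto_inner_apply (h.tendsto_inverse x) w w
  refine ⟨convex_univ, fun x _ y _ a b ha hb hab => ?_⟩
  refine le_of_tendsto_of_tendsto' (hl _) (((hl x).const_smul a).add ((hl y).const_smul b))
    fun n => ?_
  exact (convexOn_inner_inverse (h.contDiff n) (h.pos n) (h.logConcave n) w).2 trivial trivial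
    ha hb hab

theorem inverse_inner_le (h : MonoApprox A L) (n : ℕ) (x : T) (w : H) :
    ⟪Ring.inverse (L x) w, w⟫_ℝ ≤ ⟪Ring.inverse (A n x) w, w⟫_ℝ :=
  (h.pos n x).inverse_anti (h.pos_lim x) (h.inner_le n x) w

/-- The inverses converge locally uniformly. -/
theorem tendsto_inverse_prod [FiniteDimensional ℝ T] (h : MonoApprox A L) (x₀ : T) :
    Tendsto (fun p : ℕ × T => Ring.inverse (A p.1 p.2)) (atTop ×ˢ 𝓝 x₀)
      (𝓝 (Ring.inverse (L x₀))) := by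
  refine tendsto_of_quadratic (fun p => (h.pos p.1 p.2).inverse.symm) (h.pos_lim x₀).inverse.symm
    fun w => tendsto_order.2 ⟨fun c hc => ?_, fun c hc => ?_⟩
  · have hcont : Continuous fun x => ⟪Ring.inverse (L x) w, w⟫_ℝ :=
      continuousOn_univ.1 ((h.convexOn_inverse w).continuousOn isOpen_univ)
    have := (hcont.tendsto x₀).eventually (lt_mem_nhds hc)
    filter_upwards [tendsto_snd.eventually this] with p hp
    exact hp.trans_le (h.inverse_inner_le _ _ _)
  · obtain ⟨N, hN⟩ := ((tendsto_inner_apply (h.tendsto_inverse x₀) w w).eventually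
      (gt_mem_nhds hc)).exists
    have hcont : Continuous fun x => ⟪Ring.inverse (A N x) w, w⟫_ℝ :=
      ((continuous_inverse_comp (h.contDiff N).continuous (h.pos N)).clm_apply
        continuous_const).inner continuous_const
    have := (hcont.tendsto x₀).eventually (gt_mem_nhds hN)
    filter_upwards [tendsto_snd.eventually this,
      tendsto_fst.eventually (eventually_ge_atTop N)] with p hp hn
    exact ((h.pos N p.2).inverse_anti (h.pos p.1 p.2) (fun u => h.mono p.2 u hn) w).trans_lt hp

theorem tendsto_prod [FiniteDimensional ℝ T] (h : MonoApprox A L) (x₀ : T) :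
    Tendsto (fun p : ℕ × T => A p.1 p.2) (atTop ×ˢ 𝓝 x₀) (𝓝 (L x₀)) := by
  have := (h.pos_lim x₀).inverse.continuousAt_inverse.tendsto.comp (h.tendsto_inverse_prod x₀)
  rw [(h.pos_lim x₀).inverse_inverse] at this
  refine this.congr fun p => ?_
  exact (h.pos p.1 p.2).inverse_inverse

theorem tendsto_fderiv_prod [FiniteDimensional ℝ T] (h : MonoApprox A L) {x₀ e : T}
    {M : H →L[ℝ] H} (hM : HasDerivAt (fun s : ℝ => Ring.inverse (L (x₀ + s • e))) M 0) :
    Tendsto (fun p : ℕ × T => fderiv ℝ (A p.1) p.2 e) (atTop ×ˢ 𝓝 x₀)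
      (𝓝 (-(L x₀ * M * L x₀))) := by
  have hd : ∀ n y, DifferentiableAt ℝ (A n) y := fun n =>
    (h.contDiff n).differentiable (by norm_num)
  have symD : ∀ n y u v, ⟪fderiv ℝ (A n) y e u, v⟫_ℝ = ⟪fderiv ℝ (A n) y e v, u⟫_ℝ := fun n y =>
    inner_fderiv_symm (hd n) (fun y => (h.pos n y).symm) y e
  have hMs : ∀ u v, ⟪M u, v⟫_ℝ = ⟪M v, u⟫_ℝ := by
    refine symm_of_tendsto (fun s u v => ?_) (hasDerivAt_iff_tendsto_slope.1 hM)
    simp only [slope, vsub_eq_sub, _root_.smul_apply, _root_.sub_apply, inner_smul_left,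
      inner_sub_left, (h.pos_lim _).inverse.symm u v]
  have key : Tendsto (fun p : ℕ × T => Ring.inverse (A p.1 p.2) * fderiv ℝ (A p.1) p.2 e *
      Ring.inverse (A p.1 p.2)) (atTop ×ˢ 𝓝 x₀) (𝓝 (-M)) := by
    refine tendsto_of_quadratic (fun p u v => ?_) (fun u v => ?_) fun w => ?_
    · simp only [mul_apply_eq_comp]
      rw [(h.pos p.1 p.2).inverse.symm, (h.pos p.1 p.2).inverse.symm _ u, real_inner_comm,
        symD, real_inner_comm]
    · simp [hMs u v]
    · have h1 : HasDerivAt (fun s : ℝ => ⟪Ring.inverse (L (x₀ + s • e)) w, w⟫_ℝ) ⟪M w, w⟫_ℝ 0 := by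
        simpa using (hM.clm_apply (hasDerivAt_const 0 w)).inner ℝ (hasDerivAt_const 0 w)
      have h2 : ∀ p : ℕ × T, ∀ s : ℝ, ⟪Ring.inverse (A p.1 (p.2 + (0 : ℝ) • e)) w, w⟫_ℝ +
          s * -⟪fderiv ℝ (A p.1) p.2 e (Ring.inverse (A p.1 p.2) w), Ring.inverse (A p.1 p.2) w⟫_ℝ
          ≤ ⟪Ring.inverse (A p.1 (p.2 + s • e)) w, w⟫_ℝ := fun p s => by
        refine ConvexOn.add_mul_le (convexOn_inner_inverse_comp_line (h.contDiff p.1) (h.pos p.1)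
          (h.logConcave p.1) p.2 e w) ?_ s
        have := hasDerivAt_inner_inverse (fun s => h.pos p.1 (p.2 + s • e))
          (hasDerivAt_comp_line ((h.contDiff p.1).of_le (by norm_num)) p.2 e) w 0
        simpa using this
      have h3 := (tendsto_of_subgradient (l := atTop ×ˢ 𝓝 x₀)
        (φ := fun (p : ℕ × T) s => ⟪Ring.inverse (A p.1 (p.2 + s • e)) w, w⟫_ℝ) h2
        (fun s => ?_) h1).neg
      · simp only [neg_neg] at h3
        simp only [mul_apply_eq_comp, _root_.neg_apply, inner_neg_left]
        refine h3.congr fun p => ?_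
        rw [(h.pos p.1 p.2).inverse.symm, real_inner_comm]
      · have h4 : Tendsto (fun p : ℕ × T => (p.1, p.2 + s • e)) (atTop ×ˢ 𝓝 x₀)
            (atTop ×ˢ 𝓝 (x₀ + s • e)) :=
          tendsto_fst.prodMk (tendsto_snd.add_const _)
        exact tendsto_inner_apply ((h.tendsto_inverse_prod _).comp h4) w w
  have h5 := ((h.tendsto_prod x₀).mul key).mul (h.tendsto_prod x₀)
  simp only [mul_neg, neg_mul] at h5
  refine h5.congr fun p => ?_
  ext u
  simp only [mul_apply_eq_comp]
  rw [(h.pos p.1 p.2).apply_inverse, (h.pos p.1 p.2).inverse_apply]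

variable {I : Type*} [Fintype I] {A : I → ℕ → T → H →L[ℝ] H} {L : I → T → H →L[ℝ] H}

/-- If a finite sum of limits is differentiable, then each summand is. -/
theorem exists_hasDerivAt_inverse {α : T → H →L[ℝ] H} (h : ∀ i, MonoApprox (A i) (L i))
    (hα : Differentiable ℝ α) (hsum : ∀ x, ∑ i, L i x = α x) (x₀ e : T) :
    ∃ M : I → H →L[ℝ] H, (∀ i, HasDerivAt (fun s : ℝ => Ring.inverse (L i (x₀ + s • e))) (M i) 0) ∧
      ∑ i, -(L i x₀ * M i * L i x₀) = fderiv ℝ α x₀ e := by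
  have hc : ∀ i, ∃ M N : H →L[ℝ] H,
      HasDerivWithinAt (fun s : ℝ => Ring.inverse (L i (x₀ + s • e))) M (Set.Iio 0) 0 ∧
      HasDerivWithinAt (fun s : ℝ => Ring.inverse (L i (x₀ + s • e))) N (Set.Ioi 0) 0 ∧
      (∀ u v, ⟪M u, v⟫_ℝ = ⟪M v, u⟫_ℝ) ∧ (∀ u v, ⟪N u, v⟫_ℝ = ⟪N v, u⟫_ℝ) ∧
      ∀ u, ⟪M u, u⟫_ℝ ≤ ⟪N u, u⟫_ℝ := fun i => by
    refine exists_oneSided_deriv (fun s => ((h i).pos_lim _).inverse.symm) fun u => ?_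
    have := ((h i).convexOn_inverse u).comp_affineMap (AffineMap.lineMap x₀ (x₀ + e))
    simpa [Function.comp_def, AffineMap.lineMap_apply, add_comm] using this
  choose M N hM hN sM sN hle using hc
  have hα' : HasDerivAt (fun s : ℝ => α (x₀ + s • e)) (fderiv ℝ α x₀ e) 0 := by
    have h1 : HasDerivAt (fun s : ℝ => x₀ + s • e) e 0 := by
      simpa using ((hasDerivAt_id (0 : ℝ)).smul_const e).const_add x₀
    have h2 : HasFDerivAt α (fderiv ℝ α x₀) (x₀ + (0 : ℝ) • e) := by
      simpa using (hα x₀).hasFDerivAt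
    exact h2.comp_hasDerivAt 0 h1
  have key : ∀ (K : I → H →L[ℝ] H) (S : Set ℝ), UniqueDiffWithinAt ℝ S 0 →
      (∀ i, HasDerivWithinAt (fun s : ℝ => Ring.inverse (L i (x₀ + s • e))) (K i) S 0) →
      ∑ i, -(L i x₀ * K i * L i x₀) = fderiv ℝ α x₀ e := by
    intro K S hS hK
    have h1 : ∀ i, HasDerivWithinAt (fun s : ℝ => L i (x₀ + s • e))
        (-(L i x₀ * K i * L i x₀)) S 0 :=
      fun i => by
        simpa [((h i).pos_lim _).inverse_inverse] using
          hasDerivAt_inverse ((h i).pos_lim _).inverse (hK i)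
    have h2 := HasDerivWithinAt.fun_sum (u := Finset.univ) fun i _ => h1 i
    simp only [hsum] at h2
    exact hS.eq_deriv _ h2 hα'.hasDerivWithinAt
  have e1 := key M _ (uniqueDiffWithinAt_Iio 0) hM
  have e2 := key N _ (uniqueDiffWithinAt_Ioi 0) hN
  have hz : ∀ u i, ⟪N i (L i x₀ u), L i x₀ u⟫_ℝ - ⟪M i (L i x₀ u), L i x₀ u⟫_ℝ = 0 := by
    intro u
    have h3 := congrArg (fun K : H →L[ℝ] H => ⟪K u, u⟫_ℝ) (e1.trans e2.symm)
    simp only [_root_.sum_apply, _root_.neg_apply, mul_apply_eq_comp, sum_inner, inner_neg_left,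
      ((h _).pos_lim x₀).symm _ u] at h3
    have h4 : ∑ i, (⟪N i (L i x₀ u), L i x₀ u⟫_ℝ - ⟪M i (L i x₀ u), L i x₀ u⟫_ℝ) = 0 := by
      simp only [Finset.sum_sub_distrib, Finset.sum_neg_distrib, real_inner_comm] at h3 ⊢
      linarith
    have := (Finset.sum_eq_zero_iff_of_nonneg fun i _ => sub_nonneg.2 (hle i _)).1 h4
    exact fun i => this i (Finset.mem_univ i)
  have hMN : ∀ i, M i = N i := fun i => eq_of_quadratic (sM i) (sN i) fun u => by
    have := hz (Ring.inverse (L i x₀) u) i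
    rw [((h i).pos_lim x₀).apply_inverse] at this
    linarith
  refine ⟨M, fun i => ?_, e1⟩
  rw [hasDerivAt_iff_tendsto_slope, ← nhdsLT_sup_nhdsGT]
  refine Tendsto.sup ((hasDerivWithinAt_iff_tendsto_slope' (by simp)).1 (hM i)) ?_
  rw [hMN]
  exact (hasDerivWithinAt_iff_tendsto_slope' (by simp)).1 (hN i)

theorem exists_tendsto_firstVar [FiniteDimensional ℝ T] {α : T → H →L[ℝ] H}
    (h : ∀ i, MonoApprox (A i) (L i)) (hα : Differentiable ℝ α)
    (hsum : ∀ x, ∑ i, L i x = α x) (x₀ : T) {ι : Type} [Fintype ι] (e : ι → T) (v : ι → H) :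
    ∃ w : I → H, (∀ i, Tendsto (fun p : ℕ × T => firstVar (A i p.1) p.2 e v) (atTop ×ˢ 𝓝 x₀)
      (𝓝 (w i))) ∧ ∑ i, w i = firstVar α x₀ e v := by
  choose M hM hsumM using fun j => exists_hasDerivAt_inverse h hα hsum x₀ (e j)
  refine ⟨fun i => ∑ j, (-(L i x₀ * M j i * L i x₀)) (v j), fun i => ?_, ?_⟩
  · exact tendsto_finsetSum _ fun j _ =>
      tendsto_apply ((h i).tendsto_fderiv_prod (hM j i)) (v j)
  · rw [Finset.sum_comm]
    simp only [firstVar]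
    refine Finset.sum_congr rfl fun j _ => ?_
    rw [← hsumM j, _root_.sum_apply]

end MonoApprox

end MonotoneLimit

section WeakLimit
set_option maxSynthPendingDepth 3
open scoped InnerProductSpace Topology Interval
open Filter

variable {T H : Type*} [NormedAddCommGroup T] [NormedSpace ℝ T] [FiniteDimensional ℝ T]
  [MeasurableSpace T] [BorelSpace T]
  [NormedAddCommGroup H] [InnerProductSpace ℝ H] [FiniteDimensional ℝ H] [CompleteSpace H]

theorem fderiv_fderiv_apply {V W : Type*} [NormedAddCommGroup V] [NormedSpace ℝ V]
    [NormedAddCommGroup W] [NormedSpace ℝ W] {G : T → V} (hG : ContDiff ℝ 2 G) (Λ : V →L[ℝ] W)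
    (x a b : T) :
    fderiv ℝ (fderiv ℝ fun y => Λ (G y)) x a b = Λ (fderiv ℝ (fderiv ℝ G) x a b) := by
  have h1 : (fderiv ℝ fun y => Λ (G y)) = fun y => Λ.comp (fderiv ℝ G y) := by
    funext y
    exact (Λ.hasFDerivAt.comp y ((hG.differentiable (by norm_num)) y).hasFDerivAt).fderiv
  have h2 : DifferentiableAt ℝ (fderiv ℝ G) x :=
    (hG.fderiv_right (m := 1) (by norm_num)).differentiable (by norm_num) x
  have h3 : HasFDerivAt (fun y => Λ.comp (fderiv ℝ G y)) _ x :=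
    (ContinuousLinearMap.compL ℝ T V W Λ).hasFDerivAt.comp x h2.hasFDerivAt
  rw [h1, h3.fderiv]
  rfl

theorem secondVar_eq_sum {ι : Type*} [Fintype ι] {G : T → H →L[ℝ] H} (hG : ContDiff ℝ 2 G) (x : T)
    (e : ι → T) (v : ι → H) : secondVar G x e v =
      ∑ j, ∑ k, fderiv ℝ (fderiv ℝ fun y => ⟪G y (v j), v k⟫_ℝ) x (e k) (e j) := by
  refine Finset.sum_congr rfl fun j _ => Finset.sum_congr rfl fun k _ => ?_
  have := fderiv_fderiv_apply hG ((innerSL ℝ (v k)).comp (ContinuousLinearMap.apply ℝ H (v j)))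
    x (e k) (e j)
  simp only [ContinuousLinearMap.comp_apply, ContinuousLinearMap.apply_apply,
    innerSL_apply_apply] at this
  simpa only [real_inner_comm] using this.symm

theorem integral_mul_fderiv_fderiv {μ : Measure T} [μ.IsAddHaarMeasure] {χ g : T → ℝ}
    (hχ : ContDiff ℝ 2 χ) (hc : HasCompactSupport χ) (hg : ContDiff ℝ 2 g) (a b : T) :
    ∫ x, χ x * fderiv ℝ (fderiv ℝ g) x b a ∂μ = ∫ x, fderiv ℝ (fderiv ℝ χ) x a b * g x ∂μ := by
  have hg1 : ContDiff ℝ 1 (fderiv ℝ g) := hg.fderiv_right (by norm_num)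
  have hχ1 : ContDiff ℝ 1 (fderiv ℝ χ) := hχ.fderiv_right (by norm_num)
  have hc1 : HasCompactSupport fun y => fderiv ℝ χ y b := hc.fderiv_apply ℝ b
  have hd : ∀ (f : T → ℝ), ContDiff ℝ 1 (fderiv ℝ f) → ∀ c x d,
      fderiv ℝ (fun y => fderiv ℝ f y c) x d = fderiv ℝ (fderiv ℝ f) x d c := by
    intro f hf c x d
    rw [((hf.differentiable one_ne_zero x).hasFDerivAt.clm_apply (hasFDerivAt_const c x)).fderiv]
    simp
  have c1 : Continuous χ := hχ.continuous
  have c2 : Continuous g := hg.continuous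
  have c3 := hg1.continuous
  have c4 := hχ1.continuous
  have c5 : Continuous (fderiv ℝ (fderiv ℝ g)) := hg1.continuous_fderiv one_ne_zero
  have c6 : Continuous (fderiv ℝ (fderiv ℝ χ)) := hχ1.continuous_fderiv one_ne_zero
  have c7 : Continuous fun x => fderiv ℝ χ x b := by fun_prop
  have hc2 : HasCompactSupport fun y => fderiv ℝ (fun y => fderiv ℝ χ y b) y a :=
    hc1.fderiv_apply ℝ a
  have e1 := integral_mul_fderiv_eq_neg_fderiv_mul_of_integrable (μ := μ) (f := χ)
    (g := fun y => fderiv ℝ g y a) (v := b)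
    ((show Continuous fun x => fderiv ℝ χ x b * fderiv ℝ g x a by
      fun_prop).integrable_of_hasCompactSupport
      hc1.mul_right)
    (by
      simp only [hd g hg1]
      exact (show Continuous fun x => χ x * fderiv ℝ (fderiv ℝ g) x b a by
        fun_prop).integrable_of_hasCompactSupport hc.mul_right)
    ((show Continuous fun x => χ x * fderiv ℝ g x a by fun_prop).integrable_of_hasCompactSupport
      hc.mul_right)
    (fun x _ => hχ.differentiable (by norm_num) x)
    (fun x _ => (hg1.differentiable one_ne_zero x).clm_apply (differentiableAt_const a))
  have e2 := integral_mul_fderiv_eq_neg_fderiv_mul_of_integrable (μ := μ)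
    (f := fun y => fderiv ℝ χ y b) (g := g) (v := a)
    (by
      refine Continuous.integrable_of_hasCompactSupport ?_ hc2.mul_right
      simp only [hd χ hχ1]
      fun_prop)
    ((show Continuous fun x => fderiv ℝ χ x b * fderiv ℝ g x a by
      fun_prop).integrable_of_hasCompactSupport
      hc1.mul_right)
    ((show Continuous fun x => fderiv ℝ χ x b * g x by fun_prop).integrable_of_hasCompactSupport
      hc1.mul_right)
    (fun x _ => (hχ1.differentiable one_ne_zero x).clm_apply (differentiableAt_const b))
    (fun x _ => hg.differentiable (by norm_num) x)
  simp only [hd g hg1, hd χ hχ1] at e1 e2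
  rw [e1, e2, neg_neg]

theorem exists_smooth_bump (μ : Measure T) [μ.IsAddHaarMeasure] (x₀ : T) {r : ℝ} (hr : 0 < r) :
    ∃ χ : T → ℝ, ContDiff ℝ 2 χ ∧ HasCompactSupport χ ∧ (∀ x, 0 ≤ χ x) ∧
      (∀ x ∉ Metric.ball x₀ r, χ x = 0) ∧ 0 < ∫ x, χ x ∂μ := by
  let χ : ContDiffBump x₀ := ⟨r / 2, r, by linarith, by linarith⟩
  exact ⟨χ, χ.contDiff, χ.hasCompactSupport, χ.nonneg', fun x hx => χ.zero_of_le_dist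
    (by simpa using hx), χ.integral_pos⟩

/-- A sequence tending to zero pointwise cannot have second variations bounded below. -/
theorem not_eventually_le_secondVar {G : ℕ → T → H →L[ℝ] H} (hG : ∀ n, ContDiff ℝ 2 (G n))
    {C : H → H → T → ℝ} (hC : ∀ u v, Continuous (C u v))
    (hb : ∀ n x u v, |⟪G n x u, v⟫_ℝ| ≤ C u v x)
    (hlim : ∀ x u v, Tendsto (fun n => ⟪G n x u, v⟫_ℝ) atTop (𝓝 0))
    {ι : Type*} [Fintype ι] (x₀ : T) (e : ι → T) (v : ι → H) {κ : ℝ} (hκ : 0 < κ) :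
    ¬ ∀ᶠ p : ℕ × T in atTop ×ˢ 𝓝 x₀, κ ≤ secondVar (G p.1) p.2 e v := by
  intro hev
  obtain ⟨μ, hμ⟩ : ∃ μ : Measure T, μ.IsAddHaarMeasure := ⟨Measure.addHaar, inferInstance⟩
  rw [eventually_prod_iff] at hev
  obtain ⟨S, hS, U, hU, hSU⟩ := hev
  obtain ⟨N, hN⟩ := eventually_atTop.1 hS
  obtain ⟨r, hr, hrU⟩ := Metric.eventually_nhds_iff_ball.1 hU
  dsimp only at hSU
  obtain ⟨χ, hχ, hχc, hχ0, hχz, hχp⟩ := exists_smooth_bump μ x₀ hr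
  have hχ1 : ContDiff ℝ 1 (fderiv ℝ χ) := hχ.fderiv_right (by norm_num)
  have c6 : Continuous (fderiv ℝ (fderiv ℝ χ)) := hχ1.continuous_fderiv one_ne_zero
  have hsc : ∀ n u w, ContDiff ℝ 2 fun y => ⟪G n y u, w⟫_ℝ := fun n u w =>
    ((hG n).clm_apply contDiff_const).inner ℝ contDiff_const
  have hcs : ∀ a b, HasCompactSupport fun x => fderiv ℝ (fderiv ℝ χ) x a b := fun a b => by
    have h1 : HasCompactSupport (fderiv ℝ (fderiv ℝ χ)) := (hχc.fderiv ℝ).fderiv ℝ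
    exact h1.comp_left (g := fun L : T →L[ℝ] T →L[ℝ] ℝ => L a b) rfl
  have cont2 : ∀ n u w a b, Continuous fun x => fderiv ℝ (fderiv ℝ fun y => ⟪G n y u, w⟫_ℝ) x a b :=
    fun n u w a b => by
      have h1 : ContDiff ℝ 1 (fderiv ℝ fun y => ⟪G n y u, w⟫_ℝ) :=
        (hsc n u w).fderiv_right (by norm_num)
      have := h1.continuous_fderiv one_ne_zero
      fun_prop
  have hint : ∀ n, ∫ x, χ x * secondVar (G n) x e v ∂μ
      = ∑ j, ∑ k, ∫ x, fderiv ℝ (fderiv ℝ χ) x (e j) (e k) * ⟪G n x (v j), v k⟫_ℝ ∂μ := by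
    intro n
    have hi : ∀ j k, Integrable (fun x => χ x *
        fderiv ℝ (fderiv ℝ fun y => ⟪G n y (v j), v k⟫_ℝ) x (e k) (e j)) μ := fun j k =>
      (hχ.continuous.mul (cont2 n _ _ _ _)).integrable_of_hasCompactSupport
        hχc.mul_right
    simp only [secondVar_eq_sum (hG n), Finset.mul_sum]
    rw [integral_finsetSum _ fun j _ => integrable_finsetSum _ fun k _ => hi j k]
    refine Finset.sum_congr rfl fun j _ => ?_
    rw [integral_finsetSum _ fun k _ => hi j k]
    exact Finset.sum_congr rfl fun k _ =>
      integral_mul_fderiv_fderiv hχ hχc (hsc n _ _) _ _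
  have hzero : Tendsto (fun n => ∫ x, χ x * secondVar (G n) x e v ∂μ) atTop (𝓝 0) := by
    simp only [hint]
    have : ∀ j k, Tendsto (fun n => ∫ x, fderiv ℝ (fderiv ℝ χ) x (e j) (e k)
        * ⟪G n x (v j), v k⟫_ℝ ∂μ) atTop (𝓝 (∫ _, (0 : ℝ) ∂μ)) := fun j k => by
      refine tendsto_integral_of_dominated_convergence
        (fun x => ‖fderiv ℝ (fderiv ℝ χ) x (e j) (e k)‖ * C (v j) (v k) x)
        (fun n => ?_) ?_ (fun n => ae_of_all _ fun x => ?_) (ae_of_all _ fun x => ?_)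
      · have := (hsc n (v j) (v k)).continuous
        exact Continuous.aestronglyMeasurable (by fun_prop)
      · have := hC (v j) (v k)
        exact Continuous.integrable_of_hasCompactSupport (by fun_prop) (hcs _ _).norm.mul_right
      · rw [norm_mul]
        exact mul_le_mul_of_nonneg_left (hb n x _ _) (norm_nonneg _)
      · simpa using (hlim x (v j) (v k)).const_mul (fderiv ℝ (fderiv ℝ χ) x (e j) (e k))
    simpa using tendsto_finsetSum Finset.univ fun j _ => tendsto_finsetSum Finset.univ
      fun k _ => this j k
  have hpos : 0 < κ * ∫ x, χ x ∂μ := mul_pos hκ hχp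
  refine hpos.not_ge (ge_of_tendsto hzero ?_)
  filter_upwards [eventually_ge_atTop N] with n hn
  rw [← integral_const_mul]
  have cS : Continuous fun x => secondVar (G n) x e v := by
    simp only [secondVar_eq_sum (hG n)]
    exact continuous_finsetSum _ fun j _ => continuous_finsetSum _ fun k _ => cont2 n _ _ _ _
  refine integral_mono ((hχ.continuous.integrable_of_hasCompactSupport hχc).const_mul κ)
    ((hχ.continuous.mul cS).integrable_of_hasCompactSupport hχc.mul_right) fun x => ?_
  by_cases hx : x ∈ Metric.ball x₀ r
  · have h1 : κ ≤ secondVar (G n) x e v := hSU (hN n hn) (hrU x hx)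
    have h2 := mul_le_mul_of_nonneg_left h1 (hχ0 x)
    linarith
  · have : χ x = 0 := hχz x hx
    simp [this]

theorem secondVar_sub {ι : Type*} [Fintype ι] {A B : T → H →L[ℝ] H} (hA : ContDiff ℝ 2 A)
    (hB : ContDiff ℝ 2 B) (x : T) (e : ι → T) (v : ι → H) :
    secondVar (fun y => A y - B y) x e v = secondVar A x e v - secondVar B x e v := by
  have h1 : fderiv ℝ (fun y => A y - B y) = fun y => fderiv ℝ A y - fderiv ℝ B y := by
    funext y
    exact fderiv_fun_sub (hA.differentiable (by norm_num) y) (hB.differentiable (by norm_num) y)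
  have hA1 : ContDiff ℝ 1 (fderiv ℝ A) := hA.fderiv_right (by norm_num)
  have hB1 : ContDiff ℝ 1 (fderiv ℝ B) := hB.fderiv_right (by norm_num)
  have h2 : fderiv ℝ (fun y => fderiv ℝ A y - fderiv ℝ B y) x
      = fderiv ℝ (fderiv ℝ A) x - fderiv ℝ (fderiv ℝ B) x :=
    fderiv_fun_sub (hA1.differentiable one_ne_zero x) (hB1.differentiable one_ne_zero x)
  simp only [secondVar, h1, h2, _root_.sub_apply, inner_sub_left, Finset.sum_sub_distrib]

theorem secondVar_sum {ι I : Type*} [Fintype ι] {A : I → T → H →L[ℝ] H} (s : Finset I)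
    (hA : ∀ i, ContDiff ℝ 2 (A i)) (x : T) (e : ι → T) (v : ι → H) :
    secondVar (fun y => ∑ i ∈ s, A i y) x e v = ∑ i ∈ s, secondVar (A i) x e v := by
  have h1 : fderiv ℝ (fun y => ∑ i ∈ s, A i y) = fun y => ∑ i ∈ s, fderiv ℝ (A i) y := by
    funext y
    exact fderiv_fun_sum fun i _ => (hA i).differentiable (by norm_num) y
  have hA1 : ∀ i, ContDiff ℝ 1 (fderiv ℝ (A i)) := fun i => (hA i).fderiv_right (by norm_num)
  have h2 : fderiv ℝ (fun y => ∑ i ∈ s, fderiv ℝ (A i) y) x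
      = ∑ i ∈ s, fderiv ℝ (fderiv ℝ (A i)) x :=
    fderiv_fun_sum fun i _ => (hA1 i).differentiable one_ne_zero x
  simp only [secondVar, h1, h2, _root_.sum_apply, sum_inner]
  conv_rhs =>
    rw [Finset.sum_comm]
    enter [2, j]
    rw [Finset.sum_comm]

end WeakLimit

section SecondVar
set_option maxSynthPendingDepth 3
open scoped InnerProductSpace Topology Interval
open Filter

variable {T H : Type*} [NormedAddCommGroup T] [NormedSpace ℝ T] [FiniteDimensional ℝ T]
  [MeasurableSpace T] [BorelSpace T]
  [NormedAddCommGroup H] [InnerProductSpace ℝ H] [FiniteDimensional ℝ H] [CompleteSpace H]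

/-- Second-order estimate for a sum of monotone limits of matrix log-concave functions. -/
theorem MonoApprox.secondVar_le {I : Type*} [Fintype I] {A : I → ℕ → T → H →L[ℝ] H}
    {L : I → T → H →L[ℝ] H} {α : T → H →L[ℝ] H} (h : ∀ i, MonoApprox (A i) (L i))
    (hα : ContDiff ℝ 2 α) (hsum : ∀ x, ∑ i, L i x = α x) {ι : Type} [Fintype ι]
    (hq : ∀ i n x (e : ι → T) (v : ι → H), 0 ≤ schurQ (A i n) x e v)
    (x₀ : T) (e : ι → T) (v : ι → H) :
    ∃ w : I → H, (∀ i, Tendsto (fun n => firstVar (A i n) x₀ e v) atTop (𝓝 (w i))) ∧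
      ∑ i, w i = firstVar α x₀ e v ∧
      secondVar α x₀ e v ≤ ∑ i, ⟪Ring.inverse (L i x₀) (w i), w i⟫_ℝ := by
  obtain ⟨w, hw, hsumw⟩ := exists_tendsto_firstVar h (hα.differentiable (by norm_num)) hsum x₀ e v
  have hpair : Tendsto (fun n : ℕ => (n, x₀)) atTop (atTop ×ˢ 𝓝 x₀) :=
    tendsto_id.prodMk tendsto_const_nhds
  refine ⟨w, fun i => ?_, hsumw, ?_⟩
  · have := (hw i).comp hpair
    simpa only [Function.comp_def] using this
  by_contra! hlt
  obtain ⟨κ, hκ0, hκ⟩ := exists_between (sub_pos.2 hlt)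
  have hAd : ∀ n, ContDiff ℝ 2 fun y => ∑ i, A i n y := fun n =>
    ContDiff.sum fun i _ => (h i).contDiff n
  have hquad : ∀ n x u, 0 ≤ ⟪(α x - ∑ i, A i n x) u, u⟫_ℝ ∧
      ⟪(α x - ∑ i, A i n x) u, u⟫_ℝ ≤ ⟪(α x - ∑ i, A i 0 x) u, u⟫_ℝ := by
    intro n x u
    simp only [← hsum, _root_.sub_apply, _root_.sum_apply, inner_sub_left, sum_inner]
    exact ⟨sub_nonneg.2 (Finset.sum_le_sum fun i _ => (h i).inner_le n x u),
      sub_le_sub_left (Finset.sum_le_sum fun i _ => (h i).mono x u (Nat.zero_le n)) _⟩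
  have hsymm : ∀ n x u w, ⟪(α x - ∑ i, A i n x) u, w⟫_ℝ = ⟪(α x - ∑ i, A i n x) w, u⟫_ℝ := by
    intro n x u w
    simp only [← hsum, _root_.sub_apply, _root_.sum_apply, inner_sub_left, sum_inner,
      ((h _).pos_lim x).symm u w, ((h _).pos n x).symm u w]
  refine not_eventually_le_secondVar (G := fun n x => α x - ∑ i, A i n x)
    (fun n => hα.sub (hAd n))
    (C := fun u w x => (⟪(α x - ∑ i, A i 0 x) u, u⟫_ℝ + ⟪(α x - ∑ i, A i 0 x) w, w⟫_ℝ) / 2)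
    (fun u w => ?_) (fun n x u w => ?_) (fun x u w => ?_) x₀ e v
    hκ0 ?_
  · have := (hα.sub (hAd 0)).continuous
    fun_prop
  · have h1 := (hquad n x (u + w)).1
    have h2 := (hquad n x (u - w)).1
    have h3 := (hquad n x u).2
    have h4 := (hquad n x w).2
    have h5 := hsymm n x u w
    rw [abs_le]
    rw [map_add, inner_add_left, inner_add_right, inner_add_right] at h1
    rw [map_sub, inner_sub_left, inner_sub_right, inner_sub_right] at h2
    constructor <;> linarith
  · have h1 : Tendsto (fun n => α x - ∑ i, A i n x) atTop (𝓝 0) := by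
      have := (tendsto_const_nhds (x := α x) (f := (atTop : Filter ℕ))).sub
        (tendsto_finsetSum Finset.univ fun i _ => (h i).lim x)
      rwa [hsum, sub_self] at this
    simpa using tendsto_inner_apply h1 u w
  · have hr : Tendsto (fun p : ℕ × T => secondVar α p.2 e v -
        ∑ i, ⟪Ring.inverse (A i p.1 p.2) (firstVar (A i p.1) p.2 e v),
          firstVar (A i p.1) p.2 e v⟫_ℝ) (atTop ×ˢ 𝓝 x₀)
        (𝓝 (secondVar α x₀ e v - ∑ i, ⟪Ring.inverse (L i x₀) (w i), w i⟫_ℝ)) := by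
      refine Tendsto.sub ?_ (tendsto_finsetSum _ fun i _ => ?_)
      · have hα1 : ContDiff ℝ 1 (fderiv ℝ α) := hα.fderiv_right (by norm_num)
        have hα2 := hα1.continuous_fderiv one_ne_zero
        have : Continuous fun x => secondVar α x e v := by
          unfold secondVar
          fun_prop
        exact (this.tendsto x₀).comp tendsto_snd
      · have hev : Continuous fun p : (H →L[ℝ] H) × H => p.1 p.2 :=
          isBoundedBilinearMap_apply.continuous
        exact ((hev.tendsto _).comp (((h i).tendsto_inverse_prod x₀).prodMk_nhds (hw i))).inner
          (hw i)
    refine (hr.eventually (lt_mem_nhds hκ)).mono fun p hp => hp.le.trans ?_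
    rw [secondVar_sub hα (hAd p.1), secondVar_sum _ fun i => (h i).contDiff p.1]
    refine sub_le_sub_left (Finset.sum_le_sum fun i _ => ?_) _
    have := hq i p.1 p.2 e v
    unfold schurQ at this
    linarith

end SecondVar

section BoxApprox
set_option maxSynthPendingDepth 3
open scoped InnerProductSpace Topology Interval
open Filter

variable {E T H : Type*} [NormedAddCommGroup E] [NormedSpace ℝ E] [FiniteDimensional ℝ E]
  [NormedAddCommGroup T] [NormedSpace ℝ T]
  [NormedAddCommGroup H] [InnerProductSpace ℝ H] [FiniteDimensional ℝ H] [CompleteSpace H]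

theorem fderiv_comp_clm {V : Type*} [NormedAddCommGroup V] [NormedSpace ℝ V] {Φ : E → V}
    (hΦ : Differentiable ℝ Φ) (J : T →L[ℝ] E) (t : T) :
    fderiv ℝ (fun t => Φ (J t)) t = (fderiv ℝ Φ (J t)).comp J :=
  ((hΦ (J t)).hasFDerivAt.comp t J.hasFDerivAt).fderiv

theorem fderiv_fderiv_comp_clm {V : Type*} [NormedAddCommGroup V] [NormedSpace ℝ V] {Φ : E → V}
    (hΦ : ContDiff ℝ 2 Φ) (J : T →L[ℝ] E) (t a b : T) :
    fderiv ℝ (fderiv ℝ fun t => Φ (J t)) t a b = fderiv ℝ (fderiv ℝ Φ) (J t) (J a) (J b) := by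
  have h1 : (fderiv ℝ fun t => Φ (J t)) = fun t => (fderiv ℝ Φ (J t)).comp J :=
    funext fun t => fderiv_comp_clm (hΦ.differentiable (by norm_num)) J t
  have h2 : DifferentiableAt ℝ (fderiv ℝ Φ) (J t) :=
    (hΦ.fderiv_right (m := 1) (by norm_num)).differentiable (by norm_num) _
  have h3 : HasFDerivAt (fun t => fderiv ℝ Φ (J t)) ((fderiv ℝ (fderiv ℝ Φ) (J t)).comp J) t :=
    h2.hasFDerivAt.comp t J.hasFDerivAt
  have h4 : HasFDerivAt (fun t => (fderiv ℝ Φ (J t)).comp J) _ t :=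
    ((ContinuousLinearMap.compL ℝ T E V).flip J).hasFDerivAt.comp t h3
  rw [h1, h4.fderiv]
  rfl

variable {ι : Type*} [Fintype ι] {G : E → H →L[ℝ] H}

theorem firstVar_comp (hG : Differentiable ℝ G) (J : T →L[ℝ] E) (t : T) (e : ι → T) (v : ι → H) :
    firstVar (fun t => G (J t)) t e v = firstVar G (J t) (fun j => J (e j)) v := by
  simp [firstVar, fderiv_comp_clm hG]

theorem secondVar_comp (hG : ContDiff ℝ 2 G) (J : T →L[ℝ] E) (t : T) (e : ι → T) (v : ι → H) :
    secondVar (fun t => G (J t)) t e v = secondVar G (J t) (fun j => J (e j)) v := by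
  simp [secondVar, fderiv_fderiv_comp_clm hG]

theorem schurQ_comp (hG : ContDiff ℝ 2 G) (J : T →L[ℝ] E) (t : T) (e : ι → T) (v : ι → H) :
    schurQ (fun t => G (J t)) t e v = schurQ G (J t) (fun j => J (e j)) v := by
  simp only [schurQ, firstVar_comp (hG.differentiable (by norm_num)), secondVar_comp hG]

variable {n : ℕ} (f : Fin n → E) (a b : Fin n → ℝ)

theorem continuous_firstVar (hG : ContDiff ℝ 1 G) (e : ι → E) (v : ι → H) :
    Continuous fun x => firstVar G x e v := by
  have := hG.continuous_fderiv one_ne_zero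
  unfold firstVar
  fun_prop

theorem continuous_secondVar (hG : ContDiff ℝ 2 G) (e : ι → E) (v : ι → H) :
    Continuous fun x => secondVar G x e v := by
  have h1 : ContDiff ℝ 1 (fderiv ℝ G) := hG.fderiv_right (by norm_num)
  have := h1.continuous_fderiv one_ne_zero
  unfold secondVar
  fun_prop

theorem inner_integral_apply {X : Type*} [MeasurableSpace X] {μ : Measure X} {Φ : X → H →L[ℝ] H}
    (hΦ : Integrable Φ μ) (u v : H) : ⟪(∫ y, Φ y ∂μ) u, v⟫_ℝ = ∫ y, ⟪Φ y u, v⟫_ℝ ∂μ := by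
  rw [ContinuousLinearMap.integral_apply hΦ, real_inner_comm,
    ← integral_inner (hΦ.apply_continuousLinearMap u)]
  simp only [real_inner_comm]

theorem firstVar_boxI (hG : ContDiff ℝ 1 G) (x : E) (e : ι → E) (v : ι → H) :
    firstVar (boxI f a b G) x e v
      = ∫ y in hbox a b, firstVar G (x + ∑ i, y i • f i) e v := by
  have c1 := hG.continuous_fderiv one_ne_zero
  simp only [firstVar]
  rw [integral_finsetSum _ fun j _ => Continuous.integrableOn_hbox (by fun_prop) a b]
  refine Finset.sum_congr rfl fun j _ => ?_
  have hi : Integrable (fun y => fderiv ℝ G (x + ∑ i, y i • f i)) (volume.restrict (hbox a b)) :=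
    Continuous.integrableOn_hbox (by fun_prop) a b
  rw [fderiv_boxI f a b hG, boxI, ContinuousLinearMap.integral_apply hi,
    ContinuousLinearMap.integral_apply (hi.apply_continuousLinearMap _)]

theorem secondVar_boxI (hG : ContDiff ℝ 2 G) (x : E) (e : ι → E) (v : ι → H) :
    secondVar (boxI f a b G) x e v
      = ∫ y in hbox a b, secondVar G (x + ∑ i, y i • f i) e v := by
  have h1 : ContDiff ℝ 1 (fderiv ℝ G) := hG.fderiv_right (by norm_num)
  have c1 := h1.continuous_fderiv one_ne_zero
  simp only [secondVar]
  rw [integral_finsetSum _ fun j _ => Continuous.integrableOn_hbox (by fun_prop) a b]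
  refine Finset.sum_congr rfl fun j _ => ?_
  rw [integral_finsetSum _ fun j _ => Continuous.integrableOn_hbox (by fun_prop) a b]
  refine Finset.sum_congr rfl fun k _ => ?_
  have hi : Integrable (fun y => fderiv ℝ (fderiv ℝ G) (x + ∑ i, y i • f i))
      (volume.restrict (hbox a b)) := Continuous.integrableOn_hbox (by fun_prop) a b
  rw [fderiv_boxI f a b (hG.of_le (by norm_num)), fderiv_boxI f a b h1, boxI,
    ContinuousLinearMap.integral_apply hi,
    ContinuousLinearMap.integral_apply (hi.apply_continuousLinearMap _),
    inner_integral_apply ((hi.apply_continuousLinearMap _).apply_continuousLinearMap _)]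

theorem hbox_mono {a b a' b' : Fin n → ℝ} (ha : a' ≤ a) (hb : b ≤ b') : hbox a b ⊆ hbox a' b' :=
  Set.pi_mono fun i _ => Set.Ioc_subset_Ioc (ha i) (hb i)

variable (G) in
/-- The marginal of `G` over a measurable set of fibre coordinates. -/
def marginal (J : T →L[ℝ] E) (f : Fin n → E) (U : Set (Fin n → ℝ)) (t : T) : H →L[ℝ] H :=
  ∫ y in U, G (J t + ∑ i, y i • f i)

variable {f} in
theorem monoApprox_boxI (hG : ContDiff ℝ 2 G) (hpos : ∀ x, PosDefOp (G x))
    (hq : ∀ {ι : Type} [Fintype ι] x (e : ι → E) (v : ι → H), 0 ≤ schurQ G x e v)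
    (J : T →L[ℝ] E) (hint : ∀ t, Integrable fun y : Fin n → ℝ => G (J t + ∑ i, y i • f i))
    {a b : ℕ → Fin n → ℝ} (hab : ∀ k i, a k i < b k i) (ha : Antitone a) (hb : Monotone b) :
    MonoApprox (fun k t => boxI f (a k) (b k) G (J t))
      (marginal G J f (⋃ k, hbox (a k) (b k))) ∧
    ∀ k {ι : Type} [Fintype ι] t (e : ι → T) (v : ι → H),
      0 ≤ schurQ (fun t => boxI f (a k) (b k) G (J t)) t e v := by
  have hC2 : ∀ k, ContDiff ℝ 2 (boxI f (a k) (b k) G) := fun k => contDiff_two_boxI f _ _ hG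
  have hQ : ∀ k {ι : Type} [Fintype ι] t (e : ι → T) (v : ι → H),
      0 ≤ schurQ (fun t => boxI f (a k) (b k) G (J t)) t e v := by
    intro k ι _ t e v
    rw [schurQ_comp (hC2 k)]
    simpa using integral_le_schurQ_boxI (hab k) hG hpos (J t) (fun j => J (e j)) v (fun _ => 0)
      continuous_const fun y u => hq _ _ _
  have hmono : Monotone fun k => hbox (a k) (b k) := fun k l hkl => hbox_mono (ha hkl) (hb hkl)
  refine ⟨⟨fun k => (hC2 k).comp J.contDiff, fun k t => PosDefOp.boxI (hab k) hG.continuous hpos _,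
    fun k => ?_, fun t u k l hkl => ?_, fun t => ?_⟩, hQ⟩
  · intro x e z
    simpa [schurQ, secondVar, firstVar] using hQ k x (fun _ : Unit => e) fun _ => z
  · simp only [boxI]
    rw [inner_integral_apply (hint t).integrableOn, inner_integral_apply (hint t).integrableOn]
    refine setIntegral_mono_set ?_ (ae_of_all _ fun y => (hpos _).nonneg u)
      (hmono hkl).eventuallyLE
    exact (((hint t).apply_continuousLinearMap u).inner_const u).integrableOn
  · exact tendsto_setIntegral_of_monotone (fun k => measurableSet_hbox _ _) hmono
      (hint t).integrableOn

end BoxApprox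

section SchurIntegral
set_option maxSynthPendingDepth 3
open scoped InnerProductSpace Topology Interval
open Filter

variable {H X : Type*} [NormedAddCommGroup H] [InnerProductSpace ℝ H] [FiniteDimensional ℝ H]
  [CompleteSpace H] [MeasurableSpace X] {μ : Measure X} {Φ : X → H →L[ℝ] H} {w : X → H}

theorem integrable_two_inner_sub (hΦ : Integrable Φ μ) (hw : Integrable w μ) (c : H) :
    Integrable (fun y => 2 * ⟪w y, c⟫_ℝ - ⟪Φ y c, c⟫_ℝ) μ :=
  ((hw.inner_const c).const_mul 2).sub ((hΦ.apply_continuousLinearMap c).inner_const c)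

theorem integral_two_inner_sub (hΦ : Integrable Φ μ) (hw : Integrable w μ) (c : H) :
    ∫ y, (2 * ⟪w y, c⟫_ℝ - ⟪Φ y c, c⟫_ℝ) ∂μ
      = 2 * ⟪∫ y, w y ∂μ, c⟫_ℝ - ⟪(∫ y, Φ y ∂μ) c, c⟫_ℝ := by
  rw [integral_sub ((hw.inner_const c).const_mul 2)
    ((hΦ.apply_continuousLinearMap c).inner_const c), integral_const_mul, inner_integral_apply hΦ,
    real_inner_comm, ← integral_inner hw]
  simp only [real_inner_comm]

theorem PosDefOp.two_inner_sub_eq {L : H →L[ℝ] H} (hL : PosDefOp L) (W : H) :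
    2 * ⟪W, Ring.inverse L W⟫_ℝ - ⟪L (Ring.inverse L W), Ring.inverse L W⟫_ℝ
      = ⟪Ring.inverse L W, W⟫_ℝ := by
  rw [hL.apply_inverse, real_inner_comm]
  ring

/-- Joint convexity of `(L, w) ↦ ⟪L⁻¹ w, w⟫`, in integral form. -/
theorem inner_inverse_integral_le (hΦ : Integrable Φ μ) (hpos : ∀ y, PosDefOp (Φ y))
    (hL : PosDefOp (∫ y, Φ y ∂μ)) (hw : Integrable w μ)
    (hP : Integrable (fun y => ⟪Ring.inverse (Φ y) (w y), w y⟫_ℝ) μ) :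
    ⟪Ring.inverse (∫ y, Φ y ∂μ) (∫ y, w y ∂μ), ∫ y, w y ∂μ⟫_ℝ
      ≤ ∫ y, ⟪Ring.inverse (Φ y) (w y), w y⟫_ℝ ∂μ := by
  rw [← hL.two_inner_sub_eq, ← integral_two_inner_sub hΦ hw]
  exact integral_mono (integrable_two_inner_sub hΦ hw _) hP fun y => (hpos y).two_inner_sub_le _ _

theorem integrable_of_inner_inverse (hΦ : Integrable Φ μ) (hpos : ∀ y, PosDefOp (Φ y))
    (hw : AEStronglyMeasurable w μ)
    (hP : Integrable (fun y => ⟪Ring.inverse (Φ y) (w y), w y⟫_ℝ) μ) : Integrable w μ := by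
  have h1 : ∀ c, Integrable (fun y => ⟪c, w y⟫_ℝ) μ := fun c => by
    refine (hP.add ((hΦ.apply_continuousLinearMap c).inner_const c)).mono'
      (aestronglyMeasurable_const.inner hw) (ae_of_all _ fun y => ?_)
    have e1 := (hpos y).two_inner_sub_le (w y) c
    have e2 := (hpos y).two_inner_sub_le (w y) (-c)
    have e3 := (hpos y).nonneg c
    have e4 := (hpos y).inverse.nonneg (w y)
    simp only [map_neg, inner_neg_left, inner_neg_right, neg_neg] at e2
    rw [real_inner_comm, Real.norm_eq_abs, abs_le, Pi.add_apply]
    constructor <;> linarith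
  have h2 := integrable_finsetSum Finset.univ fun i _ =>
    (h1 (stdOrthonormalBasis ℝ H i)).smul_const (stdOrthonormalBasis ℝ H i)
  refine h2.congr (ae_of_all _ fun y => ?_)
  exact (stdOrthonormalBasis ℝ H).sum_repr' (w y)

/-- The variance identity. -/
theorem integral_variance (hΦ : Integrable Φ μ) (hpos : ∀ y, PosDefOp (Φ y))
    (hL : PosDefOp (∫ y, Φ y ∂μ)) (hw : Integrable w μ)
    (hP : Integrable (fun y => ⟪Ring.inverse (Φ y) (w y), w y⟫_ℝ) μ) :
    ∫ y, ⟪Φ y (Ring.inverse (Φ y) (w y) - Ring.inverse (∫ y, Φ y ∂μ) (∫ y, w y ∂μ)),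
        Ring.inverse (Φ y) (w y) - Ring.inverse (∫ y, Φ y ∂μ) (∫ y, w y ∂μ)⟫_ℝ ∂μ
      = (∫ y, ⟪Ring.inverse (Φ y) (w y), w y⟫_ℝ ∂μ)
        - ⟪Ring.inverse (∫ y, Φ y ∂μ) (∫ y, w y ∂μ), ∫ y, w y ∂μ⟫_ℝ := by
  rw [← hL.two_inner_sub_eq, ← integral_two_inner_sub hΦ hw, ← integral_sub hP
    (integrable_two_inner_sub hΦ hw _)]
  refine integral_congr_ae (ae_of_all _ fun y => ?_)
  generalize Ring.inverse (∫ y, Φ y ∂μ) (∫ y, w y ∂μ) = c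
  have h1 := (hpos y).symm (Ring.inverse (Φ y) (w y)) c
  have h2 := real_inner_comm (w y) (Ring.inverse (Φ y) (w y))
  simp only [map_sub, inner_sub_left, inner_sub_right, (hpos y).apply_inverse] at h1 ⊢
  linarith

end SchurIntegral

section Cells

/-- Lower corner in one coordinate of the truncated cells. -/
def cellLo (m : ℝ) (k : ℕ) : Fin 3 → ℝ := ![-(m + k + 1), -m, m]

/-- Upper corner in one coordinate of the truncated cells. -/
def cellHi (m : ℝ) (k : ℕ) : Fin 3 → ℝ := ![-m, m, m + k + 1]

variable {m : ℝ}

theorem cellLo_lt_cellHi (hm : 0 < m) (k : ℕ) (s : Fin 3) : cellLo m k s < cellHi m k s := by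
  have : (0 : ℝ) ≤ k := k.cast_nonneg
  fin_cases s <;> simp [cellLo, cellHi] <;> linarith

theorem antitone_cellLo (m : ℝ) (s : Fin 3) : Antitone fun k => cellLo m k s := by
  intro k l h
  have : (k : ℝ) ≤ l := by exact_mod_cast h
  fin_cases s <;> simp [cellLo, this]

theorem monotone_cellHi (m : ℝ) (s : Fin 3) : Monotone fun k => cellHi m k s := by
  intro k l h
  have : (k : ℝ) ≤ l := by exact_mod_cast h
  fin_cases s <;> simp [cellHi, this]

theorem cell_unique (hm : 0 < m) {r : ℝ} {s s' : Fin 3} {k k' : ℕ}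
    (h : r ∈ Set.Ioc (cellLo m k s) (cellHi m k s))
    (h' : r ∈ Set.Ioc (cellLo m k' s') (cellHi m k' s')) : s = s' := by
  obtain ⟨h1, h2⟩ := h
  obtain ⟨h3, h4⟩ := h'
  fin_cases s <;> fin_cases s' <;> simp [cellLo, cellHi] at * <;> linarith

theorem exists_cell (m : ℝ) {r : ℝ} {k : ℕ} (hm : 0 < m) (h : |r| < k) :
    ∃ s, r ∈ Set.Ioc (cellLo m k s) (cellHi m k s) := by
  rw [abs_lt] at h
  rcases le_or_gt r (-m) with h1 | h1
  · exact ⟨0, by simp [cellLo, cellHi]; constructor <;> linarith⟩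
  rcases le_or_gt r m with h2 | h2
  · exact ⟨1, by simp [cellLo, cellHi]; constructor <;> linarith⟩
  · exact ⟨2, by simp [cellLo, cellHi]; constructor <;> linarith⟩

variable {n : ℕ}

/-- The cells of the partition of `ℝⁿ` generated by the hyperplanes `yᵢ = ±m`. -/
def cell (m : ℝ) (σ : Fin n → Fin 3) : Set (Fin n → ℝ) :=
  ⋃ k : ℕ, hbox (fun i => cellLo m k (σ i)) fun i => cellHi m k (σ i)

theorem cell_one (m : ℝ) : cell m (fun _ : Fin n => 1) = hbox (fun _ => -m) fun _ => m := by
  simp [cell, cellLo, cellHi, Set.iUnion_const]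

theorem measurableSet_cell (m : ℝ) (σ : Fin n → Fin 3) : MeasurableSet (cell m σ) :=
  MeasurableSet.iUnion fun _ => measurableSet_hbox _ _

theorem pairwise_disjoint_cell (hm : 0 < m) :
    Pairwise (Function.onFun Disjoint (cell m : (Fin n → Fin 3) → Set (Fin n → ℝ))) := by
  intro σ τ hne
  refine Set.disjoint_left.2 fun y h1 h2 => hne (funext fun i => ?_)
  obtain ⟨k, hk⟩ := Set.mem_iUnion.1 h1
  obtain ⟨l, hl⟩ := Set.mem_iUnion.1 h2
  exact cell_unique hm (hk i trivial) (hl i trivial)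

theorem iUnion_cell (hm : 0 < m) : ⋃ σ : Fin n → Fin 3, cell m σ = Set.univ := by
  refine Set.eq_univ_of_forall fun y => ?_
  obtain ⟨k, hk⟩ := exists_nat_gt ‖y‖
  choose σ hσ using fun i => exists_cell m hm ((norm_le_pi_norm y i).trans_lt hk)
  exact Set.mem_iUnion.2 ⟨σ, Set.mem_iUnion.2 ⟨k, fun i _ => hσ i⟩⟩

theorem iUnion_hbox_eq_univ :
    ⋃ k : ℕ, hbox (fun _ : Fin n => -((k : ℝ) + 1)) (fun _ => (k : ℝ) + 1) = Set.univ := by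
  refine Set.eq_univ_of_forall fun y => ?_
  obtain ⟨k, hk⟩ := exists_nat_gt ‖y‖
  refine Set.mem_iUnion.2 ⟨k, fun i _ => ?_⟩
  have := abs_lt.1 ((norm_le_pi_norm y i).trans_lt hk)
  constructor <;> linarith

/-- The integral over `ℝⁿ` minus the central cell. -/
theorem sum_integral_cell {V : Type*} [NormedAddCommGroup V] [NormedSpace ℝ V]
    {Ψ : (Fin n → ℝ) → V} (hm : 0 < m) (h : Integrable Ψ) :
    ∑ σ : {σ : Fin n → Fin 3 // σ ≠ fun _ => 1}, ∫ y in cell m σ.1, Ψ y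
      = (∫ y, Ψ y) - ∫ y in hbox (fun _ => -m) (fun _ => m), Ψ y := by
  rw [← setIntegral_univ, ← iUnion_cell hm, integral_iUnion_fintype (measurableSet_cell m)
    (pairwise_disjoint_cell hm) fun _ => h.integrableOn, ← cell_one,
    Fintype.sum_eq_add_sum_subtype_ne _ fun _ => 1, add_sub_cancel_left]

end Cells

section AbstractPrekopa
set_option maxSynthPendingDepth 3
open scoped InnerProductSpace Topology Interval
open Filter

variable {E T H : Type*} [NormedAddCommGroup E] [NormedSpace ℝ E] [FiniteDimensional ℝ E]
  [NormedAddCommGroup T] [NormedSpace ℝ T] [FiniteDimensional ℝ T]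
  [MeasurableSpace T] [BorelSpace T]
  [NormedAddCommGroup H] [InnerProductSpace ℝ H] [FiniteDimensional ℝ H] [CompleteSpace H]
  {n : ℕ} {G : E → H →L[ℝ] H} {J : T →L[ℝ] E} {f : Fin n → E} {α : T → H →L[ℝ] H}

/-- The centred cube of half-width `k + 1`. -/
def cube (n k : ℕ) : Set (Fin n → ℝ) := hbox (fun _ => -((k : ℝ) + 1)) fun _ => (k : ℝ) + 1

theorem cube_mono (n : ℕ) : Monotone (cube n) := fun k l h => by
  have : (k : ℝ) ≤ l := by exact_mod_cast h
  exact hbox_mono (fun _ => by linarith) fun _ => by linarith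

theorem tendsto_integral_cube {V : Type*} [NormedAddCommGroup V] [NormedSpace ℝ V]
    {Ψ : (Fin n → ℝ) → V} (h : Integrable Ψ) :
    Tendsto (fun k => ∫ y in cube n k, Ψ y) atTop (𝓝 (∫ y, Ψ y)) := by
  have := tendsto_setIntegral_of_monotone (s := cube n) (fun k => measurableSet_hbox _ _)
    (cube_mono n) h.integrableOn
  rwa [show ⋃ k, cube n k = Set.univ from iUnion_hbox_eq_univ, setIntegral_univ] at this

theorem aecover_cube (n : ℕ) : AECover (volume : Measure (Fin n → ℝ)) atTop (cube n) where
  ae_eventually_mem := ae_of_all _ fun y => by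
    have hy : y ∈ ⋃ k, cube n k := by
      rw [show ⋃ k, cube n k = Set.univ from iUnion_hbox_eq_univ]; trivial
    obtain ⟨k, hk⟩ := Set.mem_iUnion.1 hy
    exact (eventually_ge_atTop k).mono fun l hl => cube_mono n hl hk
  measurableSet k := measurableSet_hbox _ _

/-- First-order data of the marginal, obtained along the exhaustion by cubes. -/
theorem marginal_estimate (hG : ContDiff ℝ 2 G) (hpos : ∀ x, PosDefOp (G x))
    (hq : ∀ {ι : Type} [Fintype ι] x (e : ι → E) (v : ι → H), 0 ≤ schurQ G x e v)
    (hint : ∀ t, Integrable fun y : Fin n → ℝ => G (J t + ∑ i, y i • f i))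
    (hα : ContDiff ℝ 2 α) (hαG : ∀ t, α t = ∫ y : Fin n → ℝ, G (J t + ∑ i, y i • f i))
    {ι : Type} [Fintype ι] (t : T) (e : ι → T) (v : ι → H) :
    PosDefOp (α t) ∧
    Tendsto (fun k => ∫ y in cube n k, G (J t + ∑ i, y i • f i)) atTop (𝓝 (α t)) ∧
    Tendsto (fun k => ∫ y in cube n k, firstVar G (J t + ∑ i, y i • f i) (fun j => J (e j)) v)
      atTop (𝓝 (firstVar α t e v)) ∧ 0 ≤ schurQ α t e v := by
  obtain ⟨hM, hQ⟩ := monoApprox_boxI hG hpos hq J hint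
    (a := fun k _ => -((k : ℝ) + 1)) (b := fun k _ => (k : ℝ) + 1)
    (fun k i => by have : (0 : ℝ) ≤ k := k.cast_nonneg
                   linarith)
    (fun k l h _ => by have : (k : ℝ) ≤ l := by exact_mod_cast h
                       simp only
                       linarith)
    (fun k l h _ => by have : (k : ℝ) ≤ l := by exact_mod_cast h
                       simp only
                       linarith)
  have hL : ∀ t, marginal G J f (⋃ k : ℕ, hbox (fun _ => -((k : ℝ) + 1)) fun _ => (k : ℝ) + 1) t
      = α t := fun t => by rw [marginal, iUnion_hbox_eq_univ, setIntegral_univ, hαG]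
  obtain ⟨w, hw, hsum, hle⟩ := MonoApprox.secondVar_le (I := Unit) (fun _ => hM) hα
    (fun x => by simpa using hL x) (fun _ k x e v => hQ k x e v) t e v
  simp only [Finset.univ_unique, PUnit.default_eq_unit, Finset.sum_singleton, hL] at hsum hle
  have hpost := hM.pos_lim t
  have hlim := hM.lim t
  rw [hL] at hpost hlim
  refine ⟨hpost, hlim, ?_, ?_⟩
  · rw [← hsum]
    refine (hw ()).congr fun k => ?_
    rw [firstVar_comp ((contDiff_two_boxI f _ _ hG).differentiable (by norm_num)),
      firstVar_boxI _ _ _ (hG.of_le (by norm_num))]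
    rfl
  · rw [schurQ, ← hsum]
    linarith

/-- Removing a central cube, the second variation of the remaining marginal is controlled by the
fibrewise Schur term. -/
theorem secondVar_sub_cube_le (hG : ContDiff ℝ 2 G) (hpos : ∀ x, PosDefOp (G x))
    (hq : ∀ {ι : Type} [Fintype ι] x (e : ι → E) (v : ι → H), 0 ≤ schurQ G x e v)
    (hint : ∀ t, Integrable fun y : Fin n → ℝ => G (J t + ∑ i, y i • f i))
    (hα : ContDiff ℝ 2 α) (hαG : ∀ t, α t = ∫ y : Fin n → ℝ, G (J t + ∑ i, y i • f i))
    {ι : Type} [Fintype ι] (t : T) (e : ι → T) (v : ι → H)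
    {w : (Fin n → ℝ) → H}
    (hwdef : ∀ y, w y = firstVar G (J t + ∑ i, y i • f i) (fun j => J (e j)) v)
    (hw : Integrable w)
    (hP : Integrable fun y => ⟪Ring.inverse (G (J t + ∑ i, y i • f i)) (w y), w y⟫_ℝ) (m : ℕ) :
    secondVar α t e v
        - ∫ y in cube n m, secondVar G (J t + ∑ i, y i • f i) (fun j => J (e j)) v
      ≤ (∫ y, ⟪Ring.inverse (G (J t + ∑ i, y i • f i)) (w y), w y⟫_ℝ)
        - ∫ y in cube n m, ⟪Ring.inverse (G (J t + ∑ i, y i • f i)) (w y), w y⟫_ℝ := by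
  have hm : (0 : ℝ) < m + 1 := by positivity
  have hM := fun σ : {σ : Fin n → Fin 3 // σ ≠ fun _ => 1} => monoApprox_boxI hG hpos hq J hint
    (a := fun k i => cellLo (m + 1) k (σ.1 i)) (b := fun k i => cellHi (m + 1) k (σ.1 i))
    (fun k i => cellLo_lt_cellHi hm k _)
    (fun k l h i => antitone_cellLo _ _ h) (fun k l h i => monotone_cellHi _ _ h)
  have hbx : ContDiff ℝ 2 fun t =>
      boxI f (fun _ => -((m : ℝ) + 1)) (fun _ => (m : ℝ) + 1) G (J t) :=
    (contDiff_two_boxI f _ _ hG).comp J.contDiff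
  obtain ⟨W, hW, -, hle⟩ := MonoApprox.secondVar_le (fun σ => (hM σ).1) (hα.sub hbx)
    (fun x => by
      simp only [hαG]
      exact sum_integral_cell hm (hint x)) (fun σ k x e v => (hM σ).2 k x e v) t e v
  rw [secondVar_sub hα hbx, secondVar_comp (contDiff_two_boxI f _ _ hG),
    secondVar_boxI _ _ _ hG] at hle
  refine hle.trans ?_
  rw [cube, ← sum_integral_cell hm hP]
  refine Finset.sum_le_sum fun σ _ => ?_
  have hWσ : W σ = ∫ y in cell (m + 1) σ.1, w y := by
    refine tendsto_nhds_unique (hW σ) ?_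
    have hmono : Monotone fun k : ℕ =>
        hbox (fun i => cellLo (m + 1) k (σ.1 i)) fun i => cellHi (m + 1) k (σ.1 i) :=
      fun k l h => hbox_mono (fun i => antitone_cellLo _ _ h) fun i => monotone_cellHi _ _ h
    refine (tendsto_setIntegral_of_monotone (fun k => measurableSet_hbox _ _) hmono
      hw.integrableOn).congr fun k => ?_
    rw [firstVar_comp ((contDiff_two_boxI f _ _ hG).differentiable (by norm_num)),
      firstVar_boxI _ _ _ (hG.of_le (by norm_num))]
    simp only [hwdef]
  rw [hWσ]
  exact inner_inverse_integral_le (hint t).integrableOn (fun y => hpos _) ((hM σ).1.pos_lim t)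
    hw.integrableOn hP.integrableOn

/-- Local Prékopa inequality for operator-valued functions. -/
theorem integral_sub_variance_le_schurQ (hG : ContDiff ℝ 2 G) (hpos : ∀ x, PosDefOp (G x))
    (hq : ∀ {ι : Type} [Fintype ι] x (e : ι → E) (v : ι → H), 0 ≤ schurQ G x e v)
    (hint : ∀ t, Integrable fun y : Fin n → ℝ => G (J t + ∑ i, y i • f i))
    (hα : ContDiff ℝ 2 α) (hαG : ∀ t, α t = ∫ y : Fin n → ℝ, G (J t + ∑ i, y i • f i))
    {ι : Type} [Fintype ι] (t : T) (e : ι → T) (v : ι → H)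
    {w : (Fin n → ℝ) → H}
    (hwdef : ∀ y, w y = firstVar G (J t + ∑ i, y i • f i) (fun j => J (e j)) v)
    {B : (Fin n → ℝ) → ℝ} (hB : Continuous B) (hB0 : ∀ y, 0 ≤ B y)
    (hB1 : ∀ y u, schurQ G (J t + ∑ i, y i • f i) (fun j => J (e j)) v - B y
      ≤ schurQ G (J t + ∑ i, y i • f i) (Sum.elim (fun j => J (e j)) f) (Sum.elim v u))
    (hB2 : ∀ y, B y ≤ schurQ G (J t + ∑ i, y i • f i) (fun j => J (e j)) v) :
    (∫ y, B y) - ∫ y, ⟪G (J t + ∑ i, y i • f i)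
        (Ring.inverse (G (J t + ∑ i, y i • f i)) (w y) - Ring.inverse (α t) (∫ z, w z)),
        Ring.inverse (G (J t + ∑ i, y i • f i)) (w y) - Ring.inverse (α t) (∫ z, w z)⟫_ℝ
      ≤ schurQ α t e v := by
  obtain ⟨hpost, hlim, hβ, h0⟩ := marginal_estimate hG hpos hq hint hα hαG t e v
  by_cases hBi : Integrable B
  swap
  · rw [integral_undef hBi]
    rw [zero_sub]
    exact (neg_nonpos.2 (integral_nonneg fun y => (hpos _).nonneg _)).trans h0
  have hwc : Continuous w := by
    have := continuous_firstVar (hG.of_le (by norm_num)) (fun j => J (e j)) v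
    rw [show w = _ from funext hwdef]
    exact this.comp (by fun_prop)
  have hS : Continuous fun y : Fin n → ℝ =>
      secondVar G (J t + ∑ i, y i • f i) (fun j => J (e j)) v := by
    have := continuous_secondVar hG (fun j => J (e j)) v
    exact this.comp (by fun_prop)
  have hGc : Continuous fun y : Fin n → ℝ => G (J t + ∑ i, y i • f i) :=
    hG.continuous.comp (by fun_prop)
  have hPc : Continuous fun y => ⟪Ring.inverse (G (J t + ∑ i, y i • f i)) (w y), w y⟫_ℝ :=
    ((continuous_inverse_comp hGc fun y => hpos _).clm_apply hwc).inner hwc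
  have hP0 : ∀ y, 0 ≤ ⟪Ring.inverse (G (J t + ∑ i, y i • f i)) (w y), w y⟫_ℝ := fun y =>
    (hpos _).inverse.nonneg _
  have hbound : ∀ k, ∫ y in cube n k, ⟪Ring.inverse (G (J t + ∑ i, y i • f i)) (w y), w y⟫_ℝ
      ≤ (∫ y, B y) + ⟪Ring.inverse (∫ y in cube n k, G (J t + ∑ i, y i • f i))
          (∫ y in cube n k, w y), ∫ y in cube n k, w y⟫_ℝ := by
    intro k
    have h1 := integral_le_schurQ_boxI (a := fun _ : Fin n => -((k : ℝ) + 1))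
      (b := fun _ => (k : ℝ) + 1) (fun _ => by have : (0 : ℝ) ≤ k := k.cast_nonneg
                                               linarith)
      hG hpos (J t) (fun j => J (e j)) v
      (fun y => -secondVar G (J t + ∑ i, y i • f i) (fun j => J (e j)) v
        + ⟪Ring.inverse (G (J t + ∑ i, y i • f i)) (w y), w y⟫_ℝ - B y) (by fun_prop)
      (fun y u => by rw [hwdef]; exact hB1 y u)
    have i1 : IntegrableOn (fun y : Fin n → ℝ =>
        -secondVar G (J t + ∑ i, y i • f i) (fun j => J (e j)) v) (cube n k) :=
      hS.neg.integrableOn_hbox _ _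
    have i2 : IntegrableOn (fun y => ⟪Ring.inverse (G (J t + ∑ i, y i • f i)) (w y), w y⟫_ℝ)
        (cube n k) := hPc.integrableOn_hbox _ _
    have i3 : IntegrableOn (fun y => -secondVar G (J t + ∑ i, y i • f i) (fun j => J (e j)) v
        + ⟪Ring.inverse (G (J t + ∑ i, y i • f i)) (w y), w y⟫_ℝ) (cube n k) := i1.add i2
    rw [schurQ, secondVar_boxI _ _ _ hG, firstVar_boxI _ _ _ (hG.of_le (by norm_num)),
      show hbox (fun _ => -((k : ℝ) + 1)) (fun _ => (k : ℝ) + 1) = cube n k from rfl,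
      integral_sub i3 hBi.integrableOn, integral_add i1 i2, integral_neg] at h1
    simp only [← hwdef] at h1
    have h2 : ∫ y in cube n k, B y ≤ ∫ y, B y :=
      setIntegral_le_integral hBi (ae_of_all _ hB0)
    have h3 : boxI f (fun _ => -((k : ℝ) + 1)) (fun _ => (k : ℝ) + 1) G (J t)
      = ∫ y in cube n k, G (J t + ∑ i, y i • f i) := rfl
    rw [h3] at h1
    linarith
  simp only [← hwdef] at hβ
  have hlim2 : Tendsto (fun k => (∫ y, B y) + ⟪Ring.inverse (∫ y in cube n k,
      G (J t + ∑ i, y i • f i)) (∫ y in cube n k, w y), ∫ y in cube n k, w y⟫_ℝ) atTop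
      (𝓝 ((∫ y, B y) + ⟪Ring.inverse (α t) (firstVar α t e v), firstVar α t e v⟫_ℝ)) := by
    have h1 := hpost.continuousAt_inverse.tendsto.comp hlim
    have h2 := (isBoundedBilinearMap_apply (𝕜 := ℝ) (E := H) (F := H)).continuous.tendsto
      (Ring.inverse (α t), firstVar α t e v)
    have h3 := h2.comp (h1.prodMk_nhds hβ)
    exact (h3.inner hβ).const_add _
  have hP : Integrable fun y => ⟪Ring.inverse (G (J t + ∑ i, y i • f i)) (w y), w y⟫_ℝ := by
    obtain ⟨C, hC⟩ := hlim2.bddAbove_range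
    exact (aecover_cube n).integrable_of_integral_bounded_of_nonneg_ae C
      (fun k => hPc.integrableOn_hbox _ _) (ae_of_all _ hP0)
      (Eventually.of_forall fun k => (hbound k).trans (hC ⟨k, rfl⟩))
  have hw : Integrable w := integrable_of_inner_inverse (hint t) (fun y => hpos _)
    hwc.aestronglyMeasurable hP
  have hβw : firstVar α t e v = ∫ y, w y := tendsto_nhds_unique hβ (tendsto_integral_cube hw)
  have hvar := integral_variance (hint t) (fun y => hpos _) (hαG t ▸ hpost) hw hP
  rw [← hαG t] at hvar
  rw [hvar, schurQ, hβw]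
  suffices h : ∀ m, secondVar α t e v
      ≤ (∫ y, ⟪Ring.inverse (G (J t + ∑ i, y i • f i)) (w y), w y⟫_ℝ) - ∫ y in cube n m, B y by
    have := ge_of_tendsto' (tendsto_const_nhds.sub (tendsto_integral_cube hBi)) h
    linarith
  intro m
  have h1 := secondVar_sub_cube_le hG hpos hq hint hα hαG t e v hwdef hw hP m
  have h2 : ∫ y in cube n m, B y
      ≤ ∫ y in cube n m, (⟪Ring.inverse (G (J t + ∑ i, y i • f i)) (w y), w y⟫_ℝ
        - secondVar G (J t + ∑ i, y i • f i) (fun j => J (e j)) v) := by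
    refine integral_mono hBi.integrableOn ((hPc.sub hS).integrableOn_hbox _ _) fun y => ?_
    have := hB2 y
    rw [schurQ, ← hwdef] at this
    simp only
    linarith
  have i1 : IntegrableOn (fun y => ⟪Ring.inverse (G (J t + ∑ i, y i • f i)) (w y), w y⟫_ℝ)
      (cube n m) := hPc.integrableOn_hbox _ _
  have i2 : IntegrableOn (fun y : Fin n → ℝ =>
      secondVar G (J t + ∑ i, y i • f i) (fun j => J (e j)) v) (cube n m) :=
    hS.integrableOn_hbox _ _
  rw [integral_sub i1 i2] at h2
  linarith

end AbstractPrekopa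

section MatrixOperator
set_option maxSynthPendingDepth 3
open scoped InnerProductSpace Topology
open Filter

variable {n d : ℕ}

/-- The operator on Euclidean space with matrix `M`. -/
def opM (M : Matrix (Fin d) (Fin d) ℝ) :
    EuclideanSpace ℝ (Fin d) →L[ℝ] EuclideanSpace ℝ (Fin d) :=
  Matrix.toEuclideanCLM (n := Fin d) (𝕜 := ℝ) M

theorem opM_toLp (M : Matrix (Fin d) (Fin d) ℝ) (u : Fin d → ℝ) :
    opM M (WithLp.toLp 2 u) = WithLp.toLp 2 (M *ᵥ u) := rfl

theorem inner_toLp (u v : Fin d → ℝ) : ⟪WithLp.toLp 2 u, WithLp.toLp 2 v⟫_ℝ = u ⬝ᵥ v := by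
  rw [EuclideanSpace.inner_toLp_toLp, star_trivial, dotProduct_comm]

theorem opM_eq_sum (M : Matrix (Fin d) (Fin d) ℝ) :
    opM M = ∑ i, ∑ j, M i j • opM (Matrix.single i j 1) := by
  conv_lhs => rw [Matrix.matrix_eq_sum_single M]
  simp only [opM, map_sum]
  refine Finset.sum_congr rfl fun i _ => Finset.sum_congr rfl fun j _ => ?_
  rw [← map_smul, Matrix.smul_single, smul_eq_mul, mul_one]

theorem opM_mul (M N : Matrix (Fin d) (Fin d) ℝ) : opM (M * N) = opM M * opM N :=
  map_mul _ M N

theorem posDefOp_opM {M : Matrix (Fin d) (Fin d) ℝ} (hM : M.PosDef) : PosDefOp (opM M) := by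
  have hs : ∀ u v : EuclideanSpace ℝ (Fin d), ⟪opM M u, v⟫_ℝ = ⟪opM M v, u⟫_ℝ := by
    intro u v
    obtain ⟨u, rfl⟩ := (WithLp.equiv 2 _).symm.surjective u
    obtain ⟨v, rfl⟩ := (WithLp.equiv 2 _).symm.surjective v
    simp only [WithLp.equiv_symm_apply, opM_toLp, inner_toLp]
    have h : Mᵀ = M := by simpa using hM.isHermitian.eq
    rw [dotProduct_comm, dotProduct_mulVec, ← mulVec_transpose, h]
  refine ⟨hs, fun u hu => ?_⟩
  have := hM.dotProduct_mulVec_pos (x := WithLp.ofLp u) (by simpa using hu)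
  rw [real_inner_comm, opM, Matrix.inner_toEuclideanCLM]
  simpa using this

theorem inverse_opM {M : Matrix (Fin d) (Fin d) ℝ} (hM : M.PosDef) :
    Ring.inverse (opM M) = opM M⁻¹ := by
  have h : opM M * opM M⁻¹ = 1 := by
    rw [← opM_mul, Matrix.mul_nonsing_inv _ ((Matrix.isUnit_iff_isUnit_det _).1 hM.isUnit)]
    exact map_one _
  calc Ring.inverse (opM M) = Ring.inverse (opM M) * (opM M * opM M⁻¹) := by rw [h, mul_one]
    _ = opM M⁻¹ := by
      rw [← mul_assoc, Ring.inverse_mul_cancel _ (posDefOp_opM hM).isUnit, one_mul]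

variable {g : (Fin n → ℝ) → Matrix (Fin d) (Fin d) ℝ}

theorem contDiff_opM {k : ℕ} (hg : MatCD k g) : ContDiff ℝ k fun x => opM (g x) := by
  rw [show (fun x => opM (g x)) = _ from funext fun x => opM_eq_sum (g x)]
  exact ContDiff.sum fun i _ => ContDiff.sum fun j _ => (hg i j).smul contDiff_const

theorem fderiv_opM (hg : MatCD 1 g) (j : Fin n) (x : Fin n → ℝ) :
    fderiv ℝ (fun x => opM (g x)) x (Pi.single j 1) = opM (mpd j g x) := by
  have h : HasFDerivAt (fun x => ∑ i, ∑ l, g x i l • opM (Matrix.single i l 1)) _ x :=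
    HasFDerivAt.fun_sum fun i _ => HasFDerivAt.fun_sum fun l _ =>
      (((hg i l).differentiable (by norm_num)) x).hasFDerivAt.smul_const _
  rw [show (fun x => opM (g x)) = _ from funext fun x => opM_eq_sum (g x), h.fderiv,
    opM_eq_sum (mpd j g x)]
  simp [_root_.sum_apply, mpd]

theorem MatCD.mpd (hg : MatCD 2 g) (j : Fin n) : MatCD 1 (mpd j g) := fun i l =>
  ((hg i l).fderiv_right (m := 1) (by norm_num)).clm_apply contDiff_const

theorem MatCD.one_of_two (hg : MatCD 2 g) : MatCD 1 g := fun i l =>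
  (hg i l).of_le (by norm_num)

theorem fderiv_fderiv_opM (hg : MatCD 2 g) (j k : Fin n) (x : Fin n → ℝ) :
    fderiv ℝ (fderiv ℝ fun x => opM (g x)) x (Pi.single k 1) (Pi.single j 1)
      = opM (mpd k (_root_.mpd j g) x) := by
  rw [← fderiv_opM (hg.mpd j)]
  have h1 : DifferentiableAt ℝ (fderiv ℝ fun x => opM (g x)) x :=
    ((contDiff_opM hg).fderiv_right (m := 1) (by norm_num)).differentiable (by norm_num) _
  have h2 : (fun x => opM (_root_.mpd j g x))
      = fun x => fderiv ℝ (fun x => opM (g x)) x (Pi.single j 1) :=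
    funext fun x => (fderiv_opM hg.one_of_two j x).symm
  rw [h2, (h1.hasFDerivAt.clm_apply (hasFDerivAt_const _ x)).fderiv]
  simp

theorem integrable_opM {X : Type*} [MeasurableSpace X] {μ : Measure X}
    {Φ : X → Matrix (Fin d) (Fin d) ℝ} (h : ∀ i j, Integrable (fun y => Φ y i j) μ) :
    Integrable (fun y => opM (Φ y)) μ := by
  rw [show (fun y => opM (Φ y)) = _ from funext fun x => opM_eq_sum (Φ x)]
  exact integrable_finsetSum _ fun i _ => integrable_finsetSum _ fun j _ => (h i j).smul_const _

theorem integral_opM {X : Type*} [MeasurableSpace X] {μ : Measure X}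
    {Φ : X → Matrix (Fin d) (Fin d) ℝ} (h : ∀ i j, Integrable (fun y => Φ y i j) μ) :
    ∫ y, opM (Φ y) ∂μ = opM (Matrix.of fun i j => ∫ y, Φ y i j ∂μ) := by
  simp only [opM_eq_sum (Φ _)]
  rw [opM_eq_sum (Matrix.of _), integral_finsetSum _ fun i _ =>
    integrable_finsetSum _ fun j _ => (h i j).smul_const _]
  refine Finset.sum_congr rfl fun i _ => ?_
  rw [integral_finsetSum _ fun j _ => (h i j).smul_const _]
  exact Finset.sum_congr rfl fun j _ => integral_smul_const _ _

end MatrixOperator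

section ThetaForm
set_option maxSynthPendingDepth 3
open scoped InnerProductSpace Topology
open Filter

variable {n d : ℕ} {g : (Fin n → ℝ) → Matrix (Fin d) (Fin d) ℝ}

theorem mul_theta (hgpos : ∀ x, (g x).PosDef) (j k : Fin n) (x : Fin n → ℝ) :
    g x * theta g j k x = mpd k (mpd j g) x - mpd k g x * (g x)⁻¹ * mpd j g x := by
  rw [theta, ← mul_assoc, Matrix.mul_nonsing_inv _
    ((Matrix.isUnit_iff_isUnit_det _).1 (hgpos x).isUnit), one_mul]

theorem transpose_of_posDef (hgpos : ∀ x, (g x).PosDef) (x : Fin n → ℝ) : (g x)ᵀ = g x := by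
  simpa using (hgpos x).isHermitian.eq

theorem mpd_transpose (hs : ∀ x, (g x)ᵀ = g x) (j : Fin n) (x : Fin n → ℝ) :
    (mpd j g x)ᵀ = mpd j g x := by
  ext i k
  simp only [mpd, Matrix.transpose_apply, Matrix.of_apply]
  rw [show (fun y => g y k i) = fun y => g y i k from funext fun y => congrFun₂ (hs y) i k]

theorem mpd_comm (hg : MatCD 2 g) (j k : Fin n) (x : Fin n → ℝ) :
    mpd k (mpd j g) x = mpd j (mpd k g) x := by
  ext i l
  have h1 : Differentiable ℝ (fderiv ℝ fun y => g y i l) :=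
    ((hg i l).fderiv_right (m := 1) (by norm_num)).differentiable (by norm_num)
  have h2 : ∀ a b : Fin n → ℝ, fderiv ℝ (fun y => fderiv ℝ (fun y => g y i l) y a) x b
      = fderiv ℝ (fderiv ℝ fun y => g y i l) x b a := fun a b => by
    rw [((h1 x).hasFDerivAt.clm_apply (hasFDerivAt_const a x)).fderiv]
    simp
  simp only [mpd, Matrix.of_apply, h2]
  exact fderiv_fderiv_symm (hg i l) x _ _

theorem mul_theta_transpose (hg : MatCD 2 g) (hgpos : ∀ x, (g x).PosDef) (j k : Fin n)
    (x : Fin n → ℝ) : (g x * theta g j k x)ᵀ = g x * theta g k j x := by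
  have hs := transpose_of_posDef hgpos
  have hm := mpd_transpose hs
  rw [mul_theta hgpos, mul_theta hgpos, Matrix.transpose_sub, Matrix.transpose_mul,
    Matrix.transpose_mul, mpd_transpose (hm j), hm, hm, Matrix.transpose_nonsing_inv, hs,
    mpd_comm hg, mul_assoc]

variable {ι κ : Type} [Fintype ι] [Fintype κ]

/-- The bilinear form `-⟪Θ^g U, W⟫` between the coordinate blocks `p` and `q`. -/
def thetaForm (g : (Fin n → ℝ) → Matrix (Fin d) (Fin d) ℝ) (x : Fin n → ℝ)
    (p : ι → Fin n) (q : κ → Fin n) (U : ι → Fin d → ℝ) (W : κ → Fin d → ℝ) : ℝ :=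
  -∑ a, ∑ b, (g x * theta g (p a) (q b) x) *ᵥ U a ⬝ᵥ W b

theorem thetaForm_comm (hg : MatCD 2 g) (hgpos : ∀ x, (g x).PosDef) (x : Fin n → ℝ)
    (p : ι → Fin n) (q : κ → Fin n) (U : ι → Fin d → ℝ) (W : κ → Fin d → ℝ) :
    thetaForm g x p q U W = thetaForm g x q p W U := by
  rw [thetaForm, thetaForm, Finset.sum_comm]
  refine congrArg _ (Finset.sum_congr rfl fun b _ => Finset.sum_congr rfl fun a _ => ?_)
  rw [← mul_theta_transpose hg hgpos, mulVec_transpose, ← dotProduct_mulVec, dotProduct_comm]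

theorem thetaForm_sumElim (x : Fin n → ℝ) (p : ι → Fin n) (q : κ → Fin n)
    (U : ι → Fin d → ℝ) (W : κ → Fin d → ℝ) :
    thetaForm g x (Sum.elim p q) (Sum.elim p q) (Sum.elim U W) (Sum.elim U W)
      = thetaForm g x p p U U + thetaForm g x p q U W + thetaForm g x q p W U
        + thetaForm g x q q W W := by
  simp only [thetaForm, Fintype.sum_sum_type, Sum.elim_inl, Sum.elim_inr, Finset.sum_add_distrib]
  ring

theorem thetaForm_sub_sub (x : Fin n → ℝ) (p : ι → Fin n) (q : κ → Fin n)
    (U U' : ι → Fin d → ℝ) (W W' : κ → Fin d → ℝ) :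
    thetaForm g x p q (U - U') (W - W') = thetaForm g x p q U W - thetaForm g x p q U W'
      - thetaForm g x p q U' W + thetaForm g x p q U' W' := by
  simp only [thetaForm, Pi.sub_apply, mulVec_sub, sub_dotProduct, dotProduct_sub,
    Finset.sum_sub_distrib]
  ring

theorem thetaForm_eq_minner {m : ℕ} (x : Fin n → ℝ) (p : ι → Fin n) (q : Fin m → Fin n)
    (U : ι → Fin d → ℝ) (W : Fin m → Fin d → ℝ) :
    thetaForm g x p q U W
      = -minner (g x) (fun b => ∑ a, theta g (p a) (q b) x *ᵥ U a) W := by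
  rw [thetaForm, minner, Finset.sum_comm]
  simp only [← mulVec_mulVec, mulVec_sum, sum_dotProduct]

theorem schurQ_opM (hg : MatCD 2 g) (hgpos : ∀ x, (g x).PosDef) (x : Fin n → ℝ)
    (p : ι → Fin n) (U : ι → Fin d → ℝ) :
    schurQ (fun x => opM (g x)) x (fun a => Pi.single (p a) 1) (fun a => WithLp.toLp 2 (U a))
      = thetaForm g x p p U U := by
  have hs := transpose_of_posDef hgpos
  simp only [schurQ, firstVar, secondVar, fderiv_fderiv_opM hg, fderiv_opM hg.one_of_two,
    inverse_opM (hgpos x), opM_toLp, map_sum, sum_inner, inner_sum, inner_toLp, thetaForm,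
    mul_theta hgpos, sub_mulVec, sub_dotProduct, Finset.sum_sub_distrib, neg_sub]
  rw [neg_add_eq_sub]
  refine congrArg₂ _ ?_ rfl
  rw [Finset.sum_comm]
  refine Finset.sum_congr rfl fun a _ => Finset.sum_congr rfl fun b _ => ?_
  rw [mul_assoc, ← mulVec_mulVec, ← mulVec_mulVec, dotProduct_mulVec, ← mulVec_transpose,
    mpd_transpose hs]

theorem sum_comm_pairs {κ' : Type*} [Fintype κ'] (f : ι → ι → κ' → κ' → ℝ) :
    ∑ a, ∑ b, ∑ j, ∑ k, f a b j k = ∑ j, ∑ k, ∑ a, ∑ b, f a b j k := by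
  refine (Finset.sum_congr rfl fun a _ => (Finset.sum_comm.trans
    (Finset.sum_congr rfl fun j _ => Finset.sum_comm))).trans ?_
  exact Finset.sum_comm.trans (Finset.sum_congr rfl fun j _ => Finset.sum_comm)

theorem schurQ_eq_basis {H : Type*} [NormedAddCommGroup H] [InnerProductSpace ℝ H]
    (G : (Fin n → ℝ) → H →L[ℝ] H) (x : Fin n → ℝ) (e : ι → Fin n → ℝ) (v : ι → H) :
    schurQ G x e v = schurQ G x (fun j => Pi.single j 1) (fun j => ∑ a, e a j • v a) := by
  have he : ∀ a, e a = ∑ j, e a j • Pi.single j (1 : ℝ) := fun a => by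
    ext i
    simp [Finset.sum_apply, Pi.single_apply]
  have h1 : firstVar G x e v
      = firstVar G x (fun j => Pi.single j 1) (fun j => ∑ a, e a j • v a) := by
    simp only [firstVar, map_sum, map_smul]
    rw [Finset.sum_comm]
    refine Finset.sum_congr rfl fun a _ => ?_
    conv_lhs => rw [he a]
    simp only [map_sum, map_smul, _root_.sum_apply, _root_.smul_apply]
  have h2 : secondVar G x e v
      = secondVar G x (fun j => Pi.single j 1) (fun j => ∑ a, e a j • v a) := by
    have h3 : ∀ a b, ⟪fderiv ℝ (fderiv ℝ G) x (e b) (e a) (v a), v b⟫_ℝ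
        = ∑ j, ∑ k, e b k * (e a j
          * ⟪fderiv ℝ (fderiv ℝ G) x (Pi.single k 1) (Pi.single j 1) (v a), v b⟫_ℝ) := by
      intro a b
      conv_lhs => rw [he a, he b]
      simp only [map_sum, map_smul, _root_.sum_apply, _root_.smul_apply, sum_inner,
        inner_smul_left, RCLike.conj_to_real, Finset.mul_sum]
      simp only [mul_left_comm]
    have h4 : ∀ j k, ⟪fderiv ℝ (fderiv ℝ G) x (Pi.single k 1) (Pi.single j 1)
          (∑ a, e a j • v a), ∑ b, e b k • v b⟫_ℝ
        = ∑ a, ∑ b, e b k * (e a j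
          * ⟪fderiv ℝ (fderiv ℝ G) x (Pi.single k 1) (Pi.single j 1) (v a), v b⟫_ℝ) := by
      intro j k
      simp only [map_sum, map_smul, sum_inner, inner_sum, inner_smul_left, inner_smul_right,
        RCLike.conj_to_real, Finset.mul_sum]
      exact Finset.sum_comm
    simp only [secondVar, h3, h4]
    exact sum_comm_pairs _
  rw [schurQ, schurQ, h1, h2]

theorem schurQ_opM_nonneg (hg : MatCD 2 g) (hgpos : ∀ x, (g x).PosDef) (hglc : NLogConcave g)
    (x : Fin n → ℝ) (e : ι → Fin n → ℝ) (v : ι → EuclideanSpace ℝ (Fin d)) :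
    0 ≤ schurQ (fun x => opM (g x)) x e v := by
  rw [schurQ_eq_basis]
  have := schurQ_opM hg hgpos x id fun j => WithLp.ofLp (∑ a, e a j • v a)
  simp only [id, WithLp.toLp_ofLp] at this
  rw [this, thetaForm_eq_minner]
  exact neg_nonneg.2 (hglc x _)

theorem thetaForm_self_nonneg (hg : MatCD 2 g) (hgpos : ∀ x, (g x).PosDef) (hglc : NLogConcave g)
    (x : Fin n → ℝ) (p : ι → Fin n) (U : ι → Fin d → ℝ) : 0 ≤ thetaForm g x p p U U := by
  rw [← schurQ_opM hg hgpos]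
  exact schurQ_opM_nonneg hg hgpos hglc _ _ _

end ThetaForm

section MatrixCalculus
set_option maxSynthPendingDepth 3
open scoped InnerProductSpace Topology
open Filter

variable {n d : ℕ} {g : (Fin n → ℝ) → Matrix (Fin d) (Fin d) ℝ}

theorem MatCD.mul {k : ℕ} {a b : (Fin n → ℝ) → Matrix (Fin d) (Fin d) ℝ} (ha : MatCD k a)
    (hb : MatCD k b) : MatCD k fun x => a x * b x := fun i j => by
  simp only [Matrix.mul_apply]
  exact ContDiff.sum fun l _ => (ha i l).mul (hb l j)

theorem mpd_mul {a b : (Fin n → ℝ) → Matrix (Fin d) (Fin d) ℝ} (ha : MatCD 1 a)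
    (hb : MatCD 1 b) (k : Fin n) (x : Fin n → ℝ) :
    mpd k (fun x => a x * b x) x = mpd k a x * b x + a x * mpd k b x := by
  ext i j
  have h : HasFDerivAt (fun x => ∑ l, a x i l * b x l j) _ x :=
    HasFDerivAt.fun_sum fun l _ => HasFDerivAt.mul
      (((ha i l).differentiable (by norm_num)) x).hasFDerivAt
      (((hb l j).differentiable (by norm_num)) x).hasFDerivAt
  simp only [mpd, Matrix.of_apply, Matrix.add_apply, Matrix.mul_apply]
  rw [h.fderiv, ← Finset.sum_add_distrib]
  simp only [_root_.sum_apply, _root_.add_apply, _root_.smul_apply, smul_eq_mul]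
  exact Finset.sum_congr rfl fun l _ => by ring

theorem MatCD.inv {k : ℕ} (hg : MatCD k g) (hgpos : ∀ x, (g x).PosDef) :
    MatCD k fun x => (g x)⁻¹ := fun i j => by
  have h : (fun x => (g x)⁻¹ i j)
      = fun x => ⟪WithLp.toLp 2 (Pi.single i 1), Ring.inverse (opM (g x))
        (WithLp.toLp 2 (Pi.single j 1))⟫_ℝ := by
    ext x
    rw [inverse_opM (hgpos x), opM_toLp, inner_toLp]
    simp
  rw [h]
  have hinv : ContDiff ℝ k fun x => Ring.inverse (opM (g x)) := by
    rw [contDiff_iff_contDiffAt]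
    intro x
    obtain ⟨u, hu⟩ := (posDefOp_opM (hgpos x)).isUnit
    exact (hu ▸ contDiffAt_ringInverse ℝ u :
      ContDiffAt ℝ k Ring.inverse (opM (g x))).comp x (contDiff_opM hg).contDiffAt
  exact contDiff_const.inner ℝ (hinv.clm_apply contDiff_const)

theorem inv_mul_cancel_of_posDef {M : Matrix (Fin d) (Fin d) ℝ} (hM : M.PosDef) :
    M⁻¹ * M = 1 :=
  Matrix.nonsing_inv_mul _ ((Matrix.isUnit_iff_isUnit_det _).1 hM.isUnit)

theorem mul_inv_cancel_of_posDef {M : Matrix (Fin d) (Fin d) ℝ} (hM : M.PosDef) :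
    M * M⁻¹ = 1 :=
  Matrix.mul_nonsing_inv _ ((Matrix.isUnit_iff_isUnit_det _).1 hM.isUnit)

theorem mpd_inv_mul_mpd (hg : MatCD 2 g) (hgpos : ∀ x, (g x).PosDef) (j k : Fin n)
    (x : Fin n → ℝ) : mpd k (fun x => (g x)⁻¹ * mpd j g x) x = theta g j k x := by
  have h := mpd_mul hg.one_of_two ((hg.one_of_two.inv hgpos).mul (hg.mpd j)) k x
  simp only [← mul_assoc, mul_inv_cancel_of_posDef (hgpos _), one_mul] at h
  rw [theta, h, add_sub_cancel_left, ← mul_assoc, inv_mul_cancel_of_posDef (hgpos x), one_mul]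

theorem continuous_theta (hg : MatCD 2 g) (hgpos : ∀ x, (g x).PosDef) (j k : Fin n) :
    Continuous (theta g j k) := by
  have h := (hg.one_of_two.inv hgpos).mul (hg.mpd j)
  rw [show theta g j k = _ from funext fun x => (mpd_inv_mul_mpd hg hgpos j k x).symm]
  refine continuous_matrix fun i l => ?_
  exact ((h i l).continuous_fderiv (by norm_num)).clm_apply continuous_const

end MatrixCalculus

section Append
variable {n0 n1 d : ℕ}

/-- The inclusion of the first block of variables. -/
def inclLeft (n0 n1 : ℕ) : (Fin n0 → ℝ) →L[ℝ] (Fin (n0 + n1) → ℝ) :=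
  LinearMap.toContinuousLinearMap
    { toFun := fun t => Fin.append t 0
      map_add' := fun s t => by
        ext i
        refine Fin.addCases (fun i => ?_) (fun i => ?_) i <;> simp
      map_smul' := fun c t => by
        ext i
        refine Fin.addCases (fun i => ?_) (fun i => ?_) i <;> simp }

theorem inclLeft_apply (t : Fin n0 → ℝ) : inclLeft n0 n1 t = Fin.append t 0 := rfl

theorem inclLeft_add_sum (t : Fin n0 → ℝ) (y : Fin n1 → ℝ) :
    inclLeft n0 n1 t + ∑ i, y i • Pi.single (Fin.natAdd n0 i) (1 : ℝ) = Fin.append t y := by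
  ext i
  rw [inclLeft_apply]
  refine Fin.addCases (fun i => ?_) (fun i => ?_) i
  · simp [Finset.sum_apply, Pi.single_apply, Fin.ext_iff]
    refine Finset.sum_eq_zero fun j _ => if_neg ?_
    omega
  · simp [Finset.sum_apply, Pi.single_apply]

theorem inclLeft_single (j : Fin n0) :
    inclLeft n0 n1 (Pi.single j 1) = Pi.single (Fin.castAdd n1 j) 1 := by
  ext i
  rw [inclLeft_apply]
  refine Fin.addCases (fun i => ?_) (fun i => ?_) i
  · simp [Pi.single_apply]
  · simp [Pi.single_apply, Fin.ext_iff]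
    omega

theorem fderiv_comp_append {h : (Fin (n0 + n1) → ℝ) → ℝ} (hh : Differentiable ℝ h)
    (t : Fin n0 → ℝ) (y : Fin n1 → ℝ) (k : Fin n1) :
    fderiv ℝ (fun y => h (Fin.append t y)) y (Pi.single k 1)
      = fderiv ℝ h (Fin.append t y) (Pi.single (Fin.natAdd n0 k) 1) := by
  have h1 : HasFDerivAt (fun y : Fin n1 → ℝ => inclLeft n0 n1 t
      + ∑ i, y i • (Pi.single (Fin.natAdd n0 i) (1 : ℝ) : Fin (n0 + n1) → ℝ)) _ y :=
    (HasFDerivAt.fun_sum fun i _ => (ContinuousLinearMap.proj (R := ℝ)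
      (φ := fun _ : Fin n1 => ℝ) i).hasFDerivAt.smul_const _).const_add _
  simp only [inclLeft_add_sum] at h1
  refine (DFunLike.congr_fun ((hh _).hasFDerivAt.comp y h1).fderiv _).trans ?_
  simp [_root_.sum_apply, Pi.single_apply]

theorem continuous_append (t : Fin n0 → ℝ) :
    Continuous fun y : Fin n1 → ℝ => Fin.append t y := by
  simp only [← inclLeft_add_sum]
  fun_prop

theorem pdF_sum_mulVec {Φ : Fin n0 → (Fin (n0 + n1) → ℝ) → Matrix (Fin d) (Fin d) ℝ}
    (hΦ : ∀ j, MatCD 1 (Φ j)) (t : Fin n0 → ℝ) (V : Fin n0 → Fin d → ℝ) (y : Fin n1 → ℝ)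
    (k : Fin n1) :
    pdF k (fun y => ∑ j, Φ j (Fin.append t y) *ᵥ V j) y
      = ∑ j, mpd (Fin.natAdd n0 k) (Φ j) (Fin.append t y) *ᵥ V j := by
  ext i
  have h : HasFDerivAt (fun x => ∑ j, ∑ l, Φ j x i l * V j l) _ (Fin.append t y) :=
    HasFDerivAt.fun_sum fun j _ => HasFDerivAt.fun_sum fun l _ =>
      (((hΦ j i l).differentiable (by norm_num)) _).hasFDerivAt.mul_const _
  simp only [pdF, Finset.sum_apply, mulVec, dotProduct]
  rw [fderiv_comp_append (h := fun x => ∑ j, ∑ l, Φ j x i l * V j l), h.fderiv]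
  · simp only [_root_.sum_apply, _root_.smul_apply, mpd, Matrix.of_apply, smul_eq_mul]
    exact Finset.sum_congr rfl fun j _ => Finset.sum_congr rfl fun l _ => mul_comm _ _
  · exact (ContDiff.sum fun j _ => ContDiff.sum fun l _ =>
      (hΦ j i l).mul contDiff_const).differentiable (by norm_num)

theorem gradM_eq_Theta01 {g : (Fin (n0 + n1) → ℝ) → Matrix (Fin d) (Fin d) ℝ} (hg : MatCD 2 g)
    (hgpos : ∀ x, (g x).PosDef) (t : Fin n0 → ℝ) (V : Fin n0 → Fin d → ℝ)
    {F : (Fin n1 → ℝ) → Fin d → ℝ}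
    (hF : ∀ y, F y = ∑ j, ((g (Fin.append t y))⁻¹
      * mpd (Fin.castAdd n1 j) g (Fin.append t y)).mulVec (V j)) (y : Fin n1 → ℝ) :
    gradM F y = Theta01 g (Fin.append t y) V := by
  ext1 k
  rw [gradM, show F = _ from funext hF, pdF_sum_mulVec
    (Φ := fun j x => (g x)⁻¹ * mpd (Fin.castAdd n1 j) g x)
    (fun j => (hg.one_of_two.inv hgpos).mul (hg.mpd _))]
  simp only [mpd_inv_mul_mpd hg hgpos, Theta01]

end Append

section Block
set_option maxSynthPendingDepth 3
open scoped InnerProductSpace Topology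
open Filter

variable {n0 n1 d : ℕ} {g : (Fin (n0 + n1) → ℝ) → Matrix (Fin d) (Fin d) ℝ}

theorem Theta11Mat_mulVec_toVec (x : Fin (n0 + n1) → ℝ) (W : Fin n1 → Fin d → ℝ) :
    Theta11Mat g x *ᵥ toVec W = toVec (Theta11 g x W) := by
  ext p
  simp [toVec, Theta11, Theta11Mat, mulVec, dotProduct, Fintype.sum_prod_type, Finset.sum_apply]

theorem minner_comm {n : ℕ} {a : Matrix (Fin d) (Fin d) ℝ} (ha : aᵀ = a)
    (U V : Fin n → Fin d → ℝ) : minner a U V = minner a V U :=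
  Finset.sum_congr rfl fun k _ => by
    rw [dotProduct_comm, dotProduct_mulVec, ← mulVec_transpose, ha]

/-- The solution `Z` of `-Θ₁₁ Z = R`. -/
def solveTheta11 (g : (Fin (n0 + n1) → ℝ) → Matrix (Fin d) (Fin d) ℝ) (x : Fin (n0 + n1) → ℝ)
    (R : Fin n1 → Fin d → ℝ) : Fin n1 → Fin d → ℝ :=
  ofVec ((-Theta11Mat g x)⁻¹ *ᵥ toVec R)

theorem Theta11_solveTheta11 {x : Fin (n0 + n1) → ℝ} (h : IsUnit (Theta11Mat g x).det)
    (R : Fin n1 → Fin d → ℝ) : Theta11 g x (solveTheta11 g x R) = -R := by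
  have h1 : toVec (Theta11 g x (solveTheta11 g x R)) = -toVec R := by
    rw [← Theta11Mat_mulVec_toVec]
    have h2 : IsUnit (-Theta11Mat g x).det := by
      rw [Matrix.det_neg]
      exact ((isUnit_one.neg).pow _).mul h
    have h3 : toVec (solveTheta11 g x R) = (-Theta11Mat g x)⁻¹ *ᵥ toVec R := rfl
    rw [h3, ← neg_neg (Theta11Mat g x), neg_mulVec, neg_neg, mulVec_mulVec,
      Matrix.mul_nonsing_inv _ h2, one_mulVec]
  ext k i
  exact congrFun h1 (k, i)

theorem thetaForm_castAdd_natAdd (x : Fin (n0 + n1) → ℝ) (V : Fin n0 → Fin d → ℝ)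
    (u : Fin n1 → Fin d → ℝ) :
    thetaForm g x (Fin.castAdd n1) (Fin.natAdd n0) V u = -minner (g x) (Theta01 g x V) u :=
  thetaForm_eq_minner ..

theorem thetaForm_natAdd_solveTheta11 {x : Fin (n0 + n1) → ℝ}
    (h : IsUnit (Theta11Mat g x).det) (R u : Fin n1 → Fin d → ℝ) :
    thetaForm g x (Fin.natAdd n0) (Fin.natAdd n0) (solveTheta11 g x R) u
      = minner (g x) R u := by
  refine (thetaForm_eq_minner ..).trans ?_
  have : (fun b => ∑ a, theta g (Fin.natAdd n0 a) (Fin.natAdd n0 b) x *ᵥ solveTheta11 g x R a)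
      = -R := Theta11_solveTheta11 h R
  rw [this]
  simp [minner, mulVec_neg]

theorem thetaForm_sumElim_eq (hg : MatCD 2 g) (hgpos : ∀ x, (g x).PosDef)
    {x : Fin (n0 + n1) → ℝ} (h : IsUnit (Theta11Mat g x).det) (V : Fin n0 → Fin d → ℝ)
    (u : Fin n1 → Fin d → ℝ) :
    thetaForm g x (Sum.elim (Fin.castAdd n1) (Fin.natAdd n0))
        (Sum.elim (Fin.castAdd n1) (Fin.natAdd n0)) (Sum.elim V u) (Sum.elim V u)
      = thetaForm g x (Fin.castAdd n1) (Fin.castAdd n1) V V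
        - minner (g x) (solveTheta11 g x (Theta01 g x V)) (Theta01 g x V)
        + thetaForm g x (Fin.natAdd n0) (Fin.natAdd n0)
          (u - solveTheta11 g x (Theta01 g x V)) (u - solveTheta11 g x (Theta01 g x V)) := by
  rw [thetaForm_sumElim, thetaForm_sub_sub,
    thetaForm_comm hg hgpos x (Fin.natAdd n0) (Fin.castAdd n1),
    thetaForm_comm hg hgpos x _ _ u (solveTheta11 g x _), thetaForm_castAdd_natAdd,
    thetaForm_natAdd_solveTheta11 h, thetaForm_natAdd_solveTheta11 h,
    minner_comm (transpose_of_posDef hgpos x) (solveTheta11 g x _)]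
  ring

theorem minner_solveTheta11_nonneg (hg : MatCD 2 g) (hgpos : ∀ x, (g x).PosDef)
    (hglc : NLogConcave g) {x : Fin (n0 + n1) → ℝ} (h : IsUnit (Theta11Mat g x).det)
    (R : Fin n1 → Fin d → ℝ) : 0 ≤ minner (g x) (solveTheta11 g x R) R := by
  rw [minner_comm (transpose_of_posDef hgpos x), ← thetaForm_natAdd_solveTheta11 h]
  exact thetaForm_self_nonneg hg hgpos hglc _ _ _

theorem minner_solveTheta11_le (hg : MatCD 2 g) (hgpos : ∀ x, (g x).PosDef)
    (hglc : NLogConcave g) {x : Fin (n0 + n1) → ℝ} (h : IsUnit (Theta11Mat g x).det)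
    (V : Fin n0 → Fin d → ℝ) (u : Fin n1 → Fin d → ℝ) :
    thetaForm g x (Fin.castAdd n1) (Fin.castAdd n1) V V
        - minner (g x) (solveTheta11 g x (Theta01 g x V)) (Theta01 g x V)
      ≤ thetaForm g x (Sum.elim (Fin.castAdd n1) (Fin.natAdd n0))
        (Sum.elim (Fin.castAdd n1) (Fin.natAdd n0)) (Sum.elim V u) (Sum.elim V u) := by
  rw [thetaForm_sumElim_eq hg hgpos h]
  exact le_add_of_nonneg_right (thetaForm_self_nonneg hg hgpos hglc _ _ _)

theorem minner_solveTheta11_le_thetaForm (hg : MatCD 2 g) (hgpos : ∀ x, (g x).PosDef)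
    (hglc : NLogConcave g) {x : Fin (n0 + n1) → ℝ} (h : IsUnit (Theta11Mat g x).det)
    (V : Fin n0 → Fin d → ℝ) :
    minner (g x) (solveTheta11 g x (Theta01 g x V)) (Theta01 g x V)
      ≤ thetaForm g x (Fin.castAdd n1) (Fin.castAdd n1) V V := by
  have := thetaForm_self_nonneg hg hgpos hglc x (Sum.elim (Fin.castAdd n1) (Fin.natAdd n0))
    (Sum.elim V (solveTheta11 g x (Theta01 g x V)))
  rw [thetaForm_sumElim_eq hg hgpos h, sub_self] at this
  simpa [thetaForm] using this

theorem continuous_minner_solveTheta11 (hg : MatCD 2 g) (hgpos : ∀ x, (g x).PosDef)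
    {X : Type*} [TopologicalSpace X] {φ : X → Fin (n0 + n1) → ℝ} (hφ : Continuous φ)
    (h : ∀ y, IsUnit (Theta11Mat g (φ y)).det) (V : Fin n0 → Fin d → ℝ) :
    Continuous fun y => minner (g (φ y)) (solveTheta11 g (φ y) (Theta01 g (φ y) V))
      (Theta01 g (φ y) V) := by
  have hθ : ∀ j k, Continuous fun y => theta g j k (φ y) := fun j k =>
    (continuous_theta hg hgpos j k).comp hφ
  have hR : ∀ k, Continuous fun y => Theta01 g (φ y) V k := fun k =>
    continuous_finsetSum _ fun j _ => (hθ _ _).matrix_mulVec continuous_const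
  have hM : Continuous fun y => -Theta11Mat g (φ y) :=
    (continuous_matrix fun p q => (hθ _ _).matrix_elem _ _).neg
  have hne : ∀ y, (-Theta11Mat g (φ y)).det ≠ 0 := fun y => by
    rw [Matrix.det_neg]
    exact mul_ne_zero (pow_ne_zero _ (by norm_num)) (h y).ne_zero
  have hI : Continuous fun y => (-Theta11Mat g (φ y))⁻¹ := by
    simp only [Matrix.inv_def, Ring.inverse_eq_inv']
    exact (hM.matrix_det.inv₀ hne).smul hM.matrix_adjugate
  have hgc : Continuous fun y => g (φ y) :=
    continuous_matrix fun i j => (hg i j).continuous.comp hφ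
  have hv : Continuous fun y => (-Theta11Mat g (φ y))⁻¹ *ᵥ toVec (Theta01 g (φ y) V) :=
    hI.matrix_mulVec (continuous_pi fun p => (continuous_apply p.2).comp (hR p.1))
  have hZ : ∀ k, Continuous fun y => solveTheta11 g (φ y) (Theta01 g (φ y) V) k := fun k =>
    continuous_pi fun i => (continuous_apply (k, i)).comp hv
  exact continuous_finsetSum _ fun k _ => (hgc.matrix_mulVec (hZ k)).dotProduct (hR k)

end Block

/-- **Local form of the matrix Prékopa inequality**: combining the block inequality with the
computation of `Θ^α`, for fixed `t`, `V₀`, and `F(y) = Σ_j (g⁻¹ ∂_{t_j} g)(t,y) v_j`,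
`⟨−Θ^α V₀,V₀⟩ ≥ ∫ ⟨(−Θ^g_{1,1})⁻¹ ∇_y F, ∇_y F⟩ dy − ∫ ‖F − α⁻¹∫ gF‖²_g dy`. -/
theorem local_matrix_prekopa (n0 n1 d : ℕ)
    (g : (Fin (n0 + n1) → ℝ) → Matrix (Fin d) (Fin d) ℝ)
    (hg : MatCD 2 g) (hgpos : ∀ x, (g x).PosDef) (hglc : NLogConcave g)
    (hgint : ∀ (t : Fin n0 → ℝ) (i k : Fin d),
      Integrable fun y : Fin n1 → ℝ => g (Fin.append t y) i k)
    (α : (Fin n0 → ℝ) → Matrix (Fin d) (Fin d) ℝ)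
    (hα_def : ∀ t i k, α t i k = ∫ y : Fin n1 → ℝ, g (Fin.append t y) i k)
    (hα : MatCD 2 α) (hαpos : ∀ t, (α t).PosDef)
    (hα1 : ∀ (t : Fin n0 → ℝ) (j : Fin n0) (i k : Fin d),
      mpd j α t i k = ∫ y : Fin n1 → ℝ, mpd (Fin.castAdd n1 j) g (Fin.append t y) i k)
    (hα2 : ∀ (t : Fin n0 → ℝ) (j l : Fin n0) (i k : Fin d),
      mpd l (mpd j α) t i k =
        ∫ y : Fin n1 → ℝ,
          mpd (Fin.castAdd n1 l) (mpd (Fin.castAdd n1 j) g) (Fin.append t y) i k)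
    (t : Fin n0 → ℝ) (V0 : Fin n0 → Fin d → ℝ)
    (hinv : ∀ y : Fin n1 → ℝ, IsUnit (Theta11Mat g (Fin.append t y)).det)
    (F : (Fin n1 → ℝ) → Fin d → ℝ)
    (hF : ∀ y, F y = ∑ j, ((g (Fin.append t y))⁻¹
      * mpd (Fin.castAdd n1 j) g (Fin.append t y)).mulVec (V0 j)) :
    -minner (α t) (ThetaOp α t V0) V0
      ≥ (∫ y : Fin n1 → ℝ,
            minner (g (Fin.append t y))
              (ofVec ((-Theta11Mat g (Fin.append t y))⁻¹.mulVec (toVec (gradM F y))))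
              (gradM F y))
        - ∫ y : Fin n1 → ℝ,
            vnormSq (g (Fin.append t y))
              (F y - (α t)⁻¹.mulVec (∫ z : Fin n1 → ℝ, (g (Fin.append t z)).mulVec (F z))) := by
  have hdefα : α = fun t => Matrix.of fun i k => ∫ y : Fin n1 → ℝ, g (Fin.append t y) i k :=
    funext fun t => Matrix.ext fun i k => hα_def t i k
  have hR := gradM_eq_Theta01 hg hgpos t V0 hF
  set f : Fin n1 → Fin (n0 + n1) → ℝ := fun i => Pi.single (Fin.natAdd n0 i) 1 with hf
  have hJ : ∀ (s : Fin n0 → ℝ) (y : Fin n1 → ℝ),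
      inclLeft n0 n1 s + ∑ i, y i • f i = Fin.append s y := inclLeft_add_sum
  let w : (Fin n1 → ℝ) → EuclideanSpace ℝ (Fin d) := fun y =>
    WithLp.toLp 2 (g (Fin.append t y) *ᵥ F y)
  let B : (Fin n1 → ℝ) → ℝ := fun y => minner (g (Fin.append t y))
    (solveTheta11 g (Fin.append t y) (Theta01 g (Fin.append t y) V0))
    (Theta01 g (Fin.append t y) V0)
  have hJe : (fun j => inclLeft n0 n1 (Pi.single j 1))
      = fun j => Pi.single (Fin.castAdd n1 j) (1 : ℝ) := funext fun j => inclLeft_single j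
  have hq0 : ∀ y, schurQ (fun x => opM (g x)) (inclLeft n0 n1 t + ∑ i, y i • f i)
      (fun j => inclLeft n0 n1 (Pi.single j 1)) (fun j => WithLp.toLp 2 (V0 j))
      = thetaForm g (Fin.append t y) (Fin.castAdd n1) (Fin.castAdd n1) V0 V0 := fun y => by
    rw [hJ, hJe, schurQ_opM hg hgpos]
  have hw : ∀ y, w y = firstVar (fun x => opM (g x)) (inclLeft n0 n1 t + ∑ i, y i • f i)
      (fun j => inclLeft n0 n1 (Pi.single j 1)) fun j => WithLp.toLp 2 (V0 j) := fun y => by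
    rw [hJ, hJe]
    simp only [w, firstVar, fderiv_opM hg.one_of_two, opM_toLp, hF, mulVec_sum, mulVec_mulVec,
      ← mul_assoc, mul_inv_cancel_of_posDef (hgpos _), one_mul]
    exact map_sum (WithLp.linearEquiv 2 ℝ (Fin d → ℝ)).symm _ _
  have main := integral_sub_variance_le_schurQ (G := fun x => opM (g x)) (J := inclLeft n0 n1)
    (f := f) (α := fun t => opM (α t)) (contDiff_opM hg) (fun x => posDefOp_opM (hgpos x))
    (fun x e v => schurQ_opM_nonneg hg hgpos hglc x e v)
    (fun s => by simpa only [hJ] using integrable_opM (hgint s)) (contDiff_opM hα)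
    (fun s => by simp only [hJ, integral_opM (hgint s), hdefα]) t
    (fun j => Pi.single j 1) (fun j => WithLp.toLp 2 (V0 j)) (w := w) hw (B := B)
    (continuous_minner_solveTheta11 hg hgpos (continuous_append t) hinv V0)
    (fun y => minner_solveTheta11_nonneg hg hgpos hglc (hinv y) _)
    (fun y u => by
      rw [hq0]
      refine (minner_solveTheta11_le hg hgpos hglc (hinv y) V0 fun k => WithLp.ofLp (u k)).trans
        (le_of_eq ?_)
      rw [← schurQ_opM hg hgpos, hJ, hJe]
      congr 1
      · ext1 a
        cases a <;> rfl
      · ext1 a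
        cases a <;> rfl)
    (fun y => by
      rw [hq0]
      exact minner_solveTheta11_le_thetaForm hg hgpos hglc (hinv y) V0)
  have hint : ∫ z, w z = WithLp.toLp 2 (∫ z : Fin n1 → ℝ, g (Fin.append t z) *ᵥ F z) :=
    (PiLp.continuousLinearEquiv 2 ℝ fun _ : Fin d => ℝ).symm.integral_comp_comm _
  have hL : schurQ (fun t => opM (α t)) t (fun j => Pi.single j 1)
      (fun j => WithLp.toLp 2 (V0 j)) = -minner (α t) (ThetaOp α t V0) V0 :=
    (schurQ_opM hα hαpos t id V0).trans (thetaForm_eq_minner ..)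
  have hV : ∀ y, inner ℝ (opM (g (inclLeft n0 n1 t + ∑ i, y i • f i))
      (Ring.inverse (opM (g (inclLeft n0 n1 t + ∑ i, y i • f i))) (w y)
        - Ring.inverse (opM (α t)) (∫ z, w z)))
      (Ring.inverse (opM (g (inclLeft n0 n1 t + ∑ i, y i • f i))) (w y)
        - Ring.inverse (opM (α t)) (∫ z, w z))
      = vnormSq (g (Fin.append t y))
        (F y - (α t)⁻¹ *ᵥ ∫ z : Fin n1 → ℝ, g (Fin.append t z) *ᵥ F z) := fun y => by
    rw [hJ, inverse_opM (hgpos _), inverse_opM (hαpos _), hint, opM_toLp, opM_toLp, mulVec_mulVec,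
      inv_mul_cancel_of_posDef (hgpos _), one_mulVec, ← WithLp.toLp_sub, opM_toLp, inner_toLp,
      vnormSq]
  simp only [hR]
  rw [hL] at main
  simp only [hV] at main
  exact main

end
end

section
/- (Prékopa's theorem.) Let g : ℝ^(n0+n1) → ℝ_{≥0} be a log-concave function (i.e., g = e^{−φ} with φ : ℝ^(n0+n1) → ℝ ∪ {+∞} convex) such that ∫_{ℝ^{n1}} g(t,y) dy < ∞ for every t ∈ ℝ^{n0}. Then the function α(t) := ∫_{ℝ^{n1}} g(t,y) dy is log-concave on ℝ^{n0}, i.e., α(λs + (1−λ)t) ≥ α(s)^λ α(t)^{1−λ} for all s, t ∈ ℝ^{n0} and λ ∈ [0,1]. -/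
open Matrix MeasureTheory

noncomputable section

open scoped ENNReal Pointwise

section PrekopaLeindler

lemma Real.volume_add_le_volume_add_of_isCompact {A B : Set ℝ} (hA : IsCompact A)
    (hB : IsCompact B) (hAn : A.Nonempty) (hBn : B.Nonempty) :
    volume A + volume B ≤ volume (A + B) := by
  obtain ⟨a, haA, ha⟩ := hA.exists_isGreatest hAn
  obtain ⟨b, hbB, hb⟩ := hB.exists_isLeast hBn
  have h1 : volume (A + {b}) = volume A := by simp [Set.add_singleton]
  have h2 : volume ({a} + B) = volume B := by simp [Set.singleton_add]
  have hd : AEDisjoint volume (A + {b}) ({a} + B) := by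
    refine measure_mono_null (t := {a + b}) ?_ (by simp)
    rintro _ ⟨⟨x, hx, _, rfl, rfl⟩, ⟨_, rfl, y, hy, hxy⟩⟩
    have := ha hx
    have := hb hy
    simp only [Set.mem_singleton_iff] at *
    linarith
  have hm : NullMeasurableSet ({a} + B) (volume : Measure ℝ) :=
    ((isCompact_singleton.add hB).measurableSet).nullMeasurableSet
  rw [← h1, ← h2, ← measure_union₀ hm hd]
  exact measure_mono (Set.union_subset
    (Set.add_subset_add_left (by simpa using hbB)) (Set.add_subset_add_right (by simpa using haA)))

/-- The one-dimensional **Brunn–Minkowski inequality**. -/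
lemma Real.volume_add_le_volume_add {A B : Set ℝ} (hA : MeasurableSet A)
    (hB : MeasurableSet B) (hAn : A.Nonempty) (hBn : B.Nonempty) :
    volume A + volume B ≤ volume (A + B) := by
  rw [hA.measure_eq_iSup_isCompact, hB.measure_eq_iSup_isCompact]
  simp_rw [iSup_and']
  refine ENNReal.biSup_add_biSup_le' ⟨∅, by simp⟩ ⟨∅, by simp⟩ ?_
  rintro K ⟨hKA, hK⟩ L ⟨hLB, hL⟩
  rcases K.eq_empty_or_nonempty with rfl | hKn
  · obtain ⟨a, ha⟩ := hAn
    have : volume ({a} + L) = volume L := by simp [Set.singleton_add]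
    rw [measure_empty, zero_add, ← this]
    exact measure_mono (Set.add_subset_add (by simpa using ha) hLB)
  rcases L.eq_empty_or_nonempty with rfl | hLn
  · obtain ⟨b, hb⟩ := hBn
    have : volume (K + {b}) = volume K := by simp [Set.add_singleton]
    rw [measure_empty, add_zero, ← this]
    exact measure_mono (Set.add_subset_add hKA (by simpa using hb))
  · exact (Real.volume_add_le_volume_add_of_isCompact hK hL hKn hLn).trans
      (measure_mono (Set.add_subset_add hKA hLB))

lemma ENNReal.geom_mean_le_arith_mean2_weighted {l m : ℝ} (hl : 0 < l) (hm : 0 < m)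
    (hlm : l + m = 1) (a b : ℝ≥0∞) :
    a ^ l * b ^ m ≤ ENNReal.ofReal l * a + ENNReal.ofReal m * b := by
  rcases eq_or_ne a ∞ with rfl | ha
  · simp [ENNReal.mul_top, hl]
  rcases eq_or_ne b ∞ with rfl | hb
  · simp [ENNReal.mul_top, hm]
  have := Real.geom_mean_le_arith_mean2_weighted hl.le hm.le
    (ENNReal.toReal_nonneg (a := a)) (ENNReal.toReal_nonneg (a := b)) hlm
  have h := ENNReal.ofReal_le_ofReal this
  rwa [ENNReal.ofReal_mul (by positivity), ENNReal.ofReal_add (by positivity) (by positivity),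
    ENNReal.ofReal_mul hl.le, ENNReal.ofReal_mul hm.le,
    ← ENNReal.ofReal_rpow_of_nonneg ENNReal.toReal_nonneg hl.le,
    ← ENNReal.ofReal_rpow_of_nonneg ENNReal.toReal_nonneg hm.le,
    ENNReal.ofReal_toReal ha, ENNReal.ofReal_toReal hb] at h

lemma ENNReal.iSup_rpow {ι : Type*} (u : ι → ℝ≥0∞) {l : ℝ} (hl : 0 < l) :
    (⨆ i, u i) ^ l = ⨆ i, u i ^ l :=
  (ENNReal.orderIsoRpow l hl).map_iSup u

lemma lintegral_eq_lintegral_meas_ofReal_lt {Ω : Type*} [MeasurableSpace Ω] (μ : Measure Ω)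
    {f : Ω → ℝ≥0∞} (hf : Measurable f) (hf' : ∀ x, f x ≠ ∞) :
    ∫⁻ x, f x ∂μ = ∫⁻ t in Set.Ioi (0 : ℝ), μ {x | ENNReal.ofReal t < f x} := by
  have := lintegral_eq_lintegral_meas_lt μ (f := fun x => (f x).toReal)
    (Filter.Eventually.of_forall fun x => ENNReal.toReal_nonneg) hf.ennreal_toReal.aemeasurable
  simp_rw [ENNReal.ofReal_toReal (hf' _)] at this
  rw [this]
  refine setLIntegral_congr_fun measurableSet_Ioi fun t ht => ?_
  have ht : 0 < t := ht
  simp only [ENNReal.ofReal_lt_iff_lt_toReal ht.le (hf' _)]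

variable {l m : ℝ}

lemma Real.arith_mean_lintegral_le_lintegral (hl : 0 < l) (hm : 0 < m) (hlm : l + m = 1)
    {f g h : ℝ → ℝ≥0∞} (hf : Measurable f) (hg : Measurable g) (hh : Measurable h)
    (hf1 : ⨆ x, f x = 1) (hg1 : ⨆ x, g x = 1)
    (hfgh : ∀ x y, f x ^ l * g y ^ m ≤ h (l • x + m • y)) :
    ENNReal.ofReal l * (∫⁻ x, f x) + ENNReal.ofReal m * (∫⁻ x, g x) ≤ ∫⁻ x, h x := by
  have hfle : ∀ x, f x ≤ 1 := fun x => hf1 ▸ le_iSup f x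
  have hgle : ∀ x, g x ≤ 1 := fun x => hg1 ▸ le_iSup g x
  refine le_trans ?_ (lintegral_mono (fun x => min_le_left (h x) 1))
  rw [lintegral_eq_lintegral_meas_ofReal_lt _ hf fun x => ((hfle x).trans_lt (by simp)).ne,
    lintegral_eq_lintegral_meas_ofReal_lt _ hg fun x => ((hgle x).trans_lt (by simp)).ne,
    lintegral_eq_lintegral_meas_ofReal_lt _ (hh.min measurable_const)
      fun x => ((min_le_right (h x) 1).trans_lt (by simp)).ne,
    ← lintegral_const_mul' _ _ (by simp), ← lintegral_const_mul' _ _ (by simp)]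
  refine (le_lintegral_add _ _).trans (setLIntegral_mono' measurableSet_Ioi fun t ht => ?_)
  have ht : 0 < t := ht
  rcases le_or_gt 1 t with ht1 | ht1
  · have hA : ∀ x, ¬ ENNReal.ofReal t < f x := fun x =>
      not_lt.2 ((hfle x).trans (by simpa using ht1))
    have hB : ∀ x, ¬ ENNReal.ofReal t < g x := fun x =>
      not_lt.2 ((hgle x).trans (by simpa using ht1))
    simp [hA, hB]
  have ht1' : ENNReal.ofReal t < 1 := by simpa using ht1
  have hA : {x | ENNReal.ofReal t < f x}.Nonempty := lt_iSup_iff.1 (ht1'.trans_eq hf1.symm)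
  have hB : {x | ENNReal.ofReal t < g x}.Nonempty := lt_iSup_iff.1 (ht1'.trans_eq hg1.symm)
  have hAm : MeasurableSet {x | ENNReal.ofReal t < f x} := measurableSet_lt measurable_const hf
  have hBm : MeasurableSet {x | ENNReal.ofReal t < g x} := measurableSet_lt measurable_const hg
  have key := Real.volume_add_le_volume_add (hAm.const_smul_of_ne_zero hl.ne')
    (hBm.const_smul_of_ne_zero hm.ne') (hA.smul_set (a := l)) (hB.smul_set (a := m))
  rw [Measure.addHaar_smul_of_nonneg _ hl.le, Measure.addHaar_smul_of_nonneg _ hm.le] at key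
  simp only [Module.finrank_self, pow_one] at key
  refine key.trans (measure_mono ?_)
  rintro _ ⟨_, ⟨x, hx, rfl⟩, _, ⟨y, hy, rfl⟩, rfl⟩
  have ht0 : ENNReal.ofReal t ≠ 0 := by simpa using ht
  refine lt_min (lt_of_lt_of_le ?_ (hfgh x y)) ht1'
  calc ENNReal.ofReal t = ENNReal.ofReal t ^ l * ENNReal.ofReal t ^ m := by
        rw [← ENNReal.rpow_add _ _ ht0 (by simp), hlm, ENNReal.rpow_one]
    _ < f x ^ l * g y ^ m := ENNReal.mul_lt_mul (ENNReal.rpow_lt_rpow hx hl)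
        (ENNReal.rpow_lt_rpow hy hm)

lemma Real.geom_mean_lintegral_le_lintegral_of_iSup_ne_top (hl : 0 < l) (hm : 0 < m)
    (hlm : l + m = 1) {f g h : ℝ → ℝ≥0∞} (hf : Measurable f) (hg : Measurable g)
    (hh : Measurable h) (hf1 : ⨆ x, f x ≠ ∞) (hg1 : ⨆ x, g x ≠ ∞)
    (hfgh : ∀ x y, f x ^ l * g y ^ m ≤ h (l • x + m • y)) :
    (∫⁻ x, f x) ^ l * (∫⁻ x, g x) ^ m ≤ ∫⁻ x, h x := by
  set a := ⨆ x, f x with ha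
  set b := ⨆ x, g x with hb
  rcases eq_or_ne a 0 with ha0 | ha0
  · have : ∀ x, f x = 0 := fun x => le_antisymm (ha0 ▸ le_iSup f x) bot_le
    simp [this, hl]
  rcases eq_or_ne b 0 with hb0 | hb0
  · have : ∀ x, g x = 0 := fun x => le_antisymm (hb0 ▸ le_iSup g x) bot_le
    simp [this, hm]
  have hal0 : a ^ l ≠ 0 := by simp [ENNReal.rpow_eq_zero_iff, ha0, hf1]
  have hbm0 : b ^ m ≠ 0 := by simp [ENNReal.rpow_eq_zero_iff, hb0, hg1]
  have halt : a ^ l ≠ ∞ := ENNReal.rpow_ne_top_of_nonneg hl.le hf1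
  have hbmt : b ^ m ≠ ∞ := ENNReal.rpow_ne_top_of_nonneg hm.le hg1
  have hc0 : a ^ l * b ^ m ≠ 0 := mul_ne_zero hal0 hbm0
  have hct : a ^ l * b ^ m ≠ ∞ := ENNReal.mul_ne_top halt hbmt
  have hmul : ∀ u v : ℝ≥0∞, (a⁻¹ * u) ^ l * (b⁻¹ * v) ^ m =
      (a ^ l * b ^ m)⁻¹ * (u ^ l * v ^ m) := fun u v => by
    rw [ENNReal.mul_rpow_of_nonneg _ _ hl.le, ENNReal.mul_rpow_of_nonneg _ _ hm.le,
      ENNReal.inv_rpow, ENNReal.inv_rpow, ENNReal.mul_inv (.inl hal0) (.inl halt)]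
    ring
  have key := Real.arith_mean_lintegral_le_lintegral hl hm hlm
    (f := fun x => a⁻¹ * f x) (g := fun x => b⁻¹ * g x) (h := fun x => (a ^ l * b ^ m)⁻¹ * h x)
    (hf.const_mul _) (hg.const_mul _) (hh.const_mul _)
    (by rw [← ENNReal.mul_iSup, ENNReal.inv_mul_cancel ha0 hf1])
    (by rw [← ENNReal.mul_iSup, ENNReal.inv_mul_cancel hb0 hg1])
    (fun x y => by rw [hmul]; gcongr; exact hfgh x y)
  have key := (ENNReal.geom_mean_le_arith_mean2_weighted hl hm hlm _ _).trans key
  rw [lintegral_const_mul _ hf, lintegral_const_mul _ hg, lintegral_const_mul _ hh, hmul] at key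
  exact (ENNReal.mul_le_mul_iff_right (ENNReal.inv_ne_zero.2 hct) (ENNReal.inv_ne_top.2 hc0)).1 key

/-- The **Prékopa–Leindler inequality**, with weights `l` and `m`, holds on `E`. -/
def PrekopaLeindler (l m : ℝ) (E : Type*) [AddCommGroup E] [Module ℝ E] [MeasureSpace E] : Prop :=
  ∀ f g h : E → ℝ≥0∞, Measurable f → Measurable g → Measurable h →
    (∀ x y, f x ^ l * g y ^ m ≤ h (l • x + m • y)) →
    (∫⁻ x, f x) ^ l * (∫⁻ x, g x) ^ m ≤ ∫⁻ x, h x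

lemma prekopaLeindler_real (hl : 0 < l) (hm : 0 < m) (hlm : l + m = 1) :
    PrekopaLeindler l m ℝ := by
  intro f g h hf hg hh hfgh
  have hsup : ∀ u : ℝ → ℝ≥0∞, Measurable u → ∫⁻ x, u x = ⨆ n : ℕ, ∫⁻ x, min (u x) n := by
    intro u hu
    rw [← lintegral_iSup (fun n => hu.min measurable_const)
      (fun i j hij x => min_le_min_left _ (by exact_mod_cast hij))]
    refine lintegral_congr fun x => ?_
    change u x = ⨆ n : ℕ, u x ⊓ (n : ℝ≥0∞)
    rw [← inf_iSup_eq, ENNReal.iSup_natCast, inf_top_eq]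
  have hmono : ∀ u : ℝ → ℝ≥0∞, Monotone fun n : ℕ => ∫⁻ x, min (u x) n := fun u i j hij =>
    lintegral_mono fun x => min_le_min_left _ (by exact_mod_cast hij)
  have hfin : ∀ (u : ℝ → ℝ≥0∞) (n : ℕ), ⨆ x, min (u x) n ≠ ∞ := fun u n =>
    ((iSup_le fun x => min_le_right _ _).trans_lt (ENNReal.natCast_lt_top n)).ne
  rw [hsup f hf, hsup g hg, ENNReal.iSup_rpow _ hl, ENNReal.iSup_rpow _ hm,
    ENNReal.iSup_mul]
  simp_rw [ENNReal.mul_iSup]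
  refine iSup₂_le fun i j => ?_
  set n := max i j
  have hi := hmono f (le_max_left i j)
  have hj := hmono g (le_max_right i j)
  refine le_trans (mul_le_mul' (ENNReal.rpow_le_rpow hi hl.le) (ENNReal.rpow_le_rpow hj hm.le)) ?_
  refine Real.geom_mean_lintegral_le_lintegral_of_iSup_ne_top hl hm hlm
    (hf.min measurable_const) (hg.min measurable_const) hh (hfin f n) (hfin g n) fun x y => ?_
  refine le_trans ?_ (hfgh x y)
  gcongr <;> exact min_le_left _ _

lemma PrekopaLeindler.prod {E F : Type*} [AddCommGroup E] [Module ℝ E] [MeasureSpace E]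
    [AddCommGroup F] [Module ℝ F] [MeasureSpace F] [SFinite (volume : Measure F)]
    (hE : PrekopaLeindler l m E) (hF : PrekopaLeindler l m F) :
    PrekopaLeindler l m (E × F) := by
  intro f g h hf hg hh hfgh
  simp_rw [Measure.volume_eq_prod]
  rw [lintegral_prod _ hf.aemeasurable, lintegral_prod _ hg.aemeasurable,
    lintegral_prod _ hh.aemeasurable]
  refine hE _ _ _ hf.lintegral_prod_right' hg.lintegral_prod_right' hh.lintegral_prod_right'
    fun x y => ?_
  exact hF _ _ _ (hf.comp measurable_prodMk_left) (hg.comp measurable_prodMk_left)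
    (hh.comp measurable_prodMk_left) fun u v => hfgh (x, u) (y, v)

lemma PrekopaLeindler.of_measurePreserving {E F : Type*} [AddCommGroup E] [Module ℝ E]
    [MeasureSpace E] [AddCommGroup F] [Module ℝ F] [MeasureSpace F]
    (hE : PrekopaLeindler l m E) (e : E ≃ᵐ F) (he : MeasurePreserving e)
    (hlin : ∀ x y, e (l • x + m • y) = l • e x + m • e y) : PrekopaLeindler l m F := by
  intro f g h hf hg hh hfgh
  rw [← he.lintegral_comp hf, ← he.lintegral_comp hg, ← he.lintegral_comp hh]
  refine hE _ _ _ (hf.comp e.measurable) (hg.comp e.measurable) (hh.comp e.measurable)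
    fun x y => ?_
  simpa only [Function.comp, hlin] using hfgh (e x) (e y)

lemma prekopaLeindler_pi (hl : 0 < l) (hm : 0 < m) (hlm : l + m = 1) (n : ℕ) :
    PrekopaLeindler l m (Fin n → ℝ) := by
  induction n with
  | zero =>
    intro f g h _ _ _ hfgh
    rw [volume_pi, Measure.pi_of_empty _ 0]
    simp only [lintegral_dirac]
    convert hfgh 0 0
  | succ n ih =>
    refine ((prekopaLeindler_real hl hm hlm).prod ih).of_measurePreserving
      (MeasurableEquiv.piFinSuccAbove (fun _ => ℝ) 0).symm
      (volume_preserving_piFinSuccAbove (fun _ => ℝ) 0).symm fun x y => ?_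
    ext i
    refine Fin.cases ?_ (fun j => ?_) i <;>
      simp [MeasurableEquiv.piFinSuccAbove, Fin.insertNthEquiv]

/-- In the Prékopa–Leindler inequality, only the majorant needs to be a.e. measurable. -/
lemma PrekopaLeindler.of_aemeasurable {E : Type*} [AddCommGroup E] [Module ℝ E] [MeasureSpace E]
    (hE : PrekopaLeindler l m E) (hl : 0 ≤ l) (hm : 0 ≤ m) {f g h : E → ℝ≥0∞}
    (hh : AEMeasurable h) (hfgh : ∀ x y, f x ^ l * g y ^ m ≤ h (l • x + m • y)) :
    (∫⁻ x, f x) ^ l * (∫⁻ x, g x) ^ m ≤ ∫⁻ x, h x := by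
  classical
  obtain ⟨f', hf'm, hf'le, hf'⟩ := exists_measurable_le_lintegral_eq volume f
  obtain ⟨g', hg'm, hg'le, hg'⟩ := exists_measurable_le_lintegral_eq volume g
  set N := toMeasurable volume {x | h x ≠ hh.mk h x} with hN
  have hN0 : volume N = 0 := by rw [hN, measure_toMeasurable]; exact hh.ae_eq_mk
  have hle : ∀ x, h x ≤ N.piecewise (fun _ => ∞) (hh.mk h) x := fun x => by
    by_cases hx : x ∈ N
    · simp [hx]
    · have : h x = hh.mk h x := by
        by_contra hne
        exact hx (subset_toMeasurable _ _ hne)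
      simp [hx, this]
  have hae : N.piecewise (fun _ => ∞) (hh.mk h) =ᵐ[volume] h := by
    filter_upwards [measure_eq_zero_iff_ae_notMem.1 hN0, hh.ae_eq_mk] with x hx hx'
    simp [hx, hx']
  rw [hf', hg', ← lintegral_congr_ae hae]
  refine hE _ _ _ hf'm hg'm (Measurable.piecewise (measurableSet_toMeasurable _ _)
    measurable_const hh.measurable_mk) fun x y => ?_
  refine le_trans ?_ ((hfgh x y).trans (hle _))
  gcongr
  exacts [hf'le x, hg'le y]

lemma Fin.append_smul_add_smul {n0 n1 : ℕ} (l m : ℝ) (s t : Fin n0 → ℝ) (x y : Fin n1 → ℝ) :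
    l • Fin.append s x + m • Fin.append t y =
      Fin.append (l • s + m • t) (l • x + m • y) := by
  ext i
  refine Fin.addCases (fun j => ?_) (fun j => ?_) i <;> simp

end PrekopaLeindler

/-- **Prékopa's theorem**: marginals of log-concave functions are log-concave. -/
theorem prekopa (n0 n1 : ℕ) (g : (Fin (n0 + n1) → ℝ) → ℝ)
    (hg0 : ∀ x, 0 ≤ g x)
    (hglc : ∀ (x y : Fin (n0 + n1) → ℝ) (l : ℝ), 0 ≤ l → l ≤ 1 →
      g x ^ l * g y ^ (1 - l) ≤ g (l • x + (1 - l) • y))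
    (hgint : ∀ t : Fin n0 → ℝ, Integrable fun y : Fin n1 → ℝ => g (Fin.append t y))
    (α : (Fin n0 → ℝ) → ℝ)
    (hα : ∀ t, α t = ∫ y : Fin n1 → ℝ, g (Fin.append t y)) :
    ∀ (s t : Fin n0 → ℝ) (l : ℝ), 0 ≤ l → l ≤ 1 →
      α s ^ l * α t ^ (1 - l) ≤ α (l • s + (1 - l) • t) := by
  intro s t l hl0 hl1
  rcases hl0.eq_or_lt with rfl | hl
  · simp
  rcases hl1.eq_or_lt with rfl | hl1
  · simp
  have hm : 0 < 1 - l := sub_pos.2 hl1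
  have hα0 : ∀ t, 0 ≤ α t := fun t => hα t ▸ integral_nonneg fun y => hg0 _
  have hαl : ∀ t, ENNReal.ofReal (α t) = ∫⁻ y, ENNReal.ofReal (g (Fin.append t y)) := fun t => by
    rw [hα, ofReal_integral_eq_lintegral_ofReal (hgint t)
      (Filter.Eventually.of_forall fun y => hg0 _)]
  rw [← ENNReal.ofReal_le_ofReal_iff (hα0 _),
    ENNReal.ofReal_mul (Real.rpow_nonneg (hα0 s) l),
    ← ENNReal.ofReal_rpow_of_nonneg (hα0 s) hl0, ← ENNReal.ofReal_rpow_of_nonneg (hα0 t) hm.le,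
    hαl, hαl, hαl]
  refine (prekopaLeindler_pi hl hm (by ring) n1).of_aemeasurable hl0 hm.le
    (hgint _).aestronglyMeasurable.aemeasurable.ennreal_ofReal fun x y => ?_
  rw [ENNReal.ofReal_rpow_of_nonneg (hg0 _) hl0, ENNReal.ofReal_rpow_of_nonneg (hg0 _) hm.le,
    ← ENNReal.ofReal_mul (Real.rpow_nonneg (hg0 _) l), ← Fin.append_smul_add_smul]
  exact ENNReal.ofReal_le_ofReal (hglc _ _ l hl0 hl1.le)
end
end
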